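/- Let m, s, r be positive integers. For every ϑ > 0 there exists ε₀ > 0 such that for every ε ∈ (0, ε₀] there exists C such that the following holds. Let G be a graph on nr vertices and let (V_{ij}) be a collection of pairwise disjoint n-vertex subsets of V(G), indexed by i ∈ [m] and 1 ≤ j ≤ s*(i), where each s*(i) ≤ s and r = s*(1) + … + s*(m). Suppose that for all i ≠ i' and all valid j, j', the pair (V_{ij}, V_{i'j'}) is (ε, d, ϑ)-super-regular in G for some d ≥ ϑ. Then for p = C·n^{−2/s}·(log n)^{2/(s(s−1))}, with high probability (as n → ∞) the graph G ∪ G_{nr,p} contains a K_r-factor. -/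

import Mathlib

open Finset
open scoped Classical

/-- The degree of a vertex (number of neighbours). -/
noncomputable def degR {V : Type*} (G : SimpleGraph V) (v : V) : ℕ :=
  Nat.card (G.neighborSet v)

/-- The number of edges of a graph on `Fin n`. -/
noncomputable def edgeCount {n : ℕ} (H : SimpleGraph (Fin n)) : ℕ := Nat.card H.edgeSet

/-- The probability that the binomial random graph `G_{n,p}` satisfies the property `P`. -/
noncomputable def Pr (n : ℕ) (p : ℝ) (P : SimpleGraph (Fin n) → Prop) : ℝ :=
  ∑ H : SimpleGraph (Fin n),
    if P H then p ^ edgeCount H * (1 - p) ^ (n.choose 2 - edgeCount H) else 0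

/-- `G` has a `K_r`-factor: a partition of the vertex set into `r`-cliques. -/
def HasCliqueFactor {n : ℕ} (G : SimpleGraph (Fin n)) (r : ℕ) : Prop :=
  ∃ P : Finpartition (Finset.univ : Finset (Fin n)), ∀ c ∈ P.parts, G.IsNClique r c

/-- The threshold function `p_s(n)`: `log n / n` if `s = 2` and `n^{-φ(s)}` with
`φ(s) = 2s/((s-1)(s+2))` if `s ≥ 3`. -/
noncomputable def pThr (s n : ℕ) : ℝ :=
  if s = 2 then Real.log n / n
  else (n : ℝ) ^ (-(2 * (s : ℝ)) / (((s : ℝ) - 1) * ((s : ℝ) + 2)))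

/-- The number of edges of `G` within the vertex set `S`. -/
noncomputable def edgesIn {V : Type*} (G : SimpleGraph V) (S : Set V) : ℕ :=
  Nat.card {e : Sym2 V // e ∈ G.edgeSet ∧ ∀ v ∈ e, v ∈ S}

/-- The number of ordered adjacent pairs between `S` and `T`. -/
noncomputable def edgesBtw {V : Type*} (G : SimpleGraph V) (S T : Set V) : ℕ :=
  Nat.card {p : V × V // p.1 ∈ S ∧ p.2 ∈ T ∧ G.Adj p.1 p.2}

/-- The edge density of the pair `(S, T)` in `G`. -/
noncomputable def density {V : Type*} (G : SimpleGraph V) (S T : Set V) : ℝ :=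
  (edgesBtw G S T : ℝ) / ((S.ncard : ℝ) * (T.ncard : ℝ))

/-- The pair `(S, T)` is `(ε, d)`-regular in `G`. -/
def IsRegularPair {V : Type*} (G : SimpleGraph V) (S T : Set V) (ε d : ℝ) : Prop :=
  ∀ X ⊆ S, ∀ Y ⊆ T, ε * S.ncard ≤ (X.ncard : ℝ) → ε * T.ncard ≤ (Y.ncard : ℝ) →
    |density G X Y - d| < ε

/-- The pair `(S, T)` is `(ε, d, ϑ)`-super-regular in `G`. -/
def IsSuperRegularPair {V : Type*} (G : SimpleGraph V) (S T : Set V) (ε d ϑ : ℝ) : Prop :=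
  IsRegularPair G S T ε d ∧
  (∀ v ∈ S, ϑ * T.ncard ≤ ((T ∩ G.neighborSet v).ncard : ℝ)) ∧
  (∀ v ∈ T, ϑ * S.ncard ≤ ((S ∩ G.neighborSet v).ncard : ℝ))

section weights
variable {X : Type*} [Fintype X] [DecidableEq X]

/-- Bernoulli product weight of a configuration. -/
noncomputable def wt (P : X → ℝ) (W : Finset X) : ℝ := ∏ x, if x ∈ W then P x else 1 - P x

/-- Expectation under the Bernoulli product measure. -/
noncomputable def Ex (P : X → ℝ) (f : Finset X → ℝ) : ℝ := ∑ W : Finset X, wt P W * f W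

def bsupp (b : X → Bool) : Finset X := univ.filter fun x => b x = true

def bEquiv : (X → Bool) ≃ Finset X where
  toFun := bsupp
  invFun W := fun x => decide (x ∈ W)
  left_inv b := by ext x; simp [bsupp]
  right_inv W := by ext x; simp [bsupp]

def bw (p : ℝ) (b : Bool) : ℝ := if b = true then p else 1 - p

lemma Ex_eq_bool (P : X → ℝ) (f : Finset X → ℝ) :
    Ex P f = ∑ b : X → Bool, (∏ x, bw (P x) (b x)) * f (bsupp b) := by
  unfold Ex
  rw [← Equiv.sum_comp (bEquiv (X := X))]
  refine Finset.sum_congr rfl fun b _ => ?_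
  simp only [bEquiv, Equiv.coe_fn_mk, wt, bw, bsupp, mem_filter, mem_univ, true_and]

lemma bool_op (op : Bool → Bool → Bool) (u1 u2 : X → Bool → ℝ) (f : (X → Bool) → ℝ) :
    ∑ b1 : X → Bool, ∑ b2 : X → Bool, (∏ x, u1 x (b1 x)) * (∏ x, u2 x (b2 x)) *
      f (fun x => op (b1 x) (b2 x)) =
    ∑ b : X → Bool, (∏ x, ∑ c : Bool × Bool,
      if op c.1 c.2 = b x then u1 x c.1 * u2 x c.2 else 0) * f b := by
  have h1 : ∀ b : X → Bool, (∏ x, ∑ c : Bool × Bool,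
      if op c.1 c.2 = b x then u1 x c.1 * u2 x c.2 else 0) =
      ∑ c : X → Bool × Bool, if b = (fun x => op (c x).1 (c x).2) then
        ∏ x, (u1 x (c x).1 * u2 x (c x).2) else 0 := by
    intro b
    rw [Finset.prod_univ_sum]
    simp only [Fintype.piFinset_univ]
    refine Finset.sum_congr rfl fun c _ => ?_
    rw [Finset.prod_ite_zero]
    congr 1
    simp only [mem_univ, true_imp_iff, eq_iff_iff]
    constructor
    · intro h; ext x; rw [h x]
    · intro h x; rw [h]
  simp only [h1, Finset.sum_mul]
  symm
  rw [Finset.sum_comm]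
  simp only [ite_mul, zero_mul, Finset.sum_ite_eq', Finset.sum_ite_eq, mem_univ, if_true]
  rw [← Equiv.sum_comp (Equiv.arrowProdEquivProdArrow X (fun _ => Bool) (fun _ => Bool)).symm]
  rw [Fintype.sum_prod_type]
  refine Finset.sum_congr rfl fun b1 _ => Finset.sum_congr rfl fun b2 _ => ?_
  simp [Equiv.arrowProdEquivProdArrow, Finset.prod_mul_distrib]

lemma Ex_union (P1 P2 : X → ℝ) (f : Finset X → ℝ) :
    Ex P1 (fun W1 => Ex P2 fun W2 => f (W1 ∪ W2)) =
      Ex (fun x => 1 - (1 - P1 x) * (1 - P2 x)) f := by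
  have := bool_op (fun a b => a || b) (fun x b => bw (P1 x) b) (fun x b => bw (P2 x) b)
    (fun b => f (bsupp b))
  simp only [Ex_eq_bool]
  refine Eq.trans ?_ (this.trans ?_)
  · refine Finset.sum_congr rfl fun b1 _ => ?_
    rw [Finset.mul_sum]
    refine Finset.sum_congr rfl fun b2 _ => ?_
    rw [mul_assoc]
    congr 3
    ext x; simp [bsupp]
  · refine Finset.sum_congr rfl fun b _ => ?_
    congr 1
    refine Finset.prod_congr rfl fun x _ => ?_
    rw [Fintype.sum_prod_type]
    cases b x <;> simp [bw] <;> ring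

lemma Ex_inter (P1 P2 : X → ℝ) (f : Finset X → ℝ) :
    Ex P1 (fun W1 => Ex P2 fun W2 => f (W1 ∩ W2)) = Ex (fun x => P1 x * P2 x) f := by
  have := bool_op (fun a b => a && b) (fun x b => bw (P1 x) b) (fun x b => bw (P2 x) b)
    (fun b => f (bsupp b))
  simp only [Ex_eq_bool]
  refine Eq.trans ?_ (this.trans ?_)
  · refine Finset.sum_congr rfl fun b1 _ => ?_
    rw [Finset.mul_sum]
    refine Finset.sum_congr rfl fun b2 _ => ?_
    rw [mul_assoc]
    congr 3
    ext x; simp [bsupp]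
  · refine Finset.sum_congr rfl fun b _ => ?_
    congr 1
    refine Finset.prod_congr rfl fun x _ => ?_
    rw [Fintype.sum_prod_type]
    cases b x <;> simp [bw] <;> ring

lemma sum_prod_ite (a b : X → ℝ) :
    ∑ W : Finset X, ∏ x, (if x ∈ W then a x else b x) = ∏ x, (a x + b x) := by
  rw [Finset.prod_add]
  rw [Finset.powerset_univ]
  refine Finset.sum_congr rfl fun W _ => ?_
  rw [Finset.prod_ite]
  congr 1
  · congr 1; ext x; simp
  · congr 1; ext x; simp

lemma Ex_const (P : X → ℝ) (c : ℝ) : Ex P (fun _ => c) = c := by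
  unfold Ex wt
  rw [← Finset.sum_mul, sum_prod_ite]
  simp

lemma wt_nonneg {P : X → ℝ} (h0 : ∀ x, 0 ≤ P x) (h1 : ∀ x, P x ≤ 1) (W : Finset X) :
    0 ≤ wt P W := by
  refine Finset.prod_nonneg fun x _ => ?_
  split_ifs
  · exact h0 x
  · linarith [h1 x]

lemma Ex_mono {P : X → ℝ} (h0 : ∀ x, 0 ≤ P x) (h1 : ∀ x, P x ≤ 1) {f g : Finset X → ℝ}
    (h : ∀ W, f W ≤ g W) : Ex P f ≤ Ex P g :=
  Finset.sum_le_sum fun W _ => mul_le_mul_of_nonneg_left (h W) (wt_nonneg h0 h1 W)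

lemma Ex_nonneg {P : X → ℝ} (h0 : ∀ x, 0 ≤ P x) (h1 : ∀ x, P x ≤ 1) {f : Finset X → ℝ}
    (h : ∀ W, 0 ≤ f W) : 0 ≤ Ex P f :=
  Finset.sum_nonneg fun W _ => mul_nonneg (wt_nonneg h0 h1 W) (h W)

lemma Ex_add (P : X → ℝ) (f g : Finset X → ℝ) :
    Ex P (fun W => f W + g W) = Ex P f + Ex P g := by
  unfold Ex; rw [← Finset.sum_add_distrib]; exact Finset.sum_congr rfl fun _ _ => by ring

lemma Ex_mul (P : X → ℝ) (c : ℝ) (f : Finset X → ℝ) :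
    Ex P (fun W => c * f W) = c * Ex P f := by
  unfold Ex; rw [Finset.mul_sum]; exact Finset.sum_congr rfl fun _ _ => by ring

lemma Ex_sub (P : X → ℝ) (f g : Finset X → ℝ) :
    Ex P (fun W => f W - g W) = Ex P f - Ex P g := by
  unfold Ex; rw [← Finset.sum_sub_distrib]; exact Finset.sum_congr rfl fun _ _ => by ring

lemma Ex_sum {ι : Type*} (s : Finset ι) (P : X → ℝ) (f : ι → Finset X → ℝ) :
    Ex P (fun W => ∑ i ∈ s, f i W) = ∑ i ∈ s, Ex P (f i) := by
  unfold Ex; rw [Finset.sum_comm]; exact Finset.sum_congr rfl fun _ _ => by rw [Finset.mul_sum]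

/-- The parameter function forced to one on `F`. -/
def force (P : X → ℝ) (F : Finset X) : X → ℝ := fun x => if x ∈ F then 1 else P x

lemma Ex_subset (P : X → ℝ) (F : Finset X) (f : Finset X → ℝ) :
    Ex P (fun W => if F ⊆ W then f W else 0) = (∏ x ∈ F, P x) * Ex (force P F) f := by
  unfold Ex
  rw [Finset.mul_sum]
  refine Finset.sum_congr rfl fun W _ => ?_
  rw [← mul_assoc]
  dsimp only
  by_cases h : F ⊆ W
  · rw [if_pos h]
    congr 1
    unfold wt force
    rw [← Finset.prod_mul_prod_compl F (fun x => if x ∈ W then P x else 1 - P x),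
      ← Finset.prod_mul_prod_compl F (fun x => if x ∈ W then _ else _), ← mul_assoc]
    congr 1
    · rw [← Finset.prod_mul_distrib]
      refine Finset.prod_congr rfl fun x hx => ?_
      simp [h hx, hx]
    · refine Finset.prod_congr rfl fun x hx => ?_
      simp [Finset.mem_compl.1 hx]
  · rw [if_neg h]
    obtain ⟨x, hx, hxW⟩ := Finset.not_subset.1 h
    have : wt (force P F) W = 0 := by
      unfold wt
      refine Finset.prod_eq_zero (mem_univ x) ?_
      simp [force, hx, hxW]
    rw [this]; ring

lemma Ex_zero_one (F : Finset X) (f : Finset X → ℝ) :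
    Ex (fun x => if x ∈ F then 1 else 0) f = f F := by
  unfold Ex
  rw [Finset.sum_eq_single F]
  · have : wt (fun x => if x ∈ F then (1:ℝ) else 0) F = 1 := by
      unfold wt; refine Finset.prod_eq_one fun x _ => ?_
      by_cases h : x ∈ F <;> simp [h]
    rw [this, one_mul]
  · intro W _ hW
    have : ∃ x, ¬ (x ∈ W ↔ x ∈ F) := by
      by_contra hc; push Not at hc; exact hW (Finset.ext hc)
    obtain ⟨x, hx⟩ := this
    have : wt (fun x => if x ∈ F then (1:ℝ) else 0) W = 0 := by
      unfold wt; refine Finset.prod_eq_zero (mem_univ x) ?_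
      by_cases h : x ∈ F <;> by_cases h' : x ∈ W <;> simp_all
    rw [this, zero_mul]
  · simp

lemma Ex_force (P : X → ℝ) (F : Finset X) (f : Finset X → ℝ) :
    Ex (force P F) f = Ex P (fun W => f (W ∪ F)) := by
  have := Ex_union P (fun x => if x ∈ F then 1 else 0) f
  simp only [Ex_zero_one] at this
  rw [this]
  congr 1
  ext x
  unfold force
  by_cases h : x ∈ F <;> simp [h]

lemma Ex_ind_subset (P : X → ℝ) (F : Finset X) :
    Ex P (fun W => if F ⊆ W then 1 else 0) = ∏ x ∈ F, P x := by
  rw [Ex_subset P F (fun _ => 1), Ex_const, mul_one]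

/-- exponential moment of the number of chosen elements inside `Y`. -/
lemma Ex_two_pow (P : X → ℝ) (Y : Finset X) :
    Ex P (fun W => (2:ℝ) ^ (W ∩ Y).card) = ∏ x ∈ Y, (1 + P x) := by
  unfold Ex
  have : ∀ W : Finset X, wt P W * (2:ℝ) ^ (W ∩ Y).card =
      ∏ x, if x ∈ W then (if x ∈ Y then 2 * P x else P x) else 1 - P x := by
    intro W
    unfold wt
    have : (2:ℝ) ^ (W ∩ Y).card = ∏ x, if x ∈ W ∩ Y then (2:ℝ) else 1 := by
      rw [Finset.prod_ite_mem]; simp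
    rw [this, ← Finset.prod_mul_distrib]
    refine Finset.prod_congr rfl fun x _ => ?_
    by_cases h : x ∈ W <;> by_cases h' : x ∈ Y <;> simp [h, h', mul_comm]
  simp only [this]
  rw [sum_prod_ite]
  rw [← Finset.prod_subset (Finset.subset_univ Y)]
  · refine Finset.prod_congr rfl fun x hx => ?_
    rw [if_pos hx]; ring
  · intro x _ hx; rw [if_neg hx]; ring

/-- marginals -/
lemma Ex_marginal {Y : Type*} [Fintype Y] [DecidableEq Y] (ι : Y ↪ X) (p : ℝ)
    (f : Finset Y → ℝ) :
    Ex (fun _ : X => p) (fun W => f (univ.filter fun y => ι y ∈ W)) = Ex (fun _ : Y => p) f := by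
  rw [Ex_eq_bool, Ex_eq_bool]
  rw [← Equiv.sum_comp (Equiv.piEquivPiSubtypeProd (fun x => x ∈ Set.range ι) (fun _ => Bool)).symm]
  rw [Fintype.sum_prod_type]
  let e : Y ≃ {x // x ∈ Set.range ι} := Equiv.ofInjective ι ι.injective
  rw [← Equiv.sum_comp (Equiv.arrowCongr e (Equiv.refl Bool))]
  refine Finset.sum_congr rfl fun b _ => ?_
  have h1 : ∀ c : {x // x ∉ Set.range ι} → Bool,
      (∏ x : X, bw p ((Equiv.piEquivPiSubtypeProd (fun x => x ∈ Set.range ι) (fun _ => Bool)).symm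
        ((Equiv.arrowCongr e (Equiv.refl Bool)) b, c) x)) =
      (∏ y, bw p (b y)) * ∏ z, bw p (c z) := by
    intro c
    rw [← Fintype.prod_subtype_mul_prod_subtype (fun x => x ∈ Set.range ι)]
    congr 1
    · symm
      refine Eq.trans (Fintype.prod_equiv e _ (fun i => bw p
        ((Equiv.piEquivPiSubtypeProd (fun x => x ∈ Set.range ι) (fun _ => Bool)).symm
          ((Equiv.arrowCongr e (Equiv.refl Bool)) b, c) i)) fun y => ?_)
          (Finset.prod_congr (by ext; simp) fun _ _ => rfl)
      have : ((e y : X)) ∈ Set.range ι := (e y).2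
      simp [Equiv.piEquivPiSubtypeProd]
      rw [dif_pos (Set.mem_range.1 this)]
    · refine Finset.prod_congr rfl fun z _ => ?_
      have := z.2
      simp only [Equiv.piEquivPiSubtypeProd, Equiv.coe_fn_symm_mk]
      rw [dif_neg this]
  have h2 : ∀ c : {x // x ∉ Set.range ι} → Bool,
      (univ.filter fun y => ι y ∈ bsupp ((Equiv.piEquivPiSubtypeProd (fun x => x ∈ Set.range ι) (fun _ => Bool)).symm
        ((Equiv.arrowCongr e (Equiv.refl Bool)) b, c))) = bsupp b := by
    intro c
    ext y
    have hy : e.symm ⟨ι y, ⟨y, rfl⟩⟩ = y := by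
      rw [Equiv.symm_apply_eq]; rfl
    simp [bsupp, Equiv.piEquivPiSubtypeProd, hy]
  simp only [h1, h2]
  rw [← Finset.sum_mul, ← Finset.mul_sum]
  have : ∑ c : {x // x ∉ Set.range ι} → Bool, ∏ z, bw p (c z) = 1 := by
    have := Finset.prod_univ_sum (fun _ : {x // x ∉ Set.range ι} => (univ : Finset Bool)) (fun _ b => bw p b)
    rw [Fintype.piFinset_univ] at this
    rw [← this]; simp [bw]
  rw [this, mul_one]

lemma Ex_mono_param {p q : ℝ} (hp : 0 ≤ p) (hpq : p ≤ q) (hq : q < 1) {f : Finset X → ℝ}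
    (hf : Monotone f) : Ex (fun _ => p) f ≤ Ex (fun _ => q) f := by
  have hp1 : p < 1 := lt_of_le_of_lt hpq hq
  set t := 1 - (1 - q) / (1 - p) with ht
  have ht0 : 0 ≤ t := by
    rw [ht, sub_nonneg, div_le_one (by linarith)]; linarith
  have ht1 : t ≤ 1 := by
    rw [ht]; linarith [div_nonneg (by linarith : 0 ≤ 1 - q) (by linarith : 0 ≤ 1 - p)]
  have := Ex_union (fun _ : X => p) (fun _ => t) f
  have h2 : (fun _ : X => 1 - (1 - p) * (1 - t)) = fun _ => q := by
    ext; rw [ht]; have : 1 - p ≠ 0 := by linarith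
    field_simp; ring
  rw [h2] at this
  rw [← this]
  refine Ex_mono (fun _ => hp) (fun _ => hp1.le) fun W => ?_
  calc f W = Ex (fun _ => t) (fun _ => f W) := (Ex_const _ _).symm
    _ ≤ _ := Ex_mono (fun _ => ht0) (fun _ => ht1) fun W' => hf Finset.subset_union_left

end weights

section fragment
variable {X I : Type*} [Fintype X] [DecidableEq X] [Fintype I]

/-- `ω` is good for `W` with remainder at most `l`. -/
def GoodFrag (Om : Finset I) (T : I → Finset X) (W : Finset X) (l : ℝ) (ω : I) : Prop :=
  ∃ ω' ∈ Om, T ω' ⊆ W ∪ T ω ∧ ((T ω' \ W).card : ℝ) ≤ l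

/-- the number of bad indices -/
noncomputable def badNum (Om : Finset I) (T : I → Finset X) (W : Finset X) (l : ℝ) : ℝ :=
  ((Om.filter fun ω => ¬ GoodFrag Om T W l ω).card : ℝ)

/-- spread families: at most `N U` of the sets contain `U`. -/
def SpreadFam (N : Finset X → ℝ) (Om : Finset I) (T : I → Finset X) : Prop :=
  ∀ U, ((Om.filter fun ω => U ⊆ T ω).card : ℝ) ≤ N U

variable (I) in
/-- reduction property -/
def Red (N : Finset X → ℝ) (Cl : Finset X → Prop) (l0 l1 π δ : ℝ) : Prop :=
  ∀ (Om : Finset I) (T : I → Finset X), SpreadFam N Om T → (∀ ω ∈ Om, Cl (T ω)) →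
    (∀ ω ∈ Om, ((T ω).card : ℝ) ≤ l0) → Ex (fun _ : X => π) (fun W => badNum Om T W l1) ≤ δ

lemma wt_union_le {π : ℝ} (h0 : 0 < π) (h1 : π ≤ 1) (W U : Finset X) (h : Disjoint W U) :
    wt (fun _ : X => π) W ≤ (π⁻¹) ^ U.card * wt (fun _ : X => π) (W ∪ U) := by
  have : (π⁻¹) ^ U.card = ∏ x, if x ∈ U then π⁻¹ else 1 := by
    rw [Finset.prod_ite_mem]; simp
  rw [this]
  unfold wt
  rw [← Finset.prod_mul_distrib]
  refine Finset.prod_le_prod (fun x _ => ?_) fun x _ => ?_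
  · split_ifs <;> linarith
  · by_cases hU : x ∈ U
    · have hW : x ∉ W := fun hW => (Finset.disjoint_left.1 h hW hU)
      simp only [hU, hW, if_true, if_false, Finset.mem_union, or_true]
      rw [inv_mul_cancel₀ h0.ne']; linarith
    · simp [hU]

lemma red_one {N : Finset X → ℝ} {Cl : Finset X → Prop} {l0 l1 π δ : ℝ}
    (h0 : 0 < π) (h1 : π ≤ 1) (hδ : 0 ≤ δ)
    (h : ∀ T, Cl T → (T.card : ℝ) ≤ l0 → (∀ U, 0 ≤ N U) →
      ∑ U ∈ T.powerset.filter (fun U => l1 < (U.card : ℝ)), (π⁻¹) ^ U.card * N U ≤ δ) :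
    Red I N Cl l0 l1 π δ := by
  intro Om T hsp hcl hcard
  have hN0 : ∀ U, 0 ≤ N U := fun U => le_trans (Nat.cast_nonneg _) (hsp U)
  rcases Om.eq_empty_or_nonempty with hOm | ⟨ω0, hω0⟩
  · subst hOm
    simp only [badNum, Finset.filter_empty, Finset.card_empty, Nat.cast_zero]
    rw [Ex_const]; exact hδ
  have hg : ∃ g : Finset X → I, ∀ Z, (∃ ω ∈ Om, T ω ⊆ Z) → g Z ∈ Om ∧ T (g Z) ⊆ Z := by
    refine ⟨fun Z => if hZ : ∃ ω ∈ Om, T ω ⊆ Z then hZ.choose else ω0, fun Z hZ => ?_⟩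
    simp only [dif_pos hZ]
    exact hZ.choose_spec
  obtain ⟨g, hg⟩ := hg
  -- the certificate
  let Q : Finset X → Finset X → Prop := fun Z U =>
    (∃ ω ∈ Om, T ω ⊆ Z) ∧ U ⊆ T (g Z) ∧ l1 < (U.card : ℝ)
  have hD : ∀ W, badNum Om T W l1 ≤
      ∑ U : Finset X, if Disjoint W U ∧ Q (W ∪ U) U then N U else 0 := by
    intro W
    have hcov : (Om.filter fun ω => ¬ GoodFrag Om T W l1 ω) ⊆
        (univ.filter fun U => Disjoint W U ∧ Q (W ∪ U) U).biUnion
          fun U => Om.filter fun ω => U ⊆ T ω := by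
      intro ω hω
      rw [Finset.mem_filter] at hω
      obtain ⟨hωO, hbad⟩ := hω
      obtain ⟨ω', hω', hmin⟩ := Finset.exists_min_image (Om.filter fun ω' => T ω' ⊆ W ∪ T ω)
        (fun ω' => (T ω' \ W).card) ⟨ω, by simp [hωO]⟩
      rw [Finset.mem_filter] at hω'
      rw [Finset.mem_biUnion]
      have hZ : T ω' ⊆ W ∪ (T ω' \ W) := by
        intro x hx; by_cases hxW : x ∈ W <;> simp [hx, hxW]
      have hUT : T ω' \ W ⊆ T ω := by
        intro x hx
        rw [Finset.mem_sdiff] at hx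
        have := hω'.2 hx.1
        rw [Finset.mem_union] at this
        exact this.resolve_left hx.2
      have hgZ := hg (W ∪ (T ω' \ W)) ⟨ω', hω'.1, hZ⟩
      have hgc : T (g (W ∪ (T ω' \ W))) ⊆ W ∪ T ω :=
        hgZ.2.trans (Finset.union_subset_union_right hUT)
      have hle := hmin (g (W ∪ (T ω' \ W))) (by rw [Finset.mem_filter]; exact ⟨hgZ.1, hgc⟩)
      have hsub : T (g (W ∪ (T ω' \ W))) \ W ⊆ T ω' \ W := by
        intro x hx
        rw [Finset.mem_sdiff] at hx
        have := hgZ.2 hx.1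
        rw [Finset.mem_union] at this
        exact this.resolve_left hx.2
      have heq := Finset.eq_of_subset_of_card_le hsub hle
      refine ⟨T ω' \ W, ?_, ?_⟩
      · rw [Finset.mem_filter]
        refine ⟨mem_univ _, Finset.disjoint_sdiff, ⟨ω', hω'.1, hZ⟩, ?_, ?_⟩
        · intro x hx
          rw [← heq] at hx
          exact (Finset.mem_sdiff.1 hx).1
        · by_contra hc
          exact hbad ⟨ω', hω'.1, hω'.2, not_lt.1 hc⟩
      · rw [Finset.mem_filter]; exact ⟨hωO, hUT⟩
    unfold badNum
    rw [← Finset.sum_filter]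
    calc (((Om.filter fun ω => ¬ GoodFrag Om T W l1 ω).card : ℕ) : ℝ)
        ≤ (((univ.filter fun U => Disjoint W U ∧ Q (W ∪ U) U).biUnion
          fun U => Om.filter fun ω => U ⊆ T ω).card : ℝ) := by
          exact_mod_cast Finset.card_le_card hcov
      _ ≤ ∑ U ∈ univ.filter (fun U => Disjoint W U ∧ Q (W ∪ U) U),
          ((Om.filter fun ω => U ⊆ T ω).card : ℝ) := by
          exact_mod_cast Finset.card_biUnion_le
      _ ≤ _ := Finset.sum_le_sum fun U _ => hsp U
  have hwt : ∀ W, 0 ≤ wt (fun _ : X => π) W := wt_nonneg (fun _ => h0.le) (fun _ => h1)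
  calc Ex (fun _ : X => π) (fun W => badNum Om T W l1)
      ≤ ∑ W, wt (fun _ : X => π) W *
        ∑ U : Finset X, (if Disjoint W U ∧ Q (W ∪ U) U then N U else 0) :=
        Finset.sum_le_sum fun W _ => mul_le_mul_of_nonneg_left (hD W) (hwt W)
    _ = ∑ U : Finset X, ∑ W ∈ univ.filter (fun W => Disjoint W U ∧ Q (W ∪ U) U),
          wt (fun _ : X => π) W * N U := by
        simp only [Finset.mul_sum]
        rw [Finset.sum_comm]
        refine Finset.sum_congr rfl fun U _ => ?_
        rw [Finset.sum_filter]
        refine Finset.sum_congr rfl fun W _ => ?_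
        split_ifs <;> simp
    _ ≤ ∑ U : Finset X, ∑ W ∈ univ.filter (fun W => Disjoint W U ∧ Q (W ∪ U) U),
          wt (fun _ : X => π) (W ∪ U) * ((π⁻¹) ^ U.card * N U) := by
        refine Finset.sum_le_sum fun U _ => Finset.sum_le_sum fun W hW => ?_
        rw [Finset.mem_filter] at hW
        have := mul_le_mul_of_nonneg_right (wt_union_le h0 h1 W U hW.2.1) (hN0 U)
        linarith
    _ ≤ ∑ U : Finset X, ∑ Z ∈ univ.filter (fun Z => Q Z U),
          wt (fun _ : X => π) Z * ((π⁻¹) ^ U.card * N U) := by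
        refine Finset.sum_le_sum fun U _ => ?_
        rw [← Finset.sum_image (f := fun Z => wt (fun _ : X => π) Z * ((π⁻¹) ^ U.card * N U))
          (g := fun W => W ∪ U)]
        · refine Finset.sum_le_sum_of_subset_of_nonneg ?_ fun Z _ _ => ?_
          · intro Z hZ
            rw [Finset.mem_image] at hZ
            obtain ⟨W, hW, rfl⟩ := hZ
            rw [Finset.mem_filter] at hW ⊢
            exact ⟨mem_univ _, hW.2.2⟩
          · have := hN0 U
            have := hwt Z
            positivity
        · intro W hW W' hW' hE
          simp only [Finset.coe_filter, Set.mem_setOf_eq, mem_univ, true_and] at hW hW'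
          have a : (W ∪ U) \ U = W := Finset.union_sdiff_cancel_right hW.1
          have b : (W' ∪ U) \ U = W' := Finset.union_sdiff_cancel_right hW'.1
          simp only at hE
          rw [← a, hE, b]
    _ = ∑ Z : Finset X, wt (fun _ : X => π) Z *
          ∑ U ∈ univ.filter (fun U => Q Z U), ((π⁻¹) ^ U.card * N U) := by
        simp only [Finset.sum_filter]
        rw [Finset.sum_comm]
        refine Finset.sum_congr rfl fun Z _ => ?_
        rw [Finset.mul_sum]
        refine Finset.sum_congr rfl fun U _ => ?_
        split_ifs <;> simp
    _ ≤ ∑ Z : Finset X, wt (fun _ : X => π) Z * δ := by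
        refine Finset.sum_le_sum fun Z _ => mul_le_mul_of_nonneg_left ?_ (hwt Z)
        by_cases hZ : ∃ ω ∈ Om, T ω ⊆ Z
        · have hgZ := hg Z hZ
          refine le_trans (le_of_eq ?_) (h (T (g Z)) (hcl _ hgZ.1) (hcard _ hgZ.1) hN0)
          refine Finset.sum_congr ?_ fun _ _ => rfl
          ext U
          simp only [Finset.mem_filter, mem_univ, true_and, Finset.mem_powerset, Q]
          exact ⟨fun h => h.2, fun h => ⟨hZ, h⟩⟩
        · rw [Finset.sum_eq_zero]
          · exact hδ
          · intro U hU
            rw [Finset.mem_filter] at hU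
            exact absurd hU.2.1 hZ
    _ = δ := by
        have := Ex_const (fun _ : X => π) δ
        exact this

lemma badNum_mono (Om : Finset I) (T : I → Finset X) {W W' : Finset X} (h : W ⊆ W') (l : ℝ) :
    badNum Om T W' l ≤ badNum Om T W l := by
  unfold badNum
  have : (Om.filter fun ω => ¬ GoodFrag Om T W' l ω) ⊆
      (Om.filter fun ω => ¬ GoodFrag Om T W l ω) := by
    intro ω hω
    rw [Finset.mem_filter] at hω ⊢
    refine ⟨hω.1, fun hgood => hω.2 ?_⟩
    obtain ⟨ω', h1, h2, h3⟩ := hgood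
    refine ⟨ω', h1, h2.trans (Finset.union_subset_union_left h), le_trans ?_ h3⟩
    exact_mod_cast Finset.card_le_card (Finset.sdiff_subset_sdiff le_rfl h)
  exact_mod_cast Finset.card_le_card this

lemma red_comp {N : Finset X → ℝ} {Cl : Finset X → Prop} {l0 l1 l2 π1 π2 δ1 δ2 : ℝ}
    (hCl : ∀ T T', T ⊆ T' → Cl T' → Cl T)
    (h0 : 0 ≤ π1) (h1 : π1 ≤ 1) (h0' : 0 ≤ π2) (h1' : π2 ≤ 1)
    (r1 : Red I N Cl l0 l1 π1 δ1) (r2 : Red I N Cl l1 l2 π2 δ2) :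
    Red I N Cl l0 l2 (1 - (1 - π1) * (1 - π2)) (δ1 + δ2) := by
  intro Om T hsp hcl hcard
  have hu := Ex_union (fun _ : X => π1) (fun _ => π2) (fun W => badNum Om T W l2)
  rw [← hu]
  have key : ∀ W1, Ex (fun _ : X => π2) (fun W2 => badNum Om T (W1 ∪ W2) l2) ≤
      badNum Om T W1 l1 + δ2 := by
    intro W1
    let χ : I → I := fun ω => if hω : GoodFrag Om T W1 l1 ω then hω.choose else ω
    have hχ : ∀ ω, GoodFrag Om T W1 l1 ω → χ ω ∈ Om ∧ T (χ ω) ⊆ W1 ∪ T ω ∧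
        ((T (χ ω) \ W1).card : ℝ) ≤ l1 := by
      intro ω hω
      simp only [χ, dif_pos hω]
      exact hω.choose_spec
    let Om' := Om.filter fun ω => GoodFrag Om T W1 l1 ω
    let T' : I → Finset X := fun ω => T (χ ω) \ W1
    have hT' : ∀ ω ∈ Om', T' ω ⊆ T ω := by
      intro ω hω x hx
      rw [Finset.mem_sdiff] at hx
      have := (hχ ω (Finset.mem_filter.1 hω).2).2.1 hx.1
      rw [Finset.mem_union] at this
      exact this.resolve_left hx.2
    have hr := r2 Om' T' (by
      intro U
      refine le_trans ?_ (hsp U)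
      refine Nat.cast_le.2 (Finset.card_le_card ?_)
      intro ω hω
      rw [Finset.mem_filter] at hω ⊢
      exact ⟨(Finset.mem_filter.1 hω.1).1, hω.2.trans (hT' ω hω.1)⟩)
      (fun ω hω => hCl _ _ (hT' ω hω) (hcl ω (Finset.mem_filter.1 hω).1))
      (fun ω hω => (hχ ω (Finset.mem_filter.1 hω).2).2.2)
    have hpt : ∀ W2, badNum Om T (W1 ∪ W2) l2 ≤ badNum Om T W1 l1 + badNum Om' T' W2 l2 := by
      intro W2
      unfold badNum
      have : (Om.filter fun ω => ¬ GoodFrag Om T (W1 ∪ W2) l2 ω) ⊆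
          (Om.filter fun ω => ¬ GoodFrag Om T W1 l1 ω) ∪
          (Om'.filter fun ω => ¬ GoodFrag Om' T' W2 l2 ω) := by
        intro ω hω
        rw [Finset.mem_filter] at hω
        rw [Finset.mem_union]
        by_cases hg : GoodFrag Om T W1 l1 ω
        · right
          have hω' : ω ∈ Om' := Finset.mem_filter.2 ⟨hω.1, hg⟩
          rw [Finset.mem_filter]
          refine ⟨hω', fun hgood => hω.2 ?_⟩
          obtain ⟨ω'', a, b, c⟩ := hgood
          have hx := hχ ω'' (Finset.mem_filter.1 a).2
          refine ⟨χ ω'', hx.1, ?_, ?_⟩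
          · intro x hx
            by_cases hxW : x ∈ W1
            · simp [hxW]
            · have : x ∈ T' ω'' := Finset.mem_sdiff.2 ⟨hx, hxW⟩
              have := b this
              rw [Finset.mem_union] at this
              rcases this with h | h
              · simp [h]
              · have := hT' ω hω' h
                simp [this]
          · refine le_trans ?_ c
            refine Nat.cast_le.2 (Finset.card_le_card ?_)
            intro x hx
            simp only [Finset.mem_sdiff, Finset.mem_union, not_or, T'] at hx ⊢
            tauto
        · left; exact Finset.mem_filter.2 ⟨hω.1, hg⟩
      refine le_trans (Nat.cast_le.2 (Finset.card_le_card this)) ?_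
      exact_mod_cast Finset.card_union_le _ _
    calc Ex (fun _ : X => π2) (fun W2 => badNum Om T (W1 ∪ W2) l2)
        ≤ Ex (fun _ : X => π2) (fun W2 => badNum Om T W1 l1 + badNum Om' T' W2 l2) :=
          Ex_mono (fun _ => h0') (fun _ => h1') hpt
      _ = badNum Om T W1 l1 + Ex (fun _ : X => π2) (fun W2 => badNum Om' T' W2 l2) := by
          rw [Ex_add, Ex_const]
      _ ≤ _ := by linarith
  calc _ ≤ Ex (fun _ : X => π1) (fun W1 => badNum Om T W1 l1 + δ2) :=
        Ex_mono (fun _ => h0) (fun _ => h1) key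
    _ = Ex (fun _ : X => π1) (fun W1 => badNum Om T W1 l1) + δ2 := by rw [Ex_add, Ex_const]
    _ ≤ _ := by linarith [r1 Om T hsp hcl hcard]

lemma red_mono {N : Finset X → ℝ} {Cl : Finset X → Prop} {l0 l1 π π' δ δ' : ℝ}
    (h0 : 0 ≤ π) (hπ : π ≤ π') (h1 : π' < 1) (hδ : δ ≤ δ') (r : Red I N Cl l0 l1 π δ) :
    Red I N Cl l0 l1 π' δ' := by
  intro Om T hsp hcl hcard
  refine le_trans ?_ ((r Om T hsp hcl hcard).trans hδ)
  have := Ex_mono_param h0 hπ h1 (f := fun W => -1 * badNum Om T W l1) (by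
    intro W W' hW
    have := badNum_mono Om T hW l1
    simp only; linarith)
  rw [Ex_mul, Ex_mul] at this
  linarith

end fragment

section host

/-- one bipartite relation is lower-regular with minimum degree -/
structure RelGood (n : ℕ) (ε θ : ℝ) (R : Fin n → Fin n → Prop) : Prop where
  deg : ∀ u, θ * n ≤ ((univ.filter fun v => R u v).card : ℝ)
  reg : ∀ A B : Finset (Fin n), ε * n ≤ (A.card : ℝ) → ε * n ≤ (B.card : ℝ) →
    θ / 2 * A.card * B.card ≤ ∑ u ∈ A, ((B.filter fun v => R u v).card : ℝ)

/-- the constant in the counting lemma -/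
noncomputable def cc (θ : ℝ) : ℕ → ℝ → ℝ
  | 0, _ => 1
  | (k + 1), δ => δ / 2 * cc θ k (θ / 4 * δ)

lemma cc_pos {θ : ℝ} (h : 0 < θ) : ∀ (k : ℕ) {δ : ℝ}, 0 < δ → 0 < cc θ k δ
  | 0, _, _ => by simp [cc]
  | (k + 1), δ, hδ => by
    have := cc_pos h k (δ := θ / 4 * δ) (by positivity)
    rw [cc]; positivity

variable {V : Type*} [Fintype V] [DecidableEq V]

lemma count_emb {n : ℕ} {ε θ : ℝ} (hε : 0 < ε) (hθ : 0 < θ) (hθ1 : θ ≤ 1) (hn : 0 < n)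
    (R : V → V → Fin n → Fin n → Prop) (hsymm : ∀ u v y z, R u v y z → R v u z y)
    (hR : ∀ u v, u ≠ v → RelGood n ε θ (R u v)) (K : ℕ) (S : Finset V) :
    ∀ (δ : ℝ) (b : V → Fin n) (Cd : V → Finset (Fin n)), S.card ≤ K → 0 < δ →
      ε * (2 * (K + 1)) ≤ δ * (θ / 4) ^ S.card → 1 ≤ n * (δ * (θ / 4) ^ S.card) →
      (∀ v ∈ S, δ * n ≤ ((Cd v).card : ℝ)) →
      cc θ S.card δ * n ^ S.card ≤ ((univ.filter fun x : V → Fin n =>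
        (∀ v, v ∉ S → x v = b v) ∧ (∀ v ∈ S, x v ∈ Cd v) ∧
        (∀ u ∈ S, ∀ v ∈ S, u ≠ v → x u ≠ x v ∧ R u v (x u) (x v))).card : ℝ) := by
  induction S using Finset.induction_on with
  | empty =>
    intro δ b Cd _ _ _ _ _
    simp only [Finset.card_empty, cc, pow_zero, mul_one]
    have : (univ.filter fun x : V → Fin n =>
        (∀ v, v ∉ (∅ : Finset V) → x v = b v) ∧ (∀ v ∈ (∅ : Finset V), x v ∈ Cd v) ∧
        (∀ u ∈ (∅ : Finset V), ∀ v ∈ (∅ : Finset V), u ≠ v → x u ≠ x v ∧ R u v (x u) (x v))) =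
        {b} := by
      ext x
      simp [funext_iff]
    rw [this]; simp
  | insert a S ha ih =>
    intro δ b Cd hK hδ hε' hn' hCd
    rw [Finset.card_insert_of_notMem ha] at hK hε' hn' ⊢
    have hnR : (0:ℝ) < n := by exact_mod_cast hn
    have hpow : (θ / 4) ^ (S.card + 1) ≤ θ / 4 := by
      rw [pow_succ]
      have : (θ / 4) ^ S.card ≤ 1 := pow_le_one₀ (by positivity) (by linarith)
      nlinarith
    have hpow1 : (θ / 4) ^ (S.card + 1) ≤ 1 := hpow.trans (by linarith)
    have hεδ : ε * (2 * (K + 1)) ≤ δ := hε'.trans (by nlinarith)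
    have hKpos : (0:ℝ) ≤ K := Nat.cast_nonneg _
    have hε1 : ε ≤ δ := by nlinarith
    have hbig : 1 ≤ θ / 4 * δ * n := by
      have : n * (δ * (θ / 4) ^ (S.card + 1)) ≤ n * (δ * (θ / 4)) := by gcongr
      nlinarith
    -- the good choices of the image of a
    let bad : V → Finset (Fin n) := fun v => (Cd a).filter fun y =>
      (((Cd v).filter fun z => R a v y z).card : ℝ) < θ / 2 * (Cd v).card
    have hbad : ∀ v ∈ S, ((bad v).card : ℝ) ≤ ε * n := by
      intro v hv
      by_contra hc
      push Not at hc
      have hav : a ≠ v := fun h => ha (h ▸ hv)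
      have hCv := hCd v (Finset.mem_insert_of_mem hv)
      have h1 := (hR a v hav).reg (bad v) (Cd v) hc.le (le_trans (by nlinarith) hCv)
      have hne : (bad v).Nonempty := by
        rw [← Finset.card_pos]
        have : (0:ℝ) < (bad v).card := lt_of_le_of_lt (by positivity) hc
        exact_mod_cast this
      have h2 : ∑ u ∈ bad v, (((Cd v).filter fun z => R a v u z).card : ℝ) <
          ∑ u ∈ bad v, θ / 2 * (Cd v).card :=
        Finset.sum_lt_sum_of_nonempty hne fun u hu => (Finset.mem_filter.1 hu).2
      rw [Finset.sum_const, nsmul_eq_mul] at h2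
      linarith
    let good : Finset (Fin n) := Cd a \ S.biUnion bad
    have hgood : δ / 2 * n ≤ (good.card : ℝ) := by
      have h1 : ((S.biUnion bad).card : ℝ) ≤ S.card * (ε * n) := by
        calc ((S.biUnion bad).card : ℝ) ≤ ∑ v ∈ S, ((bad v).card : ℝ) := by
              exact_mod_cast Finset.card_biUnion_le
          _ ≤ ∑ v ∈ S, ε * n := Finset.sum_le_sum hbad
          _ = _ := by rw [Finset.sum_const, nsmul_eq_mul]
      have h2 : ((Cd a).card : ℝ) ≤ good.card + (S.biUnion bad).card := by
        have := Finset.card_le_card_sdiff_add_card (t := S.biUnion bad) (s := Cd a)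
        exact_mod_cast this
      have h3 := hCd a (Finset.mem_insert_self a S)
      have h4 : (S.card : ℝ) ≤ K := by
        exact_mod_cast (Nat.le_of_succ_le hK)
      have h5 : S.card * (ε * n) ≤ K * (ε * n) := by gcongr
      nlinarith [mul_le_mul_of_nonneg_right hεδ hnR.le]
    -- the new candidate sets
    let Cd' : Fin n → V → Finset (Fin n) := fun y v => ((Cd v).filter fun z => R a v y z).erase y
    have hCd' : ∀ y ∈ good, ∀ v ∈ S, θ / 4 * δ * n ≤ ((Cd' y v).card : ℝ) := by
      intro y hy v hv
      have h1 : θ / 2 * (Cd v).card ≤ (((Cd v).filter fun z => R a v y z).card : ℝ) := by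
        by_contra hc
        rw [not_le] at hc
        have hy' := Finset.mem_sdiff.1 hy
        exact hy'.2 (Finset.mem_biUnion.2 ⟨v, hv, Finset.mem_filter.2 ⟨hy'.1, hc⟩⟩)
      have h2 : (((Cd v).filter fun z => R a v y z).card : ℝ) ≤ (Cd' y v).card + 1 := by
        have := Finset.pred_card_le_card_erase (s := (Cd v).filter fun z => R a v y z) (a := y)
        have := Nat.sub_le_iff_le_add.1 this
        exact_mod_cast this
      have h3 := hCd v (Finset.mem_insert_of_mem hv)
      nlinarith
    have hrec : ∀ y ∈ good, cc θ S.card (θ / 4 * δ) * n ^ S.card ≤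
        ((univ.filter fun x : V → Fin n =>
        (∀ v, v ∉ S → x v = Function.update b a y v) ∧ (∀ v ∈ S, x v ∈ Cd' y v) ∧
        (∀ u ∈ S, ∀ v ∈ S, u ≠ v → x u ≠ x v ∧ R u v (x u) (x v))).card : ℝ) := by
      intro y hy
      refine ih (θ / 4 * δ) (Function.update b a y) (Cd' y) (by omega) (by positivity) ?_ ?_
        (hCd' y hy)
      · rw [pow_succ] at hε'; linarith
      · rw [pow_succ] at hn'; linarith
    have hsub : (good.biUnion fun y => univ.filter fun x : V → Fin n =>
        (∀ v, v ∉ S → x v = Function.update b a y v) ∧ (∀ v ∈ S, x v ∈ Cd' y v) ∧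
        (∀ u ∈ S, ∀ v ∈ S, u ≠ v → x u ≠ x v ∧ R u v (x u) (x v))) ⊆
        univ.filter fun x : V → Fin n =>
        (∀ v, v ∉ insert a S → x v = b v) ∧ (∀ v ∈ insert a S, x v ∈ Cd v) ∧
        (∀ u ∈ insert a S, ∀ v ∈ insert a S, u ≠ v → x u ≠ x v ∧ R u v (x u) (x v)) := by
      intro x hx
      rw [Finset.mem_biUnion] at hx
      obtain ⟨y, hy, hx⟩ := hx
      rw [Finset.mem_filter] at hx ⊢
      obtain ⟨-, h1, h2, h3⟩ := hx
      have hxa : x a = y := by rw [h1 a ha]; simp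
      have hmem : ∀ v ∈ S, x v ∈ Cd v ∧ x v ≠ y ∧ R a v y (x v) := by
        intro v hv
        have := h2 v hv
        simp only [Cd', Finset.mem_erase, Finset.mem_filter] at this
        exact ⟨this.2.1, this.1, this.2.2⟩
      refine ⟨mem_univ _, ?_, ?_, ?_⟩
      · intro v hv
        rw [Finset.mem_insert, not_or] at hv
        rw [h1 v hv.2, Function.update_of_ne hv.1]
      · intro v hv
        rcases Finset.mem_insert.1 hv with rfl | hv
        · rw [hxa]; exact (Finset.mem_sdiff.1 hy).1
        · exact (hmem v hv).1
      · intro u hu v hv huv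
        rcases Finset.mem_insert.1 hu with h | hu
        · rcases Finset.mem_insert.1 hv with h' | hv
          · exact absurd (h.trans h'.symm) huv
          · rw [h, hxa]; exact ⟨(hmem v hv).2.1.symm, (hmem v hv).2.2⟩
        · rcases Finset.mem_insert.1 hv with h' | hv
          · rw [h', hxa]; exact ⟨(hmem u hu).2.1, hsymm _ _ _ _ (hmem u hu).2.2⟩
          · exact h3 u hu v hv huv
    refine le_trans ?_ (Nat.cast_le.2 (Finset.card_le_card hsub))
    rw [Finset.card_biUnion]
    · push_cast
      refine le_trans ?_ (Finset.sum_le_sum hrec)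
      rw [Finset.sum_const, nsmul_eq_mul, cc]
      have := cc_pos hθ S.card (δ := θ / 4 * δ) (by positivity)
      calc δ / 2 * cc θ S.card (θ / 4 * δ) * n ^ (S.card + 1)
          = (δ / 2 * n) * (cc θ S.card (θ / 4 * δ) * n ^ S.card) := by ring
        _ ≤ _ := by gcongr
    · intro y _ y' _ hyy'
      rw [Function.onFun, Finset.disjoint_left]
      intro x hx hx'
      rw [Finset.mem_filter] at hx hx'
      have e1 := hx.2.1 a ha
      have e2 := hx'.2.1 a ha
      simp at e1 e2
      exact hyy' (e1.symm.trans e2)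

lemma count_emb' {n : ℕ} {ε θ : ℝ} (hε : 0 < ε) (hθ : 0 < θ) (hθ1 : θ ≤ 1) (hn : 0 < n)
    (R : V → V → Fin n → Fin n → Prop) (hsymm : ∀ u v y z, R u v y z → R v u z y)
    (hR : ∀ u v, u ≠ v → RelGood n ε θ (R u v)) (K : ℕ) (S : Finset V)
    (δ : ℝ) (b : V → Fin n) (Cd : V → Finset (Fin n)) (hK : S.card ≤ K) (hδ : 0 < δ)
    (h1 : ε * (2 * (K + 1)) ≤ δ * (θ / 4) ^ S.card) (h2 : 1 ≤ n * (δ * (θ / 4) ^ S.card))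
    (h3 : ∀ v ∈ S, δ * n ≤ ((Cd v).card : ℝ)) :
    ∃ A : Finset (V → Fin n), cc θ S.card δ * n ^ S.card ≤ (A.card : ℝ) ∧ ∀ x ∈ A,
        (∀ v, v ∉ S → x v = b v) ∧ (∀ v ∈ S, x v ∈ Cd v) ∧
        (∀ u ∈ S, ∀ v ∈ S, u ≠ v → x u ≠ x v ∧ R u v (x u) (x v)) :=
  ⟨_, count_emb hε hθ hθ1 hn R hsymm hR K S δ b Cd hK hδ h1 h2 h3,
    fun _ hx => (Finset.mem_filter.1 hx).2⟩

end host

section switching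

lemma relGood_true {n : ℕ} {ε θ : ℝ} (hθ : 0 < θ) (hθ1 : θ ≤ 1) {R : Fin n → Fin n → Prop}
    (hR : ∀ u v, R u v) : RelGood n ε θ R := by
  constructor
  · intro u
    simp only [hR, Finset.filter_true, Finset.card_univ, Fintype.card_fin]
    have : (0:ℝ) ≤ n := Nat.cast_nonneg _
    nlinarith
  · intro A B _ _
    simp only [hR, Finset.filter_true, Finset.sum_const, nsmul_eq_mul]
    have : (0:ℝ) ≤ (A.card : ℝ) * B.card := by positivity
    nlinarith

lemma relGood_comp {n : ℕ} {ε θ : ℝ} {R : Fin n → Fin n → Prop} (h : RelGood n ε θ R)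
    (f g : Equiv.Perm (Fin n)) : RelGood n ε θ (fun y z => R (f y) (g z)) := by
  constructor
  · intro u
    refine (h.deg (f u)).trans (le_of_eq ?_)
    congr 1
    refine (Finset.card_bij (fun a _ => g a) ?_ ?_ ?_).symm
    · intro a ha; simpa using ha
    · intro a _ b _ hab; exact g.injective hab
    · intro b hb; exact ⟨g.symm b, by simpa using hb, by simp⟩
  · intro A B hA hB
    have := h.reg (A.map f.toEmbedding) (B.map g.toEmbedding) (by simpa using hA) (by simpa using hB)
    simp only [Finset.card_map, Finset.sum_map] at this
    refine this.trans (le_of_eq ?_)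
    refine Finset.sum_congr rfl fun u _ => ?_
    congr 1
    rw [Finset.filter_map, Finset.card_map]
    rfl

variable {Pt : Type*} [Fintype Pt] [DecidableEq Pt]

structure HostGood (n : ℕ) (ε θ : ℝ) (adj : Pt → Pt → Fin n → Fin n → Prop) : Prop where
  symm : ∀ p q u v, adj p q u v → adj q p v u
  good : ∀ p q, p ≠ q → RelGood n ε θ (adj p q)

/-- row `y` of the labelled family `σ` is a clique -/
def RowClique {n : ℕ} (adj : Pt → Pt → Fin n → Fin n → Prop) (σ : Pt → Equiv.Perm (Fin n))
    (y : Fin n) : Prop := ∀ p q, p ≠ q → adj p q (σ p y) (σ q y)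

abbrev Gam (Pt : Type*) := Pt → ZMod 3

def eG (p : Pt) : Gam Pt := Pi.single p 1

lemma eG_diff {p q p' q' : Pt} (hpq : p ≠ q) {c c' : Gam Pt}
    (h1 : c + eG p = c' + eG p') (h2 : c + eG q = c' + eG q') : p = p' ∧ q = q' := by
  have h : eG p - eG q = eG p' - eG q' := by
    have : (c + eG p) - (c + eG q) = (c' + eG p') - (c' + eG q') := by rw [h1, h2]
    simpa using this
  have hp := congrFun h p
  have hq := congrFun h q
  simp only [eG, Pi.sub_apply, Pi.single_apply] at hp hq
  have z1 : (1 : ZMod 3) ≠ 0 := by decide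
  have z2 : (1 : ZMod 3) ≠ -1 := by decide
  have z3 : (-1 : ZMod 3) ≠ 0 := by decide
  constructor
  · by_contra hc
    rw [if_pos trivial, if_neg hpq, if_neg hc] at hp
    split_ifs at hp
    · exact absurd hp (by decide)
    · exact absurd hp (by decide)
  · by_contra hc
    rw [if_pos trivial, if_neg (Ne.symm hpq), if_neg hc] at hq
    split_ifs at hq
    · exact absurd hq (by decide)
    · exact absurd hq (by decide)

/-- the admissible switching tuples -/
noncomputable def swSet {n : ℕ} (adj : Pt → Pt → Fin n → Fin n → Prop)
    (σ : Pt → Equiv.Perm (Fin n)) (y0 : Fin n) (F : Finset (Fin n)) : Finset (Gam Pt → Fin n) :=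
  univ.filter fun x => x 0 = y0 ∧ Function.Injective x ∧ (∀ c, c ≠ 0 → x c ∉ F) ∧
    ∀ c p q, p ≠ q → adj p q (σ p (x (c + eG p))) (σ q (x (c + eG q)))

lemma switch_count {n : ℕ} {ε θ : ℝ} (hε : 0 < ε) (hθ : 0 < θ) (hθ1 : θ ≤ 1) (hn : 0 < n)
    (adj : Pt → Pt → Fin n → Fin n → Prop) (hA : HostGood n ε θ adj)
    (M : ℕ) (hM : Fintype.card (Gam Pt) = M + 1)
    (hεθ : ε * (2 * (M + 1)) ≤ θ / 2 * (θ / 4) ^ M) (hnθ : 1 ≤ n * (θ / 2 * (θ / 4) ^ M))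
    (hnθ' : 1 ≤ n * (θ / 4))
    (σ : Pt → Equiv.Perm (Fin n)) (y0 : Fin n) (F : Finset (Fin n)) (hF : (F.card : ℝ) ≤ θ / 4 * n) :
    cc θ M (θ / 2) * n ^ M ≤ ((swSet adj σ y0 F).card : ℝ) := by
  let R : Gam Pt → Gam Pt → Fin n → Fin n → Prop := fun u v y z =>
    ∀ p q c, p ≠ q → u = c + eG p → v = c + eG q → adj p q (σ p y) (σ q z)
  have hR : ∀ u v, u ≠ v → RelGood n ε θ (R u v) := by
    intro u v _
    by_cases h : ∃ p q c, p ≠ q ∧ u = c + eG p ∧ v = c + eG q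
    · obtain ⟨p, q, c, hpq, hu, hv⟩ := h
      have : R u v = fun y z => adj p q (σ p y) (σ q z) := by
        funext y z
        apply propext
        constructor
        · intro h; exact h p q c hpq hu hv
        · intro h p' q' c' hpq' hu' hv'
          obtain ⟨e1, e2⟩ := eG_diff hpq (hu.symm.trans hu') (hv.symm.trans hv')
          subst e1 e2
          exact h
      rw [this]
      exact relGood_comp (hA.good p q hpq) _ _
    · refine relGood_true hθ hθ1 ?_
      intro y z p q c hpq hu hv
      exact absurd ⟨p, q, c, hpq, hu, hv⟩ h
  have hsymm : ∀ u v y z, R u v y z → R v u z y := by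
    intro u v y z h p q c hpq hu hv
    exact hA.symm _ _ _ _ (h q p c hpq.symm hv hu)
  have hcard : ((univ : Finset (Gam Pt)).erase 0).card = M := by
    rw [Finset.card_erase_of_mem (mem_univ _), Finset.card_univ, hM]; rfl
  have hnR : (0:ℝ) < n := by exact_mod_cast hn
  have hcd : ∀ v ∈ (univ : Finset (Gam Pt)).erase 0,
      θ / 2 * n ≤ (((((univ.filter fun z => R 0 v y0 z) \ F).erase y0).card : ℕ) : ℝ) := by
    intro v hv
    have hv0 : (0 : Gam Pt) ≠ v := by
      simp at hv; exact fun h => hv h.symm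
    have h1 : θ * n ≤ ((univ.filter fun z => R 0 v y0 z).card : ℝ) := by
      convert (hR 0 v hv0).deg y0
    have h2 : ((univ.filter fun z => R 0 v y0 z).card : ℝ) ≤
        ((univ.filter fun z => R 0 v y0 z) \ F).card + F.card := by
      exact_mod_cast Finset.card_le_card_sdiff_add_card
    have h3 : ((((univ.filter fun z => R 0 v y0 z) \ F).card : ℕ) : ℝ) ≤
        (((univ.filter fun z => R 0 v y0 z) \ F).erase y0).card + 1 := by
      have := Finset.pred_card_le_card_erase (s := (univ.filter fun z => R 0 v y0 z) \ F) (a := y0)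
      exact_mod_cast Nat.sub_le_iff_le_add.1 this
    nlinarith
  obtain ⟨A, this, hAx⟩ := count_emb' hε hθ hθ1 hn R hsymm hR M ((univ : Finset (Gam Pt)).erase 0) (θ / 2)
    (fun _ => y0) (fun v => ((univ.filter fun z => R 0 v y0 z) \ F).erase y0) hcard.le
    (by positivity) (by rw [hcard]; exact hεθ) (by rw [hcard]; exact hnθ) hcd
  rw [hcard] at this
  refine this.trans (Nat.cast_le.2 (Finset.card_le_card ?_))
  intro x hx
  unfold swSet
  rw [Finset.mem_filter]
  obtain ⟨h1, h2, h3⟩ := hAx x hx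
  have h0 : x 0 = y0 := h1 0 (by simp)
  have h2' : ∀ v, v ≠ 0 → x v ≠ y0 ∧ x v ∉ F ∧ R 0 v y0 (x v) := by
    intro v hv
    have := h2 v (by simp [hv])
    simp only [Finset.mem_erase, Finset.mem_sdiff, Finset.mem_filter, mem_univ, true_and] at this
    exact ⟨this.1, this.2.2, this.2.1⟩
  refine ⟨mem_univ _, h0, ?_, fun c hc => (h2' c hc).2.1, ?_⟩
  · intro u v huv
    by_contra hne
    by_cases hu : u = 0
    · subst hu
      exact (h2' v (Ne.symm hne)).1 (huv.symm.trans h0)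
    · by_cases hv : v = 0
      · subst hv
        exact (h2' u hu).1 (huv.trans h0)
      · exact (h3 u (by simp [hu]) v (by simp [hv]) hne).1 huv
  · intro c p q hpq
    have hne : c + eG p ≠ c + eG q := by
      intro h
      have := congrFun (add_left_cancel h) p
      simp [eG, Pi.single_apply, hpq] at this
    suffices R (c + eG p) (c + eG q) (x (c + eG p)) (x (c + eG q)) from this p q c hpq rfl rfl
    by_cases hu : c + eG p = 0
    · rw [hu] at hne ⊢
      rw [h0]
      exact (h2' _ hne.symm).2.2
    · by_cases hv : c + eG q = 0
      · rw [hv] at hne ⊢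
        rw [h0]
        exact hsymm _ _ _ _ (h2' _ hne).2.2
      · exact (h3 _ (by simp [hu]) _ (by simp [hv]) hne).2

/-- the shifted family -/
noncomputable def shiftFam {n : ℕ} (x : Gam Pt → Fin n) (σ : Pt → Equiv.Perm (Fin n)) :
    Pt → Equiv.Perm (Fin n) :=
  if h : Function.Injective x then
    fun p => ((Equiv.addRight (eG p)).viaFintypeEmbedding ⟨x, h⟩).trans (σ p)
  else σ

lemma shiftFam_apply {n : ℕ} {x : Gam Pt → Fin n} (h : Function.Injective x)
    (σ : Pt → Equiv.Perm (Fin n)) (p : Pt) (c : Gam Pt) :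
    shiftFam x σ p (x c) = σ p (x (c + eG p)) := by
  unfold shiftFam
  rw [dif_pos h]
  have := Equiv.Perm.viaFintypeEmbedding_apply_image (Equiv.addRight (eG p)) (⟨x, h⟩ : Gam Pt ↪ Fin n) c
  simp only [Equiv.trans_apply]
  have h2 : (⟨x, h⟩ : Gam Pt ↪ Fin n) c = x c := rfl
  rw [h2] at this
  rw [this]; rfl

lemma shiftFam_apply_of_notMem {n : ℕ} {x : Gam Pt → Fin n} (h : Function.Injective x)
    (σ : Pt → Equiv.Perm (Fin n)) (p : Pt) (y : Fin n) (hy : ∀ c, x c ≠ y) :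
    shiftFam x σ p y = σ p y := by
  unfold shiftFam
  rw [dif_pos h]
  simp only [Equiv.trans_apply]
  rw [Equiv.Perm.viaFintypeEmbedding_apply_notMem_range]
  rintro ⟨c, hc⟩
  exact hy c hc

lemma shiftFam_injective {n : ℕ} (x : Gam Pt → Fin n) :
    Function.Injective (shiftFam (Pt := Pt) x) := by
  intro σ τ h
  unfold shiftFam at h
  split_ifs at h with hx
  · funext p
    have := congrFun h p
    ext y
    have h2 := congrArg (fun e : Equiv.Perm (Fin n) =>
      e (((Equiv.addRight (eG p)).viaFintypeEmbedding ⟨x, hx⟩).symm y)) this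
    simp only [Equiv.trans_apply, Equiv.apply_symm_apply] at h2
    rw [h2]
  · exact h

lemma shiftFam_rowClique {n : ℕ} {adj : Pt → Pt → Fin n → Fin n → Prop}
    {σ : Pt → Equiv.Perm (Fin n)} {y0 : Fin n} {F : Finset (Fin n)} {x : Gam Pt → Fin n}
    (hx : x ∈ swSet adj σ y0 F) (y : Fin n) (hy : RowClique adj σ y ∨ y = y0) :
    RowClique adj (shiftFam x σ) y := by
  unfold swSet at hx
  rw [Finset.mem_filter] at hx
  obtain ⟨-, h0, hinj, -, hcl⟩ := hx
  by_cases h : ∃ c, x c = y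
  · obtain ⟨c, rfl⟩ := h
    intro p q hpq
    rw [shiftFam_apply hinj, shiftFam_apply hinj]
    exact hcl c p q hpq
  · push Not at h
    rcases hy with hy | hy
    · intro p q hpq
      rw [shiftFam_apply_of_notMem hinj _ _ _ h, shiftFam_apply_of_notMem hinj _ _ _ h]
      exact hy p q hpq
    · exact absurd (h0.trans hy.symm) (h 0)

lemma card_prescribed {A B : Type*} [Fintype A] [DecidableEq A] [Fintype B] [DecidableEq B]
    (S : Finset A) (b : A → B) :
    (univ.filter fun f : A → B => ∀ a ∈ S, f a = b a).card * Fintype.card B ^ S.card =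
      Fintype.card B ^ Fintype.card A := by
  have : (univ.filter fun f : A → B => ∀ a ∈ S, f a = b a) =
      Fintype.piFinset fun a => if a ∈ S then {b a} else univ := by
    ext f
    simp only [Finset.mem_filter, mem_univ, true_and, Fintype.mem_piFinset]
    refine forall_congr' fun a => ?_
    by_cases h : a ∈ S <;> simp [h]
  rw [this, Fintype.card_piFinset]
  have h2 : ∀ a, (if a ∈ S then ({b a} : Finset B) else univ).card =
      if a ∈ S then 1 else Fintype.card B := by
    intro a; split_ifs <;> simp
  simp only [h2]
  have h3 : Fintype.card B ^ S.card = ∏ a, if a ∈ S then Fintype.card B else 1 := by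
    rw [Finset.prod_ite_mem]; simp
  rw [h3, ← Finset.prod_mul_distrib]
  have : ∀ a, (if a ∈ S then 1 else Fintype.card B) * (if a ∈ S then Fintype.card B else 1) =
      Fintype.card B := by intro a; split_ifs <;> simp
  simp only [this]
  simp

end switching

section spread
variable {Pt : Type*} [Fintype Pt] [DecidableEq Pt]

/-- all labelled clique families -/
noncomputable def OmF {n : ℕ} (adj : Pt → Pt → Fin n → Fin n → Prop) :
    Finset (Pt → Equiv.Perm (Fin n)) := univ.filter fun σ => ∀ y, RowClique adj σ y

/-- the switching property used from here on -/
structure SwProp {n : ℕ} (adj : Pt → Pt → Fin n → Fin n → Prop) (M : ℕ) (c β : ℝ) : Prop where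
  hM : Fintype.card (Gam Pt) = M + 1
  hc : 0 < c
  hβ : 0 < β
  hn : 0 < n
  sw : ∀ σ y0 (F : Finset (Fin n)), (F.card : ℝ) ≤ β * n →
    c * n ^ M ≤ ((swSet adj σ y0 F).card : ℝ)

lemma double_count {n : ℕ} {adj : Pt → Pt → Fin n → Fin n → Prop} {M : ℕ} {c β : ℝ}
    (h : SwProp adj M c β) (y0 : Fin n) (F : Finset (Fin n)) (hF : (F.card : ℝ) ≤ β * n)
    (𝒜 ℬ : Finset (Pt → Equiv.Perm (Fin n)))
    (Q : (Pt → Equiv.Perm (Fin n)) → Finset (Gam Pt → Fin n)) (q : ℝ)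
    (hQ : ∀ σ, ((Q σ).card : ℝ) ≤ q)
    (hAB : ∀ σ ∈ 𝒜, ∀ x ∈ swSet adj σ y0 F, shiftFam x σ ∈ ℬ ∧ x ∈ Q (shiftFam x σ)) :
    c * n ^ M * 𝒜.card ≤ q * ℬ.card := by
  have h1 : (𝒜.sigma fun σ => swSet adj σ y0 F).card ≤ (ℬ.sigma fun σ => Q σ).card := by
    refine Finset.card_le_card_of_injOn (fun z => ⟨shiftFam z.2 z.1, z.2⟩) ?_ ?_
    · intro z hz
      have hz := Finset.mem_sigma.1 (Finset.mem_coe.1 hz)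
      exact Finset.mem_coe.2 (Finset.mem_sigma.2 (hAB z.1 hz.1 z.2 hz.2))
    · rintro ⟨σ, x⟩ _ ⟨τ, x'⟩ _ hE
      simp only [Sigma.mk.injEq, heq_eq_eq] at hE
      obtain ⟨h1, rfl⟩ := hE
      rw [shiftFam_injective x h1]
  rw [Finset.card_sigma, Finset.card_sigma] at h1
  calc c * n ^ M * 𝒜.card = ∑ σ ∈ 𝒜, c * n ^ M := by
        rw [Finset.sum_const, nsmul_eq_mul]; ring
    _ ≤ ∑ σ ∈ 𝒜, ((swSet adj σ y0 F).card : ℝ) := Finset.sum_le_sum fun σ _ => h.sw σ y0 F hF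
    _ ≤ ∑ σ ∈ ℬ, ((Q σ).card : ℝ) := by exact_mod_cast h1
    _ ≤ ∑ σ ∈ ℬ, q := Finset.sum_le_sum fun σ _ => hQ σ
    _ = _ := by rw [Finset.sum_const, nsmul_eq_mul]; ring

lemma Q_card {n M : ℕ} (hn : 0 < n) (hM : Fintype.card (Gam Pt) = M + 1)
    (Q : Finset (Gam Pt → Fin n)) (S : Finset (Gam Pt)) (g : ℕ) (hS : S.card = g + 1)
    (hQ : ∀ x ∈ Q, ∀ x' ∈ Q, ∀ a ∈ S, x a = x' a) :
    (Q.card : ℝ) ≤ n ^ M / n ^ g := by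
  rcases Q.eq_empty_or_nonempty with rfl | ⟨x0, hx0⟩
  · simp; positivity
  have hnR : (0:ℝ) < n := by exact_mod_cast hn
  have h1 := card_prescribed S x0
  rw [Fintype.card_fin, hM, hS] at h1
  have h2 : Q.card ≤ (univ.filter fun f : Gam Pt → Fin n => ∀ a ∈ S, f a = x0 a).card := by
    refine Finset.card_le_card fun x hx => ?_
    rw [Finset.mem_filter]
    exact ⟨mem_univ _, fun a ha => hQ x hx x0 hx0 a ha⟩
  rw [le_div_iff₀ (by positivity)]
  have h3 : (Q.card : ℝ) * n ^ (g + 1) ≤ n ^ (M + 1) := by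
    calc (Q.card : ℝ) * n ^ (g + 1) ≤
        ((univ.filter fun f : Gam Pt → Fin n => ∀ a ∈ S, f a = x0 a).card : ℝ) * n ^ (g + 1) := by
          gcongr
      _ = _ := by exact_mod_cast h1
  rw [pow_succ, pow_succ, ← mul_assoc] at h3
  exact le_of_mul_le_mul_right h3 hnR

lemma omF_lower {n : ℕ} {adj : Pt → Pt → Fin n → Fin n → Prop} {M : ℕ} {c β : ℝ}
    (h : SwProp adj M c β) :
    c ^ n * (n.factorial : ℝ) ^ Fintype.card Pt ≤ ((OmF adj).card : ℝ) := by
  have hn := h.hn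
  have hnR : (0:ℝ) < n := by exact_mod_cast hn
  let A : ℕ → Finset (Pt → Equiv.Perm (Fin n)) := fun k =>
    univ.filter fun σ => ∀ y : Fin n, y.val < k → RowClique adj σ y
  have key : ∀ k ≤ n, c ^ k * (n.factorial : ℝ) ^ Fintype.card Pt ≤ ((A k).card : ℝ) := by
    intro k
    induction k with
    | zero =>
      intro _
      simp [A, Fintype.card_perm]
    | succ k ih =>
      intro hk
      have hk' : k < n := hk
      have h1 := double_count h ⟨k, hk'⟩ ∅ (by simp; have := h.hβ; positivity) (A k) (A (k + 1))
        (fun _ => univ.filter fun x => x 0 = ⟨k, hk'⟩) (n ^ M / n ^ 0)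
        (fun σ => Q_card hn h.hM _ {0} 0 (by simp) (by
          intro x hx x' hx' a ha
          simp only [Finset.mem_filter, mem_univ, true_and, Finset.mem_singleton] at hx hx' ha
          subst ha
          rw [hx, hx']))
        (by
          intro σ hσ x hx
          rw [Finset.mem_filter] at hσ
          refine ⟨?_, ?_⟩
          · rw [Finset.mem_filter]
            refine ⟨mem_univ _, fun y hy => shiftFam_rowClique hx y ?_⟩
            rcases Nat.lt_succ_iff_lt_or_eq.1 hy with hy | hy
            · exact Or.inl (hσ.2 y hy)
            · exact Or.inr (Fin.ext hy)
          · rw [Finset.mem_filter]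
            unfold swSet at hx
            rw [Finset.mem_filter] at hx
            exact ⟨mem_univ _, hx.2.1⟩)
      rw [pow_zero, div_one] at h1
      have hpos : (0:ℝ) < n ^ M := by positivity
      have h2 : c * ((A k).card : ℝ) ≤ (A (k + 1)).card := by
        refine le_of_mul_le_mul_left ?_ hpos
        linarith
      have h3 := ih hk'.le
      rw [pow_succ]
      have := mul_le_mul_of_nonneg_left h3 h.hc.le
      linarith
  have := key n le_rfl
  refine this.trans (Nat.cast_le.2 (Finset.card_le_card ?_))
  intro σ hσ
  rw [Finset.mem_filter] at hσ
  unfold OmF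
  rw [Finset.mem_filter]
  exact ⟨mem_univ _, fun y => hσ.2 y y.2⟩

/-- number of families with prescribed values -/
noncomputable def MM {n : ℕ} (adj : Pt → Pt → Fin n → Fin n → Prop) (D : Finset (Pt × Fin n))
    (v : Pt × Fin n → Fin n) : Finset (Pt → Equiv.Perm (Fin n)) :=
  (OmF adj).filter fun σ => ∀ z ∈ D, σ z.1 z.2 = v z

lemma eG_inj {p q : Pt} (h : eG p = eG q) : p = q := by
  by_contra hne
  have := congrFun h p
  simp [eG, Pi.single_apply, hne] at this

lemma eG_ne_zero (p : Pt) : eG p ≠ 0 := by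
  intro h
  have := congrFun h p
  simp [eG] at this

lemma MM_step {n : ℕ} {adj : Pt → Pt → Fin n → Fin n → Prop} {M : ℕ} {c β : ℝ}
    (h : SwProp adj M c β) (D : Finset (Pt × Fin n)) (v : Pt × Fin n → Fin n) (y : Fin n)
    (hD : ((D.image Prod.snd).card : ℝ) ≤ β * n) :
    c * n ^ (D.filter fun z => z.2 = y).card * (MM adj D v).card ≤
      ((MM adj (D.filter fun z => z.2 ≠ y) v).card : ℝ) := by
  have hn := h.hn
  have hnR : (0:ℝ) < n := by exact_mod_cast hn
  set g := (D.filter fun z => z.2 = y).card with hg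
  let S : Finset (Gam Pt) := insert 0 ((D.filter fun z => z.2 = y).image fun z => -eG z.1)
  have hS : S.card = g + 1 := by
    rw [Finset.card_insert_of_notMem, Finset.card_image_of_injOn]
    · intro z hz z' hz' hE
      simp only [Finset.coe_filter, Set.mem_setOf_eq] at hz hz'
      simp only [neg_inj] at hE
      exact Prod.ext (eG_inj hE) (hz.2.trans hz'.2.symm)
    · rw [Finset.mem_image]
      rintro ⟨z, _, hz⟩
      exact eG_ne_zero z.1 (neg_eq_zero.1 hz)
  have h1 := double_count h y (D.image Prod.snd) hD (MM adj D v) (MM adj (D.filter fun z => z.2 ≠ y) v)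
    (fun σ => univ.filter fun x => x 0 = y ∧ ∀ z ∈ D, z.2 = y → σ z.1 (x (-eG z.1)) = v z)
    (n ^ M / n ^ g)
    (fun σ => Q_card hn h.hM _ S g hS (by
      intro x hx x' hx' a ha
      simp only [Finset.mem_filter, mem_univ, true_and] at hx hx'
      simp only [S, Finset.mem_insert, Finset.mem_image, Finset.mem_filter] at ha
      rcases ha with rfl | ⟨z, hz, rfl⟩
      · rw [hx.1, hx'.1]
      · exact (σ z.1).injective ((hx.2 z hz.1 hz.2).trans (hx'.2 z hz.1 hz.2).symm)))
    (by
      intro σ hσ x hx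
      unfold MM OmF at hσ
      simp only [Finset.mem_filter, mem_univ, true_and] at hσ
      have hx' := hx
      unfold swSet at hx'
      rw [Finset.mem_filter] at hx'
      obtain ⟨-, h0, hinj, hF, -⟩ := hx'
      refine ⟨?_, ?_⟩
      · unfold MM OmF
        simp only [Finset.mem_filter, mem_univ, true_and]
        refine ⟨fun y' => shiftFam_rowClique hx y' (Or.inl (hσ.1 y')), ?_⟩
        rintro z ⟨hz, hzy⟩
        rw [shiftFam_apply_of_notMem hinj, hσ.2 z hz]
        intro c' hc'
        by_cases hc0 : c' = 0
        · subst hc0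
          exact hzy (hc'.symm.trans h0)
        · exact hF c' hc0 (Finset.mem_image.2 ⟨z, hz, hc'.symm⟩)
      · simp only [Finset.mem_filter, mem_univ, true_and]
        refine ⟨h0, fun z hz hzy => ?_⟩
        rw [shiftFam_apply hinj, neg_add_cancel, h0, ← hzy]
        exact hσ.2 z hz)
  have hpos : (0:ℝ) < n ^ M := by positivity
  have hpos2 : (0:ℝ) < n ^ g := by positivity
  rw [div_mul_eq_mul_div, le_div_iff₀ hpos2] at h1
  refine le_of_mul_le_mul_left ?_ hpos
  linarith

lemma MM_small {n : ℕ} {adj : Pt → Pt → Fin n → Fin n → Prop} {M : ℕ} {c β K : ℝ}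
    (h : SwProp adj M c β) (hK1 : 1 ≤ K) (hK : 1 ≤ K * c) (v : Pt × Fin n → Fin n) :
    ∀ (k : ℕ) (D : Finset (Pt × Fin n)), D.card ≤ k → ((D.image Prod.snd).card : ℝ) ≤ β * n →
    ((MM adj D v).card : ℝ) ≤ (OmF adj).card * (K / n) ^ D.card := by
  have hn := h.hn
  have hnR : (0:ℝ) < n := by exact_mod_cast hn
  intro k
  induction k with
  | zero =>
    intro D hD _
    have : D = ∅ := by rw [← Finset.card_eq_zero]; omega
    subst this
    simp [MM]
  | succ k ih =>
    intro D hD hrow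
    rcases D.eq_empty_or_nonempty with rfl | ⟨z0, hz0⟩
    · simp [MM]
    have h1 := MM_step h D v z0.2 hrow
    have hsum : (D.filter fun z => z.2 = z0.2).card + (D.filter fun z => z.2 ≠ z0.2).card = D.card :=
      Finset.card_filter_add_card_filter_not _
    have hg : 1 ≤ (D.filter fun z => z.2 = z0.2).card :=
      Finset.card_pos.2 ⟨z0, Finset.mem_filter.2 ⟨hz0, rfl⟩⟩
    have h2 := ih (D.filter fun z => z.2 ≠ z0.2) (by omega) (by
      refine le_trans ?_ hrow
      exact Nat.cast_le.2 (Finset.card_le_card (Finset.image_subset_image (Finset.filter_subset _ _))))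
    set g := (D.filter fun z => z.2 = z0.2).card
    set d' := (D.filter fun z => z.2 ≠ z0.2).card
    have h3 : c * n ^ g * (MM adj D v).card ≤ (OmF adj).card * (K / n) ^ d' := h1.trans h2
    have hKg : 1 ≤ c * K ^ g := by
      have : K ≤ K ^ g := le_self_pow₀ hK1 (by omega)
      nlinarith [h.hc]
    rw [← hsum, pow_add]
    have h4 : ((MM adj D v).card : ℝ) ≤ (c * K ^ g) * (MM adj D v).card :=
      le_mul_of_one_le_left (Nat.cast_nonneg _) hKg
    have hng : (0:ℝ) < n ^ g := by positivity
    calc ((MM adj D v).card : ℝ) ≤ (c * K ^ g) * (MM adj D v).card := h4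
      _ = (K / n) ^ g * (c * n ^ g * (MM adj D v).card) := by rw [div_pow]; field_simp
      _ ≤ (K / n) ^ g * ((OmF adj).card * (K / n) ^ d') := by
          have : 0 ≤ (K / n) ^ g := by positivity
          gcongr
      _ = _ := by ring

lemma MM_large {n : ℕ} {adj : Pt → Pt → Fin n → Fin n → Prop} {M : ℕ} {c β : ℝ}
    (h : SwProp adj M c β) (v : Pt × Fin n → Fin n) (D : Finset (Pt × Fin n)) :
    ((MM adj D v).card : ℝ) * n ^ D.card ≤
      (OmF adj).card * (Real.exp (Fintype.card Pt) / c) ^ n := by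
  have hn := h.hn
  have hnR : (0:ℝ) < n := by exact_mod_cast hn
  have h1 := card_prescribed D v
  have h2 : (MM adj D v).card ≤ (univ.filter fun f : Pt × Fin n → Fin n => ∀ a ∈ D, f a = v a).card := by
    refine Finset.card_le_card_of_injOn (fun σ z => σ z.1 z.2) ?_ ?_
    · intro σ hσ
      have hσ := Finset.mem_filter.1 (Finset.mem_coe.1 hσ)
      simp only [Finset.coe_filter, mem_univ, true_and, Set.mem_setOf_eq]
      exact hσ.2
    · intro σ _ τ _ hE
      funext p
      ext y
      have := congrFun hE (p, y)
      simp only at this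
      rw [this]
  have h3 : ((MM adj D v).card : ℝ) * n ^ D.card ≤ (n ^ n) ^ Fintype.card Pt := by
    have : (MM adj D v).card * n ^ D.card ≤ (n ^ n) ^ Fintype.card Pt := by
      calc (MM adj D v).card * n ^ D.card ≤
        (univ.filter fun f : Pt × Fin n → Fin n => ∀ a ∈ D, f a = v a).card * n ^ D.card :=
          Nat.mul_le_mul_right _ h2
        _ = _ := by
          rw [Fintype.card_fin] at h1
          rw [h1, Fintype.card_prod, Fintype.card_fin, ← pow_mul, mul_comm]
    exact_mod_cast this
  have h4 : (n:ℝ) ^ n ≤ Real.exp n * n.factorial := by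
    have := Real.pow_div_factorial_le_exp (n:ℝ) hnR.le n
    rwa [div_le_iff₀ (by positivity)] at this
  have h5 := omF_lower h
  have hc := h.hc
  calc ((MM adj D v).card : ℝ) * n ^ D.card ≤ (n ^ n) ^ Fintype.card Pt := h3
    _ ≤ (Real.exp n * n.factorial) ^ Fintype.card Pt := by gcongr
    _ = (Real.exp (Fintype.card Pt) / c) ^ n * (c ^ n * (n.factorial : ℝ) ^ Fintype.card Pt) := by
        rw [mul_pow, div_pow, ← Real.exp_nat_mul, ← Real.exp_nat_mul, mul_comm (n:ℝ)]
        field_simp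
    _ ≤ (Real.exp (Fintype.card Pt) / c) ^ n * (OmF adj).card := by gcongr
    _ = _ := by ring

/-- vertex spread -/
lemma MM_spread (Pt : Type*) [Fintype Pt] [DecidableEq Pt] {c β : ℝ} (hc : 0 < c) (hβ : 0 < β) :
    ∃ K : ℝ, 1 ≤ K ∧ ∀ {n : ℕ} {adj : Pt → Pt → Fin n → Fin n → Prop} {M : ℕ},
      SwProp adj M c β → ∀ (v : Pt × Fin n → Fin n) (D : Finset (Pt × Fin n)),
      ((MM adj D v).card : ℝ) ≤ (OmF adj).card * (K / n) ^ D.card := by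
  set B := max 1 (Real.exp (Fintype.card Pt) / c) with hB
  have hB1 : 1 ≤ B := le_max_left _ _
  set L := ⌈1 / β⌉₊ with hL
  refine ⟨max (B ^ L) (1 / c), le_trans (one_le_pow₀ hB1) (le_max_left _ _), ?_⟩
  intro n adj M h v D
  have hn := h.hn
  have hnR : (0:ℝ) < n := by exact_mod_cast hn
  by_cases hrow : ((D.image Prod.snd).card : ℝ) ≤ β * n
  · refine MM_small h (le_trans (one_le_pow₀ hB1) (le_max_left _ _)) ?_ v D.card D le_rfl hrow
    rw [← div_le_iff₀ hc]; exact le_max_right _ _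
  · push Not at hrow
    have h1 : ((D.image Prod.snd).card : ℝ) ≤ D.card := Nat.cast_le.2 Finset.card_image_le
    have hnL : n ≤ L * D.card := by
      have : (n:ℝ) ≤ L * D.card := by
        have h2 : 1 / β ≤ L := Nat.le_ceil _
        have h3 : 1 ≤ L * β := by rwa [div_le_iff₀ hβ] at h2
        have h4 : β * n ≤ D.card := (hrow.le.trans h1)
        have : (0:ℝ) ≤ L := Nat.cast_nonneg _
        nlinarith
      exact_mod_cast this
    have h2 := MM_large h v D
    rw [div_pow, mul_div_assoc', le_div_iff₀ (by positivity)]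
    refine h2.trans ?_
    gcongr
    calc (Real.exp (Fintype.card Pt) / c) ^ n ≤ B ^ n := by
          gcongr; exact le_max_right _ _
      _ ≤ B ^ (L * D.card) := pow_le_pow_right₀ hB1 hnL
      _ = (B ^ L) ^ D.card := by rw [pow_mul]
      _ ≤ _ := by gcongr; exact le_max_left _ _

end spread

section patterns
variable {s : ℕ}

abbrev Pr2 (s : ℕ) := {ab : Fin s × Fin s // ab.1 < ab.2}

/-- the graph of a pattern -/
def gD (D : Finset (Pr2 s)) : SimpleGraph (Fin s) :=
  SimpleGraph.fromRel fun a b => ∃ d ∈ D, d.1 = (a, b)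

/-- the vertices that are not minimal in their component -/
noncomputable def NM (D : Finset (Pr2 s)) : Finset (Fin s) :=
  univ.filter fun b => ∃ a, a < b ∧ (gD D).Reachable a b

noncomputable def rk (D : Finset (Pr2 s)) : ℕ := (NM D).card

lemma gD_adj {D : Finset (Pr2 s)} {d : Pr2 s} (hd : d ∈ D) : (gD D).Adj d.1.1 d.1.2 := by
  unfold gD
  rw [SimpleGraph.fromRel_adj]
  exact ⟨ne_of_lt d.2, Or.inl ⟨d, hd, rfl⟩⟩

lemma exists_minrep (D : Finset (Pr2 s)) (b : Fin s) :
    ∃ a, a ∉ NM D ∧ (gD D).Reachable a b := by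
  induction b using WellFoundedLT.induction with
  | ind b ih =>
    by_cases hb : b ∈ NM D
    · unfold NM at hb
      rw [Finset.mem_filter] at hb
      obtain ⟨-, a, hab, hr⟩ := hb
      obtain ⟨a', ha', hr'⟩ := ih a hab
      exact ⟨a', ha', hr'.trans hr⟩
    · exact ⟨b, hb, SimpleGraph.Reachable.refl _⟩

lemma not_mem_NM_unique {D : Finset (Pr2 s)} {a a' : Fin s} (ha : a ∉ NM D) (ha' : a' ∉ NM D)
    (h : (gD D).Reachable a a') : a = a' := by
  rcases lt_trichotomy a a' with hl | hl | hl
  · exact absurd (Finset.mem_filter.2 ⟨mem_univ _, a, hl, h⟩) ha'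
  · exact hl
  · exact absurd (Finset.mem_filter.2 ⟨mem_univ _, a', hl, h.symm⟩) ha

lemma card_le_rk (D : Finset (Pr2 s)) : 2 * D.card ≤ rk D * (rk D + 1) := by
  have hmem : ∀ d ∈ D, d.1.2 ∈ NM D := fun d hd =>
    Finset.mem_filter.2 ⟨mem_univ _, d.1.1, d.2, (gD_adj hd).reachable⟩
  have h1 : D.card ≤ (NM D).sym2.card := by
    refine Finset.card_le_card_of_injOn
      (fun d => if d.1.1 ∈ NM D then s(d.1.1, d.1.2) else s(d.1.2, d.1.2)) ?_ ?_
    · intro d hd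
      have := hmem d hd
      simp only [Finset.mem_coe]
      split_ifs with h <;> simp [h, this]
    · intro d hd d' hd' hE
      have m1 := hmem d hd
      have m2 := hmem d' hd'
      have l1 := d.2
      have l2 := d'.2
      have r1 := (gD_adj hd).reachable
      have r2 := (gD_adj hd').reachable
      simp only at hE
      apply Subtype.ext
      split_ifs at hE with h h' h'
      · rw [Sym2.eq_iff] at hE
        rcases hE with ⟨e1, e2⟩ | ⟨e1, e2⟩
        · exact Prod.ext e1 e2
        · rw [e1, e2] at l1; exact absurd l1 (lt_asymm l2)
      · rw [Sym2.eq_iff] at hE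
        have : d.1.1 = d.1.2 := by rcases hE with ⟨e1, e2⟩ | ⟨e1, e2⟩ <;> rw [e1, e2]
        exact absurd this (ne_of_lt l1)
      · rw [Sym2.eq_iff] at hE
        have : d'.1.1 = d'.1.2 := by rcases hE with ⟨e1, e2⟩ | ⟨e1, e2⟩ <;> rw [← e1, ← e2]
        exact absurd this (ne_of_lt l2)
      · rw [Sym2.eq_iff] at hE
        have e : d.1.2 = d'.1.2 := by rcases hE with ⟨e1, e2⟩ | ⟨e1, e2⟩ <;> exact e1
        refine Prod.ext ?_ e
        refine not_mem_NM_unique h h' ?_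
        rw [← e] at r2
        exact r1.trans r2.symm
  rw [Finset.card_sym2] at h1
  have h2 := Nat.triangle_succ (rk D)
  have h3 : ((rk D + 1).choose 2) * 2 = (rk D + 1) * (rk D) := by
    rw [Nat.choose_two_right, Nat.div_mul_cancel]
    · simp
    · simpa using (Nat.even_mul_pred_self (rk D + 1)).two_dvd
  have h4 : (NM D).card = rk D := rfl
  rw [h4] at h1
  nlinarith

lemma rk_lt (hs : 0 < s) (D : Finset (Pr2 s)) : rk D + 1 ≤ s := by
  obtain ⟨a, ha, -⟩ := exists_minrep D ⟨0, hs⟩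
  have : (NM D).card < (univ : Finset (Fin s)).card :=
    Finset.card_lt_card (Finset.ssubset_univ_iff.2 fun h => ha (by rw [h]; exact mem_univ _))
  unfold rk
  simpa using this

lemma card_Pr2 (s : ℕ) : 2 * Fintype.card (Pr2 s) = s * (s - 1) := by
  have h : Fintype.card (Pr2 s) = (univ.filter fun ab : Fin s × Fin s => ab.1 < ab.2).card :=
    Fintype.card_subtype _
  have h2 : (univ.filter fun ab : Fin s × Fin s => ab.2 < ab.1).card =
      (univ.filter fun ab : Fin s × Fin s => ab.1 < ab.2).card := by
    refine Finset.card_bij (fun ab _ => (ab.2, ab.1)) ?_ ?_ ?_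
    · intro ab h; simpa using h
    · intro ab _ cd _ h; simp only [Prod.mk.injEq] at h; exact Prod.ext h.2 h.1
    · intro ab h; exact ⟨(ab.2, ab.1), by simpa using h, rfl⟩
  have h3 : (univ.filter fun ab : Fin s × Fin s => ab.1 = ab.2).card = s := by
    have : (univ.filter fun ab : Fin s × Fin s => ab.1 = ab.2) = (univ : Finset (Fin s)).diag := by
      ext ab; simp
    rw [this]; simp
  have h4 : (univ : Finset (Fin s × Fin s)).card = s * s := by simp
  have h5 : (univ : Finset (Fin s × Fin s)) = ((univ.filter fun ab : Fin s × Fin s => ab.1 < ab.2) ∪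
      (univ.filter fun ab : Fin s × Fin s => ab.2 < ab.1)) ∪
      (univ.filter fun ab : Fin s × Fin s => ab.1 = ab.2) := by
    ext ab
    simp only [mem_univ, Finset.mem_union, Finset.mem_filter, true_and, true_iff]
    rcases lt_trichotomy ab.1 ab.2 with h | h | h <;> tauto
  rw [h5, Finset.card_union_of_disjoint, Finset.card_union_of_disjoint, h2, h3, ← h] at h4
  · rcases s with _ | s
    · simp
    · simp only [Nat.add_sub_cancel]; nlinarith
  · rw [Finset.disjoint_filter]; intro ab _ h1 h2; exact lt_asymm h1 h2
  · rw [Finset.disjoint_left]; intro ab h1 h2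
    simp only [Finset.mem_union, Finset.mem_filter, mem_univ, true_and] at h1 h2
    rw [h2] at h1
    rcases h1 with h1 | h1 <;> exact lt_irrefl _ h1

lemma rk_gain (D : Finset (Pr2 s)) (hne : D.Nonempty) (hfull : D ≠ univ) :
    2 * D.card + 1 ≤ s * rk D := by
  obtain ⟨d, hd⟩ := hne
  have hs : 0 < s := lt_of_le_of_lt (Nat.zero_le _) d.1.1.2
  have h1 := card_le_rk D
  have h2 := rk_lt hs D
  have hpos : 1 ≤ rk D := by
    refine Finset.card_pos.2 ⟨d.1.2, ?_⟩
    exact Finset.mem_filter.2 ⟨mem_univ _, d.1.1, d.2, (gD_adj hd).reachable⟩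
  by_cases h : rk D + 2 ≤ s
  · nlinarith
  · have h3 : D.card < Fintype.card (Pr2 s) := (Finset.card_lt_iff_ne_univ D).2 hfull
    have h4 := card_Pr2 s
    have h5 : rk D = s - 1 := by omega
    rw [h5]
    have : s * (s - 1) = (s - 1) * s := by ring
    omega

lemma rk_univ (hs : 0 < s) : rk (univ : Finset (Pr2 s)) = s - 1 := by
  have h1 := card_le_rk (univ : Finset (Pr2 s))
  rw [Finset.card_univ, card_Pr2] at h1
  have h2 := rk_lt hs (univ : Finset (Pr2 s))
  obtain ⟨t, rfl⟩ : ∃ t, s = t + 1 := ⟨s - 1, by omega⟩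
  simp only [Nat.add_sub_cancel] at h1 ⊢
  by_contra hne
  have : rk (univ : Finset (Pr2 (t + 1))) + 1 ≤ t := by omega
  nlinarith

/-- functions constant along the pattern -/
noncomputable def constOn (n : ℕ) (D : Finset (Pr2 s)) : Finset (Fin s → Fin n) :=
  univ.filter fun f => ∀ d ∈ D, f d.1.1 = f d.1.2

lemma const_reach {n : ℕ} {D : Finset (Pr2 s)} {f : Fin s → Fin n} (hf : f ∈ constOn n D)
    {a b : Fin s} (h : (gD D).Reachable a b) : f a = f b := by
  obtain ⟨w⟩ := h
  induction w with
  | nil => rfl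
  | cons hadj _ ih =>
    rw [← ih]
    unfold constOn at hf
    rw [Finset.mem_filter] at hf
    unfold gD at hadj
    rw [SimpleGraph.fromRel_adj] at hadj
    rcases hadj.2 with ⟨d, hd, he⟩ | ⟨d, hd, he⟩
    · have := hf.2 d hd; rw [he] at this; exact this
    · have := hf.2 d hd; rw [he] at this; exact this.symm

lemma card_constOn (n : ℕ) (D : Finset (Pr2 s)) : (constOn n D).card * n ^ rk D ≤ n ^ s := by
  have h1 : (constOn n D).card ≤ Fintype.card ({a // a ∉ NM D} → Fin n) := by
    rw [← Finset.card_univ]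
    refine Finset.card_le_card_of_injOn (fun f a => f a.1) (fun _ _ => by simp) ?_
    intro f hf f' hf' hE
    funext b
    obtain ⟨a, ha, hr⟩ := exists_minrep D b
    rw [← const_reach hf hr, ← const_reach hf' hr]
    exact congrFun hE ⟨a, ha⟩
  rw [Fintype.card_fun, Fintype.card_fin] at h1
  have h2 : Fintype.card {a // a ∉ NM D} + rk D = s := by
    have := Fintype.card_subtype_compl (fun a => a ∈ NM D)
    rw [this, Fintype.card_fin]
    have h3 : Fintype.card {a // a ∈ NM D} = rk D := by simp [rk]
    rw [h3]
    have := Finset.card_le_univ (NM D)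
    rw [Fintype.card_fin] at this
    unfold rk
    omega
  calc (constOn n D).card * n ^ rk D ≤ n ^ Fintype.card {a // a ∉ NM D} * n ^ rk D :=
        Nat.mul_le_mul_right _ h1
    _ = n ^ s := by rw [← pow_add, h2]

end patterns

section model
variable {m s n : ℕ}

abbrev PtT (m s : ℕ) := Fin m × Fin s
abbrev Sg (m s n : ℕ) := PtT m s → Equiv.Perm (Fin n)
abbrev Hyp (m s n : ℕ) := Fin m × (Fin s → Fin n)
abbrev Edg (m s n : ℕ) := Fin m × Pr2 s × Fin n × Fin n
abbrev Rw (m n : ℕ) := Fin m × Fin n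

def eh (h : Hyp m s n) (d : Pr2 s) : Edg m s n := (h.1, d, h.2 d.1.1, h.2 d.1.2)
noncomputable def EH (h : Hyp m s n) : Finset (Edg m s n) := univ.image (eh h)
def row (σ : Sg m s n) (t : Rw m n) : Hyp m s n := (t.1, fun j => σ (t.1, j) t.2)
noncomputable def SS (σ : Sg m s n) : Finset (Hyp m s n) := univ.image (row σ)
noncomputable def ES (σ : Sg m s n) : Finset (Edg m s n) := (SS σ).biUnion EH

lemma eh_inj (h : Hyp m s n) : Function.Injective (eh h) := by
  intro d d' hE
  exact (Prod.mk.inj (Prod.mk.inj hE).2).1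

lemma card_EH (h : Hyp m s n) : (EH h).card = Fintype.card (Pr2 s) := by
  unfold EH
  rw [Finset.card_image_of_injective _ (eh_inj h), Finset.card_univ]

lemma mem_EH {h : Hyp m s n} {e : Edg m s n} : e ∈ EH h ↔ eh h e.2.1 = e ∧ True := by
  unfold EH
  simp only [Finset.mem_image, mem_univ, true_and, and_true]
  constructor
  · rintro ⟨d, rfl⟩; rfl
  · intro h; exact ⟨_, h⟩

lemma row_inj (hs : 0 < s) (σ : Sg m s n) : Function.Injective (row σ) := by
  intro t t' h
  have h1 : t.1 = t'.1 := (Prod.mk.inj h).1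
  have h2 := congrFun (Prod.mk.inj h).2 ⟨0, hs⟩
  simp only [h1] at h2
  exact Prod.ext h1 ((σ _).injective h2)

/-- relative position of row `t` of `σ0` in `σ` -/
def rho (σ0 σ : Sg m s n) (t : Rw m n) : Fin s → Fin n :=
  fun j => (σ (t.1, j)).symm (σ0 (t.1, j) t.2)

def MMb (adj : PtT m s → PtT m s → Fin n → Fin n → Prop) (K : ℝ) : Prop :=
  ∀ (v : PtT m s × Fin n → Fin n) (D : Finset (PtT m s × Fin n)),
      ((MM adj D v).card : ℝ) ≤ (OmF adj).card * (K / n) ^ D.card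

lemma count_rows {adj : PtT m s → PtT m s → Fin n → Fin n → Prop} {K : ℝ} 
    (hK : MMb adj K) (σ0 : Sg m s n) (Tch : Finset (Rw m n)) (Dt : Rw m n → Finset (Pr2 s))
    (𝒜 : Finset (Sg m s n)) (h𝒜 : ∀ σ ∈ 𝒜, σ ∈ OmF adj ∧ ∀ t ∈ Tch, rho σ0 σ t ∈ constOn n (Dt t)) :
    (𝒜.card : ℝ) ≤ (OmF adj).card * ∏ t ∈ Tch, ((K / n) ^ s * ((constOn n (Dt t)).card : ℝ)) := by
  let f : Sg m s n → (↥Tch → Fin s → Fin n) := fun σ t => rho σ0 σ t.1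
  let P : Finset (↥Tch → Fin s → Fin n) := Fintype.piFinset fun t : ↥Tch => constOn n (Dt t.1)
  have hmaps : ∀ σ ∈ 𝒜, f σ ∈ P := by
    intro σ hσ
    rw [Fintype.mem_piFinset]
    intro t
    exact (h𝒜 σ hσ).2 t.1 t.2
  have hP : (P.card : ℝ) = ∏ t ∈ Tch, ((constOn n (Dt t)).card : ℝ) := by
    rw [Fintype.card_piFinset]
    push_cast
    exact Finset.prod_coe_sort Tch fun t => ((constOn n (Dt t)).card : ℝ)
  have hfib : ∀ g ∈ P, ((𝒜.filter fun σ => f σ = g).card : ℝ) ≤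
      (OmF adj).card * ((K / n) ^ s) ^ Tch.card := by
    intro g _
    let z : ↥Tch × Fin s → PtT m s × Fin n := fun tj => ((tj.1.1.1, tj.2), g tj.1 tj.2)
    rcases (𝒜.filter fun σ => f σ = g).eq_empty_or_nonempty with he | ⟨σ1, hσ1⟩
    · have h1 := hK (fun z => z.2) (univ.image z)
      have h2 : (0:ℝ) ≤ (OmF adj).card * ((K / n) ^ s) ^ Tch.card := by
        by_cases hOm : (OmF adj).card = 0
        · simp [hOm]
        · by_cases hn : n = 0
          · subst hn
            simp only [Nat.cast_zero, div_zero]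
            positivity
          · by_cases hs : s = 0
            · subst hs; simp
            by_cases hT : Tch.card = 0
            · simp [hT]
            obtain ⟨t, ht⟩ := Finset.card_pos.1 (Nat.pos_of_ne_zero hT)
            have h3 := hK (fun z => z.2) {((t.1, ⟨0, Nat.pos_of_ne_zero hs⟩), t.2)}
            rw [Finset.card_singleton, pow_one] at h3
            have h4 : (0:ℝ) ≤ (OmF adj).card * (K / n) := le_trans (Nat.cast_nonneg _) h3
            have h5 : (0:ℝ) < (OmF adj).card := by exact_mod_cast Nat.pos_of_ne_zero hOm
            have h6 : 0 ≤ K / n := nonneg_of_mul_nonneg_right h4 h5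
            positivity
      rw [he]; simpa using h2
    · have hσ1' := Finset.mem_filter.1 hσ1
      have hg : ∀ (t : ↥Tch) j, g t j = (σ1 (t.1.1, j)).symm (σ0 (t.1.1, j) t.1.2) := by
        intro t j; rw [← hσ1'.2]; rfl
      have hz : Function.Injective z := by
        rintro ⟨⟨⟨i, y⟩, ht⟩, j⟩ ⟨⟨⟨i', y'⟩, ht'⟩, j'⟩ hE
        have e1 := (Prod.mk.inj (Prod.mk.inj hE).1).1
        have e2 := (Prod.mk.inj (Prod.mk.inj hE).1).2
        have e3 := (Prod.mk.inj hE).2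
        simp only at e1 e2 e3
        subst e1; subst e2
        rw [hg, hg] at e3
        have e4 := (σ0 (i, j)).injective ((σ1 (i, j)).symm.injective e3)
        simp only at e4
        subst e4; rfl
      have hsub : (𝒜.filter fun σ => f σ = g) ⊆
          MM adj (univ.image z) (fun w => σ1 w.1 w.2) := by
        intro σ hσ
        have hσ' := Finset.mem_filter.1 hσ
        refine Finset.mem_filter.2 ⟨(h𝒜 σ hσ'.1).1, ?_⟩
        intro w hw
        obtain ⟨⟨t, j⟩, -, rfl⟩ := Finset.mem_image.1 hw
        show σ (t.1.1, j) (g t j) = σ1 (t.1.1, j) (g t j)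
        have h1 : g t j = (σ (t.1.1, j)).symm (σ0 (t.1.1, j) t.1.2) := by
          rw [← hσ'.2]; rfl
        have h2 := hg t j
        conv_lhs => rw [h1]
        conv_rhs => rw [h2]
        simp
      have h1 := hK (fun w => σ1 w.1 w.2) (univ.image z)
      rw [Finset.card_image_of_injective _ hz, Finset.card_univ, Fintype.card_prod,
        Fintype.card_coe, Fintype.card_fin, mul_comm Tch.card s, pow_mul] at h1
      refine le_trans ?_ h1
      exact_mod_cast Finset.card_le_card hsub
  have h1 : (𝒜.card : ℝ) = ∑ g ∈ P, ((𝒜.filter fun σ => f σ = g).card : ℝ) := by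
    rw [Finset.card_eq_sum_card_fiberwise hmaps]; push_cast; rfl
  rw [h1]
  calc _ ≤ ∑ g ∈ P, ((OmF adj).card * ((K / n) ^ s) ^ Tch.card : ℝ) := Finset.sum_le_sum hfib
    _ = _ := by
        rw [Finset.sum_const, nsmul_eq_mul, hP, Finset.prod_mul_distrib, Finset.prod_const]; ring

lemma constOn_univ_bound (hs : 0 < s) (hn : 0 < n) :
    ((constOn n (univ : Finset (Pr2 s))).card : ℝ) ≤ n := by
  have h := card_constOn n (univ : Finset (Pr2 s))
  rw [rk_univ hs] at h
  have h2 : n ^ s = n * n ^ (s - 1) := by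
    rw [← pow_succ']; congr 1; omega
  rw [h2] at h
  exact_mod_cast Nat.le_of_mul_le_mul_right h (by positivity)

/-- hypergraph spread -/
lemma hyper_spread {adj : PtT m s → PtT m s → Fin n → Fin n → Prop} {K : ℝ} (hK0 : 0 ≤ K)
    (hs : 0 < s) (hn : 0 < n) (hK : MMb adj K) :
    SpreadFam (fun U => (OmF adj).card * ((K / n) ^ s * n) ^ U.card) (OmF adj) SS := by
  intro U
  by_cases hU : ∃ σ0 : Sg m s n, U ⊆ SS σ0
  swap
  · push Not at hU
    have : ((OmF adj).filter fun ω => U ⊆ SS ω) = ∅ := by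
      apply Finset.filter_false_of_mem
      intro σ _; exact hU σ
    rw [this, Finset.card_empty, Nat.cast_zero]
    positivity
  obtain ⟨σ0, hσ0⟩ := hU
  have h := count_rows hK σ0 (univ.filter fun t => row σ0 t ∈ U) (fun _ => univ)
    ((OmF adj).filter fun ω => U ⊆ SS ω) (by
      intro σ hσ
      have hσ' := Finset.mem_filter.1 hσ
      refine ⟨hσ'.1, fun t ht => ?_⟩
      have ht' := (Finset.mem_filter.1 ht).2
      obtain ⟨t', -, ht2⟩ := Finset.mem_image.1 (hσ'.2 ht')
      have e1 : t'.1 = t.1 := (Prod.mk.inj ht2).1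
      have e2 : ∀ j, rho σ0 σ t j = t'.2 := by
        intro j
        have := congrFun (Prod.mk.inj ht2).2 j
        simp only [e1] at this
        unfold rho
        rw [← this]; simp
      refine Finset.mem_filter.2 ⟨mem_univ _, fun d _ => ?_⟩
      rw [e2, e2])
  have hc : (univ.filter fun t => row σ0 t ∈ U).card = U.card := by
    rw [← Finset.card_image_of_injective _ (row_inj hs σ0)]
    congr 1
    ext h
    simp only [Finset.mem_image, Finset.mem_filter, mem_univ, true_and]
    constructor
    · rintro ⟨t, ht, rfl⟩; exact ht
    · intro hh
      obtain ⟨t, -, rfl⟩ := Finset.mem_image.1 (hσ0 hh)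
      exact ⟨t, hh, rfl⟩
  refine h.trans ?_
  rw [Finset.prod_const, hc]
  have := constOn_univ_bound hs hn
  beta_reduce
  gcongr

/-- the pattern of `U` at row `t` -/
noncomputable def pat (σ0 : Sg m s n) (U : Finset (Edg m s n)) (t : Rw m n) : Finset (Pr2 s) :=
  univ.filter fun d => eh (row σ0 t) d ∈ U

noncomputable def NE (adj : PtT m s → PtT m s → Fin n → Fin n → Prop) (U : Finset (Edg m s n)) : ℝ :=
  (((OmF adj).filter fun σ => U ⊆ ES σ).card : ℝ)

lemma edge_spread {adj : PtT m s → PtT m s → Fin n → Fin n → Prop} {K : ℝ} 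
    (hK : MMb adj K) (σ0 : Sg m s n) (U : Finset (Edg m s n)) :
    NE adj U ≤ (OmF adj).card * ∏ t : Rw m n, (if pat σ0 U t = ∅ then 1 else
      ((K / n) ^ s * ((constOn n (pat σ0 U t)).card : ℝ))) := by
  have h := count_rows hK σ0 (univ.filter fun t => ¬ pat σ0 U t = ∅) (pat σ0 U)
    ((OmF adj).filter fun ω => U ⊆ ES ω) (by
      intro σ hσ
      have hσ' := Finset.mem_filter.1 hσ
      refine ⟨hσ'.1, fun t ht => ?_⟩
      refine Finset.mem_filter.2 ⟨mem_univ _, fun d hd => ?_⟩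
      have hd' := (Finset.mem_filter.1 hd).2
      obtain ⟨h, hh, hh2⟩ := Finset.mem_biUnion.1 (hσ'.2 hd')
      obtain ⟨t', -, rfl⟩ := Finset.mem_image.1 hh
      have hE := (mem_EH.1 hh2).1
      have e1 : t'.1 = t.1 := (Prod.mk.inj hE).1
      have e2 := (Prod.mk.inj (Prod.mk.inj (Prod.mk.inj hE).2).2).1
      have e3 := (Prod.mk.inj (Prod.mk.inj (Prod.mk.inj hE).2).2).2
      simp only [row, eh, e1] at e2 e3
      unfold rho
      rw [← e2, ← e3]; simp)
  refine h.trans (le_of_eq ?_)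
  rw [Finset.prod_filter]
  congr 1
  refine Finset.prod_congr rfl fun t _ => ?_
  by_cases ht : pat σ0 U t = ∅ <;> simp [ht]

end model

section rounds

lemma chernoff_sub {X : Type*} [DecidableEq X] (T : Finset X) {a c l1 : ℝ} (ha : 0 ≤ a) (hc : 0 ≤ c) :
    ∑ U ∈ T.powerset.filter (fun U => l1 < (U.card : ℝ)), a ^ U.card ≤
      Real.exp (-(c * l1)) * Real.exp (Real.exp c * a * T.card) := by
  have h1 : ∀ U ∈ T.powerset.filter (fun U => l1 < (U.card : ℝ)), a ^ U.card ≤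
      Real.exp (-(c * l1)) * (Real.exp c * a) ^ U.card := by
    intro U hU
    have hl := (Finset.mem_filter.1 hU).2
    rw [mul_pow, ← Real.exp_nat_mul, ← mul_assoc, ← Real.exp_add]
    refine le_mul_of_one_le_left (by positivity) (Real.one_le_exp ?_)
    nlinarith
  calc _ ≤ ∑ U ∈ T.powerset.filter (fun U => l1 < (U.card : ℝ)),
        Real.exp (-(c * l1)) * (Real.exp c * a) ^ U.card := Finset.sum_le_sum h1
    _ ≤ ∑ U ∈ T.powerset, Real.exp (-(c * l1)) * (Real.exp c * a) ^ U.card :=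
        Finset.sum_le_sum_of_subset_of_nonneg (Finset.filter_subset _ _)
          fun _ _ _ => by positivity
    _ = Real.exp (-(c * l1)) * (Real.exp c * a + 1) ^ T.card := by
        rw [← Finset.mul_sum]
        congr 1
        rw [← Finset.sum_pow_mul_eq_add_pow]
        simp
    _ ≤ _ := by
        rw [mul_comm (Real.exp c * a) (T.card : ℝ), Real.exp_nat_mul]
        have := Real.add_one_le_exp (Real.exp c * a)
        gcongr

lemma red_base {X : Type*} (I : Type*) [Fintype X] [DecidableEq X] [Fintype I]
    (N : Finset X → ℝ) (Cl : Finset X → Prop) (l : ℝ) : Red I N Cl l l 0 0 := by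
  intro Om T _ _ hc
  have : ∀ W, badNum Om T W l = 0 := by
    intro W
    unfold badNum
    rw [Nat.cast_eq_zero, Finset.card_eq_zero]
    refine Finset.filter_false_of_mem fun ω hω hg => hg ⟨ω, hω, Finset.subset_union_right, ?_⟩
    refine le_trans ?_ (hc ω hω)
    exact_mod_cast Finset.card_le_card Finset.sdiff_subset
  simp only [this]
  rw [Ex_const]

lemma hyper_red {X : Type*} (I : Type*) [Fintype X] [DecidableEq X] [Fintype I] {A q l : ℝ}
    (hA : 0 ≤ A) (hq : 0 < q) (hl : 0 ≤ l) (k : ℕ) (hk : k * (2 * Real.exp 2 * q) < 1) :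
    Red I (fun U : Finset X => A * q ^ U.card) (fun _ => True) (2 ^ k * l) l
      (k * (2 * Real.exp 2 * q)) (A * (k * Real.exp (-l))) := by
  set π := 2 * Real.exp 2 * q with hπ
  have hπ0 : 0 < π := by positivity
  induction k with
  | zero => simpa using red_base I _ _ l
  | succ k ih =>
    push_cast at hk ⊢
    have hk' : k * π < 1 := by nlinarith
    have hkp : 0 ≤ k * π := by positivity
    have ih' := ih hk'
    have hπ1 : π < 1 := by nlinarith
    have h1 : Red I (fun U : Finset X => A * q ^ U.card) (fun _ => True) (2 ^ (k+1) * l)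
        (2 ^ k * l) π (A * Real.exp (-l)) := by
      refine red_one hπ0 hπ1.le (by positivity) ?_
      intro T _ hT _
      have h2 : ∀ U : Finset X, (π⁻¹) ^ U.card * (A * q ^ U.card) =
          A * ((2 * Real.exp 2)⁻¹) ^ U.card := by
        intro U
        have : (2 * Real.exp 2)⁻¹ = π⁻¹ * q := by
          rw [hπ]; field_simp
        rw [this, mul_pow]; ring
      simp only [h2]
      rw [← Finset.mul_sum]
      refine mul_le_mul_of_nonneg_left ?_ hA
      refine (chernoff_sub T (c := 2) (by positivity) (by norm_num)).trans ?_
      rw [← Real.exp_add]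
      apply Real.exp_le_exp.2
      have h3 : Real.exp 2 * (2 * Real.exp 2)⁻¹ = 1 / 2 := by
        have := Real.exp_pos 2
        field_simp
      rw [h3]
      have h4 : (1:ℝ) ≤ 2 ^ k := one_le_pow₀ (by norm_num)
      have h5 : l ≤ 2 ^ k * l := by nlinarith
      rw [pow_succ] at hT
      nlinarith
    have h6 := red_comp (fun _ _ _ _ => trivial) hπ0.le hπ1.le hkp hk'.le h1 ih'
    refine red_mono ?_ ?_ (by linarith) (le_of_eq ?_) h6
    · nlinarith
    · nlinarith
    · ring

end rounds

section edgerounds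
variable {m s n : ℕ}

def ClE (T : Finset (Edg m s n)) : Prop := ∃ σ0 : Sg m s n, T ⊆ ES σ0

lemma ehrow_inj (σ0 : Sg m s n) : Function.Injective
    (fun td : Rw m n × Pr2 s => eh (row σ0 td.1) td.2) := by
  rintro ⟨⟨i, y⟩, d⟩ ⟨⟨i', y'⟩, d'⟩ hE
  have e1 : i = i' := (Prod.mk.inj hE).1
  have e2 : d = d' := (Prod.mk.inj (Prod.mk.inj hE).2).1
  have e3 := (Prod.mk.inj (Prod.mk.inj (Prod.mk.inj hE).2).2).1
  subst e1; subst e2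
  have := (σ0 _).injective e3
  simp only at this
  subst this; rfl

lemma mem_ES {σ0 : Sg m s n} {e : Edg m s n} : e ∈ ES σ0 ↔
    ∃ td : Rw m n × Pr2 s, eh (row σ0 td.1) td.2 = e := by
  unfold ES SS EH
  simp only [Finset.mem_biUnion, Finset.mem_image, mem_univ, true_and]
  constructor
  · rintro ⟨_, ⟨t, rfl⟩, d, rfl⟩; exact ⟨(t, d), rfl⟩
  · rintro ⟨⟨t, d⟩, rfl⟩; exact ⟨_, ⟨t, rfl⟩, d, rfl⟩

lemma card_pat {σ0 : Sg m s n} {U : Finset (Edg m s n)} (hU : U ⊆ ES σ0) :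
    U.card = ∑ t, (pat σ0 U t).card := by
  have h1 : U = (univ.filter fun td : Rw m n × Pr2 s => eh (row σ0 td.1) td.2 ∈ U).image
      (fun td : Rw m n × Pr2 s => eh (row σ0 td.1) td.2) := by
    ext e
    simp only [Finset.mem_image, Finset.mem_filter, mem_univ, true_and]
    constructor
    · intro he
      obtain ⟨td, rfl⟩ := mem_ES.1 (hU he)
      exact ⟨td, he, rfl⟩
    · rintro ⟨td, h, rfl⟩; exact h
  conv_lhs => rw [h1]
  rw [Finset.card_image_of_injective _ (ehrow_inj σ0), ← Finset.univ_product_univ]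
  rw [Finset.card_filter, Finset.sum_product]
  refine Finset.sum_congr rfl fun t _ => ?_
  rw [← Finset.card_filter]; rfl

lemma pat_injOn {σ0 : Sg m s n} {U U' : Finset (Edg m s n)} (hU : U ⊆ ES σ0) (hU' : U' ⊆ ES σ0)
    (h : pat σ0 U = pat σ0 U') : U = U' := by
  have key : ∀ t d, eh (row σ0 t) d ∈ U ↔ eh (row σ0 t) d ∈ U' := by
    intro t d
    have := congrFun h t
    have h2 : d ∈ pat σ0 U t ↔ d ∈ pat σ0 U' t := by rw [this]
    simpa [pat] using h2
  ext e
  constructor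
  · intro he
    obtain ⟨td, rfl⟩ := mem_ES.1 (hU he)
    exact (key _ _).1 he
  · intro he
    obtain ⟨td, rfl⟩ := mem_ES.1 (hU' he)
    exact (key _ _).2 he

lemma edge_round {adj : PtT m s → PtT m s → Fin n → Fin n → Prop} {K p w c l0 l1 : ℝ}
    (I : Type*) [Fintype I] (hK0 : 0 ≤ K)
    (hK : MMb adj K) (hp : 0 < p) (hp1 : p ≤ 1) (hc : 0 ≤ c) (hw0 : 0 ≤ w)
    (hw : ∀ D : Finset (Pr2 s), D.Nonempty →
      (p⁻¹) ^ D.card * ((K / n) ^ s * ((constOn n D).card : ℝ)) ≤ w) :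
    Red I (NE adj) ClE l0 l1 p ((OmF adj).card * (Real.exp (-(c * l1)) *
      Real.exp (2 ^ Fintype.card (Pr2 s) * Real.exp (c * Fintype.card (Pr2 s)) * w * l0))) := by
  refine red_one hp hp1 (by positivity) ?_
  rintro T ⟨σ0, hσ0⟩ hT -
  set b := Fintype.card (Pr2 s) with hb
  let g : Finset (Pr2 s) → ℝ := fun D => if D = ∅ then 1 else
      (Real.exp c * p⁻¹) ^ D.card * ((K / n) ^ s * ((constOn n D).card : ℝ))
  have hg0 : ∀ D, 0 ≤ g D := by
    intro D
    simp only [g]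
    split_ifs
    · norm_num
    · positivity
  have hgw : ∀ D : Finset (Pr2 s), D.Nonempty → g D ≤ Real.exp (c * b) * w := by
    intro D hD
    simp only [g, if_neg hD.ne_empty]
    rw [mul_pow, mul_assoc]
    refine mul_le_mul ?_ (hw D hD) (by positivity) (by positivity)
    rw [← Real.exp_nat_mul]
    apply Real.exp_le_exp.2
    have : (D.card : ℝ) ≤ b := by exact_mod_cast Finset.card_le_univ D
    nlinarith
  have h1 : ∀ U ∈ T.powerset.filter (fun U => l1 < (U.card : ℝ)), (p⁻¹) ^ U.card * NE adj U ≤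
      (OmF adj).card * Real.exp (-(c * l1)) * ∏ t, g (pat σ0 U t) := by
    intro U hU
    have hl := (Finset.mem_filter.1 hU).2
    have hUT := Finset.mem_powerset.1 (Finset.mem_filter.1 hU).1
    have h2 := edge_spread hK σ0 U
    have h3 : ∏ t, g (pat σ0 U t) = (Real.exp c * p⁻¹) ^ U.card *
        ∏ t : Rw m n, (if pat σ0 U t = ∅ then 1 else
          ((K / n) ^ s * ((constOn n (pat σ0 U t)).card : ℝ))) := by
      rw [card_pat (hUT.trans hσ0), ← Finset.prod_pow_eq_pow_sum, ← Finset.prod_mul_distrib]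
      refine Finset.prod_congr rfl fun t _ => ?_
      simp only [g]
      split_ifs with h
      · rw [h]; simp
      · rfl
    rw [h3]
    have h4 : (p⁻¹) ^ U.card ≤ Real.exp (-(c * l1)) * (Real.exp c * p⁻¹) ^ U.card := by
      rw [mul_pow, ← Real.exp_nat_mul, ← mul_assoc, ← Real.exp_add]
      refine le_mul_of_one_le_left (by positivity) (Real.one_le_exp ?_)
      nlinarith
    calc _ ≤ (Real.exp (-(c * l1)) * (Real.exp c * p⁻¹) ^ U.card) * _ :=
          mul_le_mul h4 h2 (Nat.cast_nonneg _) (by positivity)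
      _ = _ := by ring
  have h5 : ∑ U ∈ T.powerset.filter (fun U => l1 < (U.card : ℝ)), ∏ t, g (pat σ0 U t) ≤
      ∏ t : Rw m n, ∑ D ∈ (pat σ0 T t).powerset, g D := by
    rw [Finset.prod_univ_sum]
    rw [← Finset.sum_image (f := fun x : Rw m n → Finset (Pr2 s) => ∏ t, g (x t)) (g := pat σ0)
      (s := T.powerset.filter (fun U => l1 < (U.card : ℝ)))]
    · refine Finset.sum_le_sum_of_subset_of_nonneg ?_ fun x _ _ => Finset.prod_nonneg fun t _ => hg0 _
      intro x hx
      obtain ⟨U, hU, rfl⟩ := Finset.mem_image.1 hx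
      have hUT := Finset.mem_powerset.1 (Finset.mem_filter.1 hU).1
      rw [Fintype.mem_piFinset]
      intro t
      rw [Finset.mem_powerset]
      intro d hd
      exact Finset.mem_filter.2 ⟨mem_univ _, hUT (Finset.mem_filter.1 hd).2⟩
    · intro U hU U' hU' h
      have hUT := Finset.mem_powerset.1 (Finset.mem_filter.1 hU).1
      have hUT' := Finset.mem_powerset.1 (Finset.mem_filter.1 hU').1
      exact pat_injOn (hUT.trans hσ0) (hUT'.trans hσ0) h
  have h6 : ∀ t : Rw m n, ∑ D ∈ (pat σ0 T t).powerset, g D ≤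
      Real.exp (2 ^ b * Real.exp (c * b) * w * (pat σ0 T t).card) := by
    intro t
    have hsum : ∑ D ∈ (pat σ0 T t).powerset, g D ≤
        1 + ((2 ^ b * (Real.exp (c * b) * w)) * (pat σ0 T t).card) := by
      by_cases he : pat σ0 T t = ∅
      · rw [he]; simp [g]
      · have hsplit := Finset.sum_erase_add (pat σ0 T t).powerset g (Finset.empty_mem_powerset _)
        rw [← hsplit]
        have hg1 : g ∅ = 1 := by simp [g]
        rw [hg1, add_comm]
        have hb1 : ∑ D ∈ ((pat σ0 T t).powerset.erase ∅), g D ≤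
            ∑ D ∈ ((pat σ0 T t).powerset.erase ∅), (Real.exp (c * b) * w) :=
          Finset.sum_le_sum fun D hD => hgw D (Finset.nonempty_iff_ne_empty.2 (Finset.mem_erase.1 hD).1)
        rw [Finset.sum_const, nsmul_eq_mul] at hb1
        have hb2 : (((pat σ0 T t).powerset.erase ∅).card : ℝ) ≤ 2 ^ b := by
          have h7 : ((pat σ0 T t).powerset.erase ∅).card ≤ (univ : Finset (Finset (Pr2 s))).card :=
            Finset.card_le_card (Finset.subset_univ _)
          rw [Finset.card_univ, Fintype.card_finset] at h7
          exact_mod_cast h7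
        have hb3 : (1:ℝ) ≤ (pat σ0 T t).card := by
          exact_mod_cast Finset.card_pos.2 (Finset.nonempty_iff_ne_empty.2 he)
        have hb4 : 0 ≤ Real.exp (c * b) * w := by positivity
        have hb5 : (((pat σ0 T t).powerset.erase ∅).card : ℝ) * (Real.exp (c * b) * w) ≤
            2 ^ b * (Real.exp (c * b) * w) := mul_le_mul_of_nonneg_right hb2 hb4
        have hb6 : 2 ^ b * (Real.exp (c * b) * w) ≤
            2 ^ b * (Real.exp (c * b) * w) * (pat σ0 T t).card :=
          le_mul_of_one_le_right (by positivity) hb3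
        linarith
    refine hsum.trans ?_
    rw [add_comm, ← mul_assoc (2 ^ b : ℝ)]
    exact Real.add_one_le_exp _
  calc _ ≤ ∑ U ∈ T.powerset.filter (fun U => l1 < (U.card : ℝ)),
        (OmF adj).card * Real.exp (-(c * l1)) * ∏ t, g (pat σ0 U t) := Finset.sum_le_sum h1
    _ = (OmF adj).card * Real.exp (-(c * l1)) *
        ∑ U ∈ T.powerset.filter (fun U => l1 < (U.card : ℝ)), ∏ t, g (pat σ0 U t) := by
        rw [← Finset.mul_sum]
    _ ≤ (OmF adj).card * Real.exp (-(c * l1)) *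
        ∏ t : Rw m n, Real.exp (2 ^ b * Real.exp (c * b) * w * (pat σ0 T t).card) := by
        refine mul_le_mul_of_nonneg_left ?_ (by positivity)
        exact h5.trans (Finset.prod_le_prod (fun t _ => Finset.sum_nonneg fun D _ => hg0 D) fun t _ => h6 t)
    _ ≤ _ := by
        rw [← Real.exp_sum, ← Finset.mul_sum, mul_assoc]
        refine mul_le_mul_of_nonneg_left ?_ (Nat.cast_nonneg _)
        refine mul_le_mul_of_nonneg_left ?_ (Real.exp_pos _).le
        apply Real.exp_le_exp.2
        refine mul_le_mul_of_nonneg_left ?_ (by positivity)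
        rw [← Nat.cast_sum, ← card_pat hσ0]
        exact hT

/-- numerics for the edge rounds -/
lemma edge_w {K p L : ℝ} (hK0 : 0 ≤ K) (hn : 0 < n) (hs : 0 < s) (hp : 0 < p) (hL : 1 ≤ L)
    (hp2 : (p⁻¹) ^ s ≤ (n:ℝ) ^ 2) (hLn : L ^ s ≤ n)
    (hpb : (p⁻¹) ^ Fintype.card (Pr2 s) ≤ (n:ℝ) ^ (s - 1) / L)
    (D : Finset (Pr2 s)) (hD : D.Nonempty) :
    (p⁻¹) ^ D.card * ((K / n) ^ s * ((constOn n D).card : ℝ)) ≤ K ^ s / L := by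
  have hnR : (0:ℝ) < n := by exact_mod_cast hn
  have hn1 : (1:ℝ) ≤ n := by exact_mod_cast hn
  have hL0 : 0 < L := by linarith
  have h1 : ((constOn n D).card : ℝ) * (n:ℝ) ^ rk D ≤ (n:ℝ) ^ s := by exact_mod_cast card_constOn n D
  have h2 : (K / n) ^ s * ((constOn n D).card : ℝ) ≤ K ^ s * ((n:ℝ) ^ rk D)⁻¹ := by
    rw [div_pow, div_mul_eq_mul_div, mul_div_assoc]
    refine mul_le_mul_of_nonneg_left ?_ (by positivity)
    rw [div_le_iff₀ (by positivity), ← div_eq_inv_mul, le_div_iff₀ (by positivity)]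
    exact h1
  have h3 : (p⁻¹) ^ D.card * ((n:ℝ) ^ rk D)⁻¹ ≤ L⁻¹ := by
    by_cases hf : D = univ
    · rw [hf, rk_univ hs, Finset.card_univ, ← div_eq_mul_inv, div_le_iff₀ (by positivity)]
      rw [← div_eq_inv_mul]; exact hpb
    · have hg := rk_gain D hD hf
      refine le_of_pow_le_pow_left₀ hs.ne' (by positivity) ?_
      have e0 : ((p⁻¹) ^ D.card * ((n:ℝ) ^ rk D)⁻¹) ^ s =
          ((p⁻¹) ^ s) ^ D.card * ((n:ℝ) ^ (s * rk D))⁻¹ := by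
        rw [mul_pow, ← pow_mul (p⁻¹), mul_comm D.card s, pow_mul (p⁻¹), inv_pow ((n:ℝ) ^ rk D),
          ← pow_mul (n:ℝ), mul_comm (rk D) s]
      rw [e0, inv_pow L]
      have e1 : ((p⁻¹) ^ s) ^ D.card ≤ (n:ℝ) ^ (2 * D.card) := by
        rw [pow_mul]; exact pow_le_pow_left₀ (by positivity) hp2 _
      have e2 : (n:ℝ) ^ (2 * D.card) * n ≤ (n:ℝ) ^ (s * rk D) := by
        rw [← pow_succ]; exact pow_le_pow_right₀ hn1 hg
      rw [← div_eq_mul_inv, div_le_iff₀ (by positivity), ← div_eq_inv_mul, le_div_iff₀ (by positivity)]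
      calc _ ≤ (n:ℝ) ^ (2 * D.card) * n := mul_le_mul e1 hLn (by positivity) (by positivity)
        _ ≤ _ := e2
  calc _ ≤ (p⁻¹) ^ D.card * (K ^ s * ((n:ℝ) ^ rk D)⁻¹) := mul_le_mul_of_nonneg_left h2 (by positivity)
    _ = K ^ s * ((p⁻¹) ^ D.card * ((n:ℝ) ^ rk D)⁻¹) := by ring
    _ ≤ K ^ s * L⁻¹ := mul_le_mul_of_nonneg_left h3 (by positivity)
    _ = _ := by rw [div_eq_mul_inv]

/-- all edge rounds together; `x = √L`. -/
lemma edge_red {adj : PtT m s → PtT m s → Fin n → Fin n → Prop} {K p x : ℝ}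
    (I : Type*) [Fintype I] (hK0 : 0 ≤ K) (hK : MMb adj K) (hs : 2 ≤ s)
    (hp : 0 < p) (hx : 1 ≤ x)
    (hw : ∀ D : Finset (Pr2 s), D.Nonempty →
      (p⁻¹) ^ D.card * ((K / n) ^ s * ((constOn n D).card : ℝ)) ≤ K ^ s / x ^ 2)
    (Q : ℝ) (hQ : Q = 2 ^ Fintype.card (Pr2 s) * K ^ s * Fintype.card (Pr2 s)) (hxQ : Q ≤ Real.log x)
    (k : ℕ) (hk : (k + 1) * p < 1) :
    Red I (NE adj) ClE (Fintype.card (Pr2 s) * x ^ k) (1 / 2) ((k + 1) * p)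
      ((OmF adj).card * ((k + 1) *
        Real.exp (-(Real.log x / (2 * Fintype.card (Pr2 s))) + Q))) := by
  set b := Fintype.card (Pr2 s) with hb
  have hb1 : 1 ≤ b := by
    rw [hb, Nat.succ_le_iff, Fintype.card_pos_iff]
    exact ⟨⟨(⟨0, by omega⟩, ⟨1, by omega⟩), by simp⟩⟩
  have hbR : (1:ℝ) ≤ b := by exact_mod_cast hb1
  have hx0 : 0 < x := by linarith
  have hlog : 0 ≤ Real.log x := Real.log_nonneg hx
  have hc0 : 0 ≤ Real.log x / b := by positivity
  have hcb : Real.exp (Real.log x / b * b) = x := by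
    rw [div_mul_cancel₀ _ (by positivity), Real.exp_log hx0]
  have hQ0 : 0 ≤ Q := by rw [hQ]; positivity
  induction k with
  | zero =>
    simp only [Nat.cast_zero, zero_add, one_mul, pow_zero, mul_one] at hk ⊢
    have h := edge_round (c := Real.log x / b) (l0 := b) (l1 := 1 / 2) I hK0 hK hp hk.le hc0
      (w := K ^ s / x ^ 2) (by positivity) hw
    refine red_mono hp.le le_rfl hk ?_ h
    refine mul_le_mul_of_nonneg_left ?_ (Nat.cast_nonneg _)
    rw [← Real.exp_add, hcb]
    apply Real.exp_le_exp.2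
    have e1 : 2 ^ b * x * (K ^ s / x ^ 2) * b = Q / x := by
      rw [hQ]; field_simp
    have e2 : Q / x ≤ Q := div_le_self hQ0 hx
    rw [← hb, e1]
    have e3 : Real.log x / b * (1 / 2) = Real.log x / (2 * b) := by field_simp
    linarith
  | succ k ih =>
    push_cast at hk ⊢
    have hk0 : (k + 1 : ℝ) * p < 1 := by nlinarith
    have ih' := ih hk0
    have hp1 : p < 1 := by nlinarith [mul_nonneg (Nat.cast_nonneg k : (0:ℝ) ≤ k) hp.le]
    have h := edge_round (c := Real.log x / b) (l0 := b * x ^ (k + 1)) (l1 := b * x ^ k)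
      I hK0 hK hp hp1.le hc0 (w := K ^ s / x ^ 2) (by positivity) hw
    have h' : Red I (NE adj) ClE (b * x ^ (k + 1)) (b * x ^ k) p
        ((OmF adj).card * Real.exp (-(Real.log x / (2 * b)) + Q)) := by
      refine red_mono hp.le le_rfl hp1 ?_ h
      refine mul_le_mul_of_nonneg_left ?_ (Nat.cast_nonneg _)
      rw [← Real.exp_add, hcb]
      apply Real.exp_le_exp.2
      have e1 : 2 ^ b * x * (K ^ s / x ^ 2) * (b * x ^ (k + 1)) = Q * x ^ k := by
        rw [hQ, pow_succ]; field_simp; ring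
      rw [← hb, e1]
      have e2 : Real.log x / b * (b * x ^ k) = Real.log x * x ^ k := by field_simp
      rw [e2]
      have e3 : (1:ℝ) ≤ x ^ k := one_le_pow₀ hx
      have e4 : Real.log x / (2 * b) ≤ Real.log x := div_le_self hlog (by linarith)
      nlinarith
    have h6 := red_comp (fun T T' hT ⟨σ0, h0⟩ => ⟨σ0, hT.trans h0⟩) hp.le hp1.le
      (by positivity) hk0.le h' ih'
    have hpk : 0 ≤ p * ((k + 1) * p) := by positivity
    refine red_mono ?_ ?_ (by linarith) (le_of_eq ?_) h6
    · nlinarith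
    · nlinarith
    · ring

end edgerounds

section coupling

lemma Ex_split {X : Type*} [Fintype X] [DecidableEq X] (e : X) (t : ℝ) (P P1 P0 : X → ℝ)
    (h1 : ∀ x, x ≠ e → P1 x = P x) (h0 : ∀ x, x ≠ e → P0 x = P x) (he : P e = t) (he1 : P1 e = 1)
    (he0 : P0 e = 0) (f : Finset X → ℝ) : Ex P f = t * Ex P1 f + (1 - t) * Ex P0 f := by
  unfold Ex
  rw [Finset.mul_sum, Finset.mul_sum, ← Finset.sum_add_distrib]
  refine Finset.sum_congr rfl fun W _ => ?_
  have key : wt P W = t * wt P1 W + (1 - t) * wt P0 W := by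
    unfold wt
    rw [← Finset.mul_prod_erase univ _ (mem_univ e),
      ← Finset.mul_prod_erase univ (fun x => if x ∈ W then P1 x else 1 - P1 x) (mem_univ e),
      ← Finset.mul_prod_erase univ (fun x => if x ∈ W then P0 x else 1 - P0 x) (mem_univ e)]
    have e1 : ∏ x ∈ univ.erase e, (if x ∈ W then P1 x else 1 - P1 x) =
        ∏ x ∈ univ.erase e, (if x ∈ W then P x else 1 - P x) :=
      Finset.prod_congr rfl fun x hx => by rw [h1 x (Finset.ne_of_mem_erase hx)]
    have e0 : ∏ x ∈ univ.erase e, (if x ∈ W then P0 x else 1 - P0 x) =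
        ∏ x ∈ univ.erase e, (if x ∈ W then P x else 1 - P x) :=
      Finset.prod_congr rfl fun x hx => by rw [h0 x (Finset.ne_of_mem_erase hx)]
    rw [e1, e0, he, he1, he0]
    split_ifs <;> ring
  rw [key]; ring

lemma Ex_disjoint {X : Type*} [Fintype X] [DecidableEq X] (P : X → ℝ) (F : Finset X) :
    Ex P (fun W => if Disjoint W F then 1 else 0) = ∏ x ∈ F, (1 - P x) := by
  unfold Ex
  have : ∀ W : Finset X, wt P W * (if Disjoint W F then (1:ℝ) else 0) =
      ∏ x, if x ∈ W then (if x ∈ F then 0 else P x) else 1 - P x := by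
    intro W
    by_cases h : Disjoint W F
    · rw [if_pos h, mul_one]
      unfold wt
      refine Finset.prod_congr rfl fun x _ => ?_
      by_cases hx : x ∈ W
      · have : x ∉ F := Finset.disjoint_left.1 h hx
        simp [hx, this]
      · simp [hx]
    · rw [if_neg h, mul_zero]
      rw [Finset.not_disjoint_iff] at h
      obtain ⟨x, hx, hx'⟩ := h
      refine (Finset.prod_eq_zero (mem_univ x) ?_).symm
      simp [hx, hx']
  simp only [this]
  rw [sum_prod_ite, ← Finset.prod_subset (Finset.subset_univ F)]
  · refine Finset.prod_congr rfl fun x hx => ?_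
    simp [hx]
  · intro x _ hx
    simp [hx]

variable {X Y : Type*} [Fintype X] [DecidableEq X] [Fintype Y] [DecidableEq Y]

noncomputable def clo (E : Y → Finset X) (G : Finset X) : Finset Y := univ.filter fun h => E h ⊆ G

def ev (E : Y → Finset X) (Tp Tm : Finset Y) (G : Finset X) : Prop :=
  (∀ h ∈ Tp, E h ⊆ G) ∧ ∀ h ∈ Tm, ¬ E h ⊆ G

noncomputable def ind (q : Prop) : ℝ := if q then 1 else 0

lemma ind_nonneg (q : Prop) : 0 ≤ ind q := by unfold ind; split_ifs <;> norm_num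
lemma ind_le_one (q : Prop) : ind q ≤ 1 := by unfold ind; split_ifs <;> norm_num
lemma ind_mono {q q' : Prop} (h : q → q') : ind q ≤ ind q' := by
  by_cases h1 : q
  · simp [ind, h1, h h1]
  · have := ind_nonneg q'
    simpa [ind, h1] using this

lemma coupling_aux (E : Y → Finset X) (P : X → ℝ) (h0 : ∀ x, 0 ≤ P x) (h1 : ∀ x, P x ≤ 1)
    (π : ℝ) (hπ0 : 0 ≤ π) (hπ1 : π ≤ 1) (ψ : Finset Y → Prop)
    (hψ : ∀ A B, A ⊆ B → ψ A → ψ B) (Bd : Finset Y → Y → Prop)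
    (hBd : ∀ A B, A ⊆ B → ∀ h, Bd A h → Bd B h)
    (valid : ∀ (Tp Tm H : Finset Y) (e : Y), Tp ⊆ H → e ∉ Tm → ¬ Bd (insert e H) e →
      π * Ex P (fun G => ind (ev E Tp Tm G)) ≤ Ex P (fun G => ind (ev E (insert e Tp) Tm G)))
    (rest : Finset Y) : ∀ (H Tp Tm : Finset Y), Tp ⊆ H → Disjoint rest Tm →
      (∀ h ∈ H, h ∉ Tp → Bd H h) →
      Ex P (fun G => ind (ev E Tp Tm G)) *
        Ex (fun y => if y ∈ rest then π else 0)
          (fun H' => ind (ψ ((H ∪ H').filter fun h => ¬ Bd (H ∪ H') h))) ≤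
      Ex P (fun G => ind (ev E Tp Tm G) * ind (ψ (clo E G))) := by
  induction rest using Finset.induction_on with
  | empty =>
    intro H Tp Tm hTp _ hinv
    have hz : (fun y : Y => if y ∈ (∅ : Finset Y) then π else 0) =
        (fun y : Y => if y ∈ (∅ : Finset Y) then (1:ℝ) else 0) := by funext y; simp
    rw [hz, Ex_zero_one, Finset.union_empty, mul_comm, ← Ex_mul]
    refine Ex_mono h0 h1 fun G => ?_
    by_cases hE : ev E Tp Tm G
    · have h2 : ind (ψ (H.filter fun h => ¬ Bd H h)) ≤ ind (ψ (clo E G)) := by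
        refine ind_mono (hψ _ _ ?_)
        intro h hh
        have hh' := Finset.mem_filter.1 hh
        refine Finset.mem_filter.2 ⟨mem_univ _, hE.1 h ?_⟩
        by_contra hc
        exact hh'.2 (hinv h hh'.1 hc)
      have h3 := ind_nonneg (ev E Tp Tm G)
      nlinarith
    · simp [ind, hE]
  | insert e rest' he ih =>
    intro H Tp Tm hTp hdis hinv
    have heTm : e ∉ Tm := Finset.disjoint_left.1 hdis (Finset.mem_insert_self _ _)
    have hdis' : Disjoint rest' Tm :=
      Finset.disjoint_of_subset_left (Finset.subset_insert _ _) hdis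
    set φ : Finset Y → ℝ := fun Z => ind (ψ (Z.filter fun h => ¬ Bd Z h)) with hφ
    set P' : Y → ℝ := fun y => if y ∈ rest' then π else 0 with hP'
    have hP'0 : ∀ y, 0 ≤ P' y := fun y => by simp only [P']; split_ifs <;> linarith
    have hP'1 : ∀ y, P' y ≤ 1 := fun y => by simp only [P']; split_ifs <;> linarith
    have hsplit : Ex (fun y => if y ∈ insert e rest' then π else 0) (fun H' => φ (H ∪ H')) =
        π * Ex P' (fun H' => φ (insert e H ∪ H')) + (1 - π) * Ex P' (fun H' => φ (H ∪ H')) := by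
      rw [Ex_split e π _ (force P' {e}) P' _ _ _ _ _ (fun H' => φ (H ∪ H'))]
      · rw [Ex_force]
        congr 3
        funext W
        congr 1
        ext y
        simp only [Finset.mem_union, Finset.mem_insert, Finset.mem_singleton]
        tauto
      · intro x hx
        simp [force, P', hx]
      · intro x hx
        simp [P', hx]
      · simp
      · simp [force]
      · simp [P', he]
    show Ex P (fun G => ind (ev E Tp Tm G)) *
        Ex (fun y => if y ∈ insert e rest' then π else 0) (fun H' => φ (H ∪ H')) ≤ _
    rw [hsplit]
    set F1 := Ex P' (fun H' => φ (insert e H ∪ H')) with hF1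
    set F0 := Ex P' (fun H' => φ (H ∪ H')) with hF0
    set c := Ex P (fun G => ind (ev E Tp Tm G)) with hc
    have hc0 : 0 ≤ c := Ex_nonneg h0 h1 fun _ => ind_nonneg _
    have ih0 : c * F0 ≤ _ := ih H Tp Tm hTp hdis' hinv
    by_cases hF : F1 < F0
    · have : c * (π * F1 + (1 - π) * F0) ≤ c * F0 := by
        refine mul_le_mul_of_nonneg_left ?_ hc0
        nlinarith
      exact this.trans ih0
    push Not at hF
    by_cases hb : Bd (insert e H) e
    · have ih1 : c * F1 ≤ _ := ih (insert e H) Tp Tm (hTp.trans (Finset.subset_insert _ _)) hdis' (by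
        intro h hh hhT
        rcases Finset.mem_insert.1 hh with rfl | hh
        · exact hb
        · exact hBd _ _ (Finset.subset_insert _ _) h (hinv h hh hhT))
      have : c * (π * F1 + (1 - π) * F0) ≤ c * F1 := by
        refine mul_le_mul_of_nonneg_left ?_ hc0
        nlinarith
      exact this.trans ih1
    · have hv := valid Tp Tm H e hTp heTm hb
      set a := Ex P (fun G => ind (ev E (insert e Tp) Tm G)) with ha
      have ih1 : a * F1 ≤ _ := ih (insert e H) (insert e Tp) Tm
        (Finset.insert_subset_insert _ hTp) hdis' (by
        intro h hh hhT
        rcases Finset.mem_insert.1 hh with rfl | hh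
        · exact absurd (Finset.mem_insert_self _ _) hhT
        · exact hBd _ _ (Finset.subset_insert _ _) h
            (hinv h hh fun h' => hhT (Finset.mem_insert_of_mem h')))
      have ih2 := ih H Tp (insert e Tm) hTp (by
        rw [Finset.disjoint_insert_right]; exact ⟨he, hdis'⟩) hinv
      have hsum : ∀ g : Finset X → ℝ, Ex P (fun G => ind (ev E Tp Tm G) * g G) =
          Ex P (fun G => ind (ev E (insert e Tp) Tm G) * g G) +
          Ex P (fun G => ind (ev E Tp (insert e Tm) G) * g G) := by
        intro g
        rw [← Ex_add]
        congr 1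
        funext G
        have : ind (ev E Tp Tm G) = ind (ev E (insert e Tp) Tm G) + ind (ev E Tp (insert e Tm) G) := by
          unfold ind ev
          simp only [Finset.forall_mem_insert]
          by_cases hA : E e ⊆ G <;> simp [hA]
        rw [this]; ring
      have hsum1 := hsum (fun _ => 1)
      simp only [mul_one] at hsum1
      rw [hsum (fun G => ind (ψ (clo E G)))]
      have hE2 : Ex P (fun G => ind (ev E Tp (insert e Tm) G)) = c - a := by linarith
      rw [hE2] at ih2
      have : c * (π * F1 + (1 - π) * F0) ≤ a * F1 + (c - a) * F0 := by nlinarith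
      exact this.trans (add_le_add ih1 ih2)

lemma coupling (E : Y → Finset X) (P : X → ℝ) (h0 : ∀ x, 0 ≤ P x) (h1 : ∀ x, P x ≤ 1)
    (π : ℝ) (hπ0 : 0 ≤ π) (hπ1 : π ≤ 1) (ψ : Finset Y → Prop)
    (hψ : ∀ A B, A ⊆ B → ψ A → ψ B) (Bd : Finset Y → Y → Prop)
    (hBd : ∀ A B, A ⊆ B → ∀ h, Bd A h → Bd B h)
    (valid : ∀ (Tp Tm H : Finset Y) (e : Y), Tp ⊆ H → e ∉ Tm → ¬ Bd (insert e H) e →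
      π * Ex P (fun G => ind (ev E Tp Tm G)) ≤ Ex P (fun G => ind (ev E (insert e Tp) Tm G))) :
    Ex (fun _ => π) (fun H => ind (ψ (H.filter fun h => ¬ Bd H h))) ≤
      Ex P (fun G => ind (ψ (clo E G))) := by
  have h := coupling_aux E P h0 h1 π hπ0 hπ1 ψ hψ Bd hBd valid univ ∅ ∅ ∅ (by simp) (by simp) (by simp)
  have h2 : ∀ G : Finset X, ind (ev E (∅ : Finset Y) ∅ G) = 1 := by
    intro G; simp [ind, ev]
  simp only [h2, Ex_const, one_mul, mem_univ, if_true, Finset.empty_union] at h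
  exact h

/-- the validity criterion -/
lemma valid_crit (E : Y → Finset X) {p : ℝ} (hp0 : 0 < p) (hp1 : p ≤ 1) (b : ℕ)
    (hb : ∀ h, (E h).card ≤ b) (Tp Tm : Finset Y) (e : Y)
    (hQ : ∑ f ∈ Tm.filter (fun f => ¬ Disjoint (E f) (E e \ Tp.biUnion E)),
      p ^ (E f \ (Tp.biUnion E ∪ E e)).card ≤ 1 / 2) :
    p ^ b / 2 * Ex (fun _ => p) (fun G => ind (ev E Tp Tm G)) ≤
      Ex (fun _ => p) (fun G => ind (ev E (insert e Tp) Tm G)) := by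
  set R := Tp.biUnion E with hR
  set Z := E e \ R with hZ
  have h0 : ∀ x : X, 0 ≤ (fun _ : X => p) x := fun _ => hp0.le
  have h1 : ∀ x : X, (fun _ : X => p) x ≤ 1 := fun _ => hp1
  -- decreasing events
  let D : Finset Y → Finset X → Prop := fun S G => ∀ h ∈ S, ¬ E h ⊆ G
  have hDanti : ∀ S G G', G ⊆ G' → D S G' → D S G := fun S G G' hG h f hf hfG =>
    h f hf (hfG.trans hG)
  set T1 := Tm.filter (fun f => Disjoint (E f) Z) with hT1
  set T2 := Tm.filter (fun f => ¬ Disjoint (E f) Z) with hT2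
  have hsubs : ∀ (F : Finset X) (S : Finset Y), Ex (fun _ : X => p) (fun G => ind (F ⊆ G ∧ D S G)) =
      p ^ F.card * Ex (fun _ : X => p) (fun G => ind (D S (G ∪ F))) := by
    intro F S
    have := Ex_subset (fun _ : X => p) F (fun G => ind (D S G))
    rw [Ex_force, Finset.prod_const] at this
    rw [← this]
    congr 1
    funext G
    by_cases hF : F ⊆ G <;> simp [ind, hF]
  have hE1 : Ex (fun _ : X => p) (fun G => ind (ev E Tp Tm G)) =
      p ^ R.card * Ex (fun _ : X => p) (fun G => ind (D Tm (G ∪ R))) := by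
    rw [← hsubs]
    congr 1
    funext G
    have : ev E Tp Tm G ↔ (R ⊆ G ∧ D Tm G) := by
      unfold ev
      rw [hR, Finset.biUnion_subset]
    rw [this]
  have hE2 : Ex (fun _ : X => p) (fun G => ind (ev E (insert e Tp) Tm G)) =
      p ^ (R ∪ Z).card * Ex (fun _ : X => p) (fun G => ind (D Tm (G ∪ (R ∪ Z)))) := by
    rw [← hsubs]
    congr 1
    funext G
    have : ev E (insert e Tp) Tm G ↔ (R ∪ Z ⊆ G ∧ D Tm G) := by
      unfold ev
      rw [hZ, Finset.union_sdiff_self_eq_union, Finset.union_subset_iff, hR, Finset.biUnion_subset,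
        Finset.forall_mem_insert]
      tauto
    rw [this]
  set q1 := Ex (fun _ : X => p) (fun G => ind (D T1 (G ∪ R))) with hq1
  have hq10 : 0 ≤ q1 := Ex_nonneg h0 h1 fun _ => ind_nonneg _
  have hD1 : ∀ G, D T1 (G ∪ (R ∪ Z)) ↔ D T1 (G ∪ R) := by
    intro G
    refine ⟨hDanti _ _ _ (Finset.union_subset_union_right Finset.subset_union_left), ?_⟩
    intro h f hf hfG
    refine h f hf fun x hx => ?_
    have hx1 := hfG hx
    have hx2 : x ∉ Z := Finset.disjoint_left.1 (Finset.mem_filter.1 hf).2 hx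
    simp only [Finset.mem_union] at hx1 ⊢
    tauto
  have hlow : ∀ G, ind (D T1 (G ∪ R)) - ∑ f ∈ T2, ind (E f \ (R ∪ E e) ⊆ G ∧ D T1 (G ∪ R)) ≤
      ind (D Tm (G ∪ (R ∪ Z))) := by
    intro G
    by_cases h : D T1 (G ∪ R)
    · by_cases h2 : D Tm (G ∪ (R ∪ Z))
      · have h3 : 0 ≤ ∑ f ∈ T2, ind (E f \ (R ∪ E e) ⊆ G ∧ D T1 (G ∪ R)) :=
          Finset.sum_nonneg fun f _ => ind_nonneg _
        have h4 : ind (D Tm (G ∪ (R ∪ Z))) = 1 := by simp [ind, h2]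
        have := ind_le_one (D T1 (G ∪ R))
        linarith
      · have h3 : ∃ f ∈ T2, E f \ (R ∪ E e) ⊆ G := by
          simp only [D] at h2
          push Not at h2
          obtain ⟨f, hf, hfG⟩ := h2
          refine ⟨f, ?_, ?_⟩
          · refine Finset.mem_filter.2 ⟨hf, fun hd => ?_⟩
            exact ((hD1 G).2 h) f (Finset.mem_filter.2 ⟨hf, hd⟩) hfG
          · intro x hx
            have hx1 := Finset.mem_sdiff.1 hx
            have hx2 := hfG hx1.1
            simp only [hZ, Finset.mem_union, Finset.mem_sdiff] at hx1 hx2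
            tauto
        obtain ⟨f, hf, hfG⟩ := h3
        have h4 : ind (E f \ (R ∪ E e) ⊆ G ∧ D T1 (G ∪ R)) ≤
            ∑ f ∈ T2, ind (E f \ (R ∪ E e) ⊆ G ∧ D T1 (G ∪ R)) :=
          Finset.single_le_sum (f := fun f => ind (E f \ (R ∪ E e) ⊆ G ∧ D T1 (G ∪ R)))
            (fun f _ => ind_nonneg _) hf
        have h5 : ind (E f \ (R ∪ E e) ⊆ G ∧ D T1 (G ∪ R)) = 1 := by simp [ind, hfG, h]
        have h6 := ind_le_one (D T1 (G ∪ R))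
        have h7 := ind_nonneg (D Tm (G ∪ (R ∪ Z)))
        linarith
    · have h3 : 0 ≤ ∑ f ∈ T2, ind (E f \ (R ∪ E e) ⊆ G ∧ D T1 (G ∪ R)) :=
        Finset.sum_nonneg fun f _ => ind_nonneg _
      have h4 : ind (D T1 (G ∪ R)) = 0 := by simp [ind, h]
      have h7 := ind_nonneg (D Tm (G ∪ (R ∪ Z)))
      linarith
  have hterm : ∀ f ∈ T2, Ex (fun _ : X => p) (fun G => ind (E f \ (R ∪ E e) ⊆ G ∧ D T1 (G ∪ R))) ≤
      p ^ (E f \ (R ∪ E e)).card * q1 := by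
    intro f _
    have := Ex_subset (fun _ : X => p) (E f \ (R ∪ E e)) (fun G => ind (D T1 (G ∪ R)))
    rw [Ex_force, Finset.prod_const] at this
    have h2 : (fun G => ind (E f \ (R ∪ E e) ⊆ G ∧ D T1 (G ∪ R))) =
        (fun W => if E f \ (R ∪ E e) ⊆ W then (ind (D T1 (W ∪ R))) else 0) := by
      funext G
      by_cases hF : E f \ (R ∪ E e) ⊆ G <;> simp [ind, hF]
    rw [h2, this]
    refine mul_le_mul_of_nonneg_left ?_ (by positivity)
    refine Ex_mono h0 h1 fun G => ind_mono (hDanti _ _ _ ?_)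
    exact Finset.union_subset_union_left Finset.subset_union_left
  have hmain : q1 * (1 / 2) ≤ Ex (fun _ : X => p) (fun G => ind (D Tm (G ∪ (R ∪ Z)))) := by
    have h2 := Ex_mono h0 h1 hlow
    rw [Ex_sub, Ex_sum] at h2
    refine le_trans ?_ h2
    have h3 := Finset.sum_le_sum hterm
    rw [← Finset.sum_mul] at h3
    have h4 := mul_le_mul_of_nonneg_right hQ hq10
    linarith
  have hq1' : Ex (fun _ : X => p) (fun G => ind (D Tm (G ∪ R))) ≤ q1 :=
    Ex_mono h0 h1 fun G => ind_mono fun h f hf => h f (Finset.mem_filter.1 hf).1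
  rw [hE1, hE2, Finset.card_union_of_disjoint Finset.disjoint_sdiff, pow_add]
  have hZb : p ^ b ≤ p ^ Z.card :=
    pow_le_pow_of_le_one hp0.le hp1 ((Finset.card_le_card Finset.sdiff_subset).trans (hb e))
  have hRp : 0 < p ^ R.card := by positivity
  have hbp : 0 < p ^ b := by positivity
  calc p ^ b / 2 * (p ^ R.card * Ex (fun _ : X => p) (fun G => ind (D Tm (G ∪ R))))
      ≤ p ^ b / 2 * (p ^ R.card * q1) := by gcongr
    _ = p ^ R.card * p ^ b * (q1 * (1 / 2)) := by ring
    _ ≤ p ^ R.card * p ^ Z.card * (q1 * (1 / 2)) := by gcongr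
    _ ≤ _ := by gcongr

end coupling

section badness
variable {m s n : ℕ}

lemma pat_gain {p Y : ℝ} (hn : 0 < n) (hs : 0 < s) (hp : 0 < p) (hY : 0 < Y)
    (hp2 : (p⁻¹) ^ s ≤ (n:ℝ) ^ 2) (hYn : Y ^ s ≤ n)
    (D : Finset (Pr2 s)) (hD : D.Nonempty) (hf : D ≠ univ) :
    (p⁻¹) ^ D.card * ((n:ℝ) ^ rk D)⁻¹ ≤ Y⁻¹ := by
  have hnR : (0:ℝ) < n := by exact_mod_cast hn
  have hn1 : (1:ℝ) ≤ n := by exact_mod_cast hn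
  have hg := rk_gain D hD hf
  refine le_of_pow_le_pow_left₀ hs.ne' (by positivity) ?_
  have e0 : ((p⁻¹) ^ D.card * ((n:ℝ) ^ rk D)⁻¹) ^ s =
      ((p⁻¹) ^ s) ^ D.card * ((n:ℝ) ^ (s * rk D))⁻¹ := by
    rw [mul_pow, ← pow_mul (p⁻¹), mul_comm D.card s, pow_mul (p⁻¹), inv_pow ((n:ℝ) ^ rk D),
      ← pow_mul (n:ℝ), mul_comm (rk D) s]
  rw [e0, inv_pow Y]
  have e1 : ((p⁻¹) ^ s) ^ D.card ≤ (n:ℝ) ^ (2 * D.card) := by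
    rw [pow_mul]; exact pow_le_pow_left₀ (by positivity) hp2 _
  have e2 : (n:ℝ) ^ (2 * D.card) * n ≤ (n:ℝ) ^ (s * rk D) := by
    rw [← pow_succ]; exact pow_le_pow_right₀ hn1 hg
  rw [← div_eq_mul_inv, div_le_iff₀ (by positivity), ← div_eq_inv_mul, le_div_iff₀ (by positivity)]
  calc _ ≤ (n:ℝ) ^ (2 * D.card) * n := mul_le_mul e1 hYn (by positivity) (by positivity)
    _ ≤ _ := e2

noncomputable def dgS (H : Finset (Hyp m s n)) (i : Fin m) (z : Fin s × Fin n) : Finset (Hyp m s n) :=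
  H.filter fun g => g.1 = i ∧ g.2 z.1 = z.2

def exc (Dg : ℕ) (H : Finset (Hyp m s n)) : Prop := ∃ i z, Dg < (dgS H i z).card

def loc (H : Finset (Hyp m s n)) (h : Hyp m s n) : Prop :=
  ∃ g1 ∈ H, ∃ g2 ∈ H, g1.1 = h.1 ∧ g2.1 = h.1 ∧ ∃ x y w, x ≠ y ∧ g1.2 x = h.2 x ∧ g2.2 y = h.2 y ∧
    g1.2 w = g2.2 w ∧ g1.2 w ≠ h.2 w

def Bd (Dg : ℕ) (H : Finset (Hyp m s n)) (h : Hyp m s n) : Prop := exc Dg H ∨ loc H h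

lemma Bd_mono (Dg : ℕ) (A B : Finset (Hyp m s n)) (hAB : A ⊆ B) (h : Hyp m s n) (hb : Bd Dg A h) :
    Bd Dg B h := by
  rcases hb with ⟨i, z, hz⟩ | ⟨g1, h1, g2, h2, hh⟩
  · exact Or.inl ⟨i, z, lt_of_lt_of_le hz (Finset.card_le_card (Finset.filter_subset_filter _ hAB))⟩
  · exact Or.inr ⟨g1, hAB h1, g2, hAB h2, hh⟩

noncomputable def nb (H : Finset (Hyp m s n)) (i : Fin m) (z : Fin s × Fin n) : Finset (Fin s × Fin n) :=
  insert z ((dgS H i z ×ˢ (univ : Finset (Fin s))).image fun gj => (gj.2, gj.1.2 gj.2))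

noncomputable def ball (H : Finset (Hyp m s n)) (i : Fin m) : ℕ → Fin s × Fin n → Finset (Fin s × Fin n)
  | 0, z => {z}
  | k + 1, z => (nb H i z).biUnion (ball H i k)

lemma card_nb {Dg : ℕ} {H : Finset (Hyp m s n)} (hH : ¬ exc Dg H) (i : Fin m) (z : Fin s × Fin n) :
    (nb H i z).card ≤ 1 + s * Dg := by
  unfold nb
  refine (Finset.card_insert_le _ _).trans ?_
  have h1 : ((dgS H i z ×ˢ (univ : Finset (Fin s))).image
      fun gj => (gj.2, gj.1.2 gj.2)).card ≤ Dg * s := by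
    refine Finset.card_image_le.trans ?_
    rw [Finset.card_product, Finset.card_univ, Fintype.card_fin]
    refine Nat.mul_le_mul_right _ ?_
    by_contra hc
    exact hH ⟨i, z, not_le.1 hc⟩
  rw [mul_comm s]; omega

lemma card_ball {Dg : ℕ} {H : Finset (Hyp m s n)} (hH : ¬ exc Dg H) (i : Fin m) (k : ℕ) :
    ∀ z : Fin s × Fin n, (ball H i k z).card ≤ (1 + s * Dg) ^ k := by
  induction k with
  | zero => intro z; simp [ball]
  | succ k ih =>
    intro z
    unfold ball
    rw [pow_succ, mul_comm]
    refine (Finset.card_biUnion_le_card_mul _ _ _ fun w _ => ih w).trans ?_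
    exact Nat.mul_le_mul_right _ (card_nb hH i z)

lemma ball_succ (H : Finset (Hyp m s n)) (i : Fin m) (k : ℕ) (z : Fin s × Fin n) :
    ball H i k z ⊆ ball H i (k + 1) z := by
  intro w hw
  exact Finset.mem_biUnion.2 ⟨z, Finset.mem_insert_self _ _, hw⟩

lemma ball_mono (H : Finset (Hyp m s n)) (i : Fin m) {k l : ℕ} (hkl : k ≤ l) (z : Fin s × Fin n) :
    ball H i k z ⊆ ball H i l z := by
  induction l, hkl using Nat.le_induction with
  | base => exact le_rfl
  | succ l _ ih => exact ih.trans (ball_succ H i l z)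

/-- maps compatible with the pattern -/
def Compat (H : Finset (Hyp m s n)) (i : Fin m) (D : Finset (Pr2 s)) (f : Fin s → Fin n) : Prop :=
  ∀ d ∈ D, ∃ g ∈ H, g.1 = i ∧ g.2 d.1.1 = f d.1.1 ∧ g.2 d.1.2 = f d.1.2

lemma walk_ball {H : Finset (Hyp m s n)} {i : Fin m} {D : Finset (Pr2 s)} {f : Fin s → Fin n}
    (hf : Compat H i D f) {a b : Fin s} (w : (gD D).Walk a b) :
    (b, f b) ∈ ball H i w.length (a, f a) := by
  induction w with
  | nil => simp [ball]
  | @cons a c b hadj w ih =>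
    rw [SimpleGraph.Walk.length_cons]
    refine Finset.mem_biUnion.2 ⟨(c, f c), ?_, ih⟩
    refine Finset.mem_insert_of_mem ?_
    unfold gD at hadj
    rw [SimpleGraph.fromRel_adj] at hadj
    have : ∃ g ∈ H, g.1 = i ∧ g.2 a = f a ∧ g.2 c = f c := by
      rcases hadj.2 with ⟨d, hd, he⟩ | ⟨d, hd, he⟩
      · have := hf d hd; rw [he] at this; exact this
      · obtain ⟨g, hg, h1, h2, h3⟩ := hf d hd
        rw [he] at h2 h3; exact ⟨g, hg, h1, h3, h2⟩
    obtain ⟨g, hg, h1, h2, h3⟩ := this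
    refine Finset.mem_image.2 ⟨(g, c), ?_, ?_⟩
    · exact Finset.mem_product.2 ⟨Finset.mem_filter.2 ⟨hg, h1, h2⟩, mem_univ _⟩
    · simp [h3]

lemma reach_ball {H : Finset (Hyp m s n)} {i : Fin m} {D : Finset (Pr2 s)} {f : Fin s → Fin n}
    (hf : Compat H i D f) {a b : Fin s} (h : (gD D).Reachable a b) :
    (b, f b) ∈ ball H i s (a, f a) := by
  obtain ⟨w, hw⟩ := h.exists_isPath
  refine ball_mono H i ?_ _ (walk_ball hf w)
  have := hw.length_lt
  rw [Fintype.card_fin] at this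
  exact this.le

lemma count_pat {Dg : ℕ} {H : Finset (Hyp m s n)} (hH : ¬ exc Dg H) (hn : 0 < n) (i : Fin m)
    (D : Finset (Pr2 s)) (a : Fin s) (v : Fin n) (A : Finset (Fin s → Fin n))
    (hA : ∀ f ∈ A, f a = v ∧ Compat H i D f) :
    A.card * n ^ (rk D + 1) ≤ n ^ s * ((1 + s * Dg) ^ s) ^ s := by
  set B := (1 + s * Dg) ^ s with hB
  let Fr := {x : Fin s // x ∉ NM D ∧ ¬ (gD D).Reachable a x}
  have hFr : Fintype.card Fr + (rk D + 1) ≤ s := by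
    obtain ⟨a', ha', hr⟩ := exists_minrep D a
    have h1 : Fintype.card Fr = (univ.filter fun x => x ∉ NM D ∧ ¬ (gD D).Reachable a x).card :=
      Fintype.card_subtype _
    have h2 : (univ.filter fun x => x ∉ NM D ∧ ¬ (gD D).Reachable a x) ⊆ ((NM D)ᶜ).erase a' := by
      intro x hx
      have hx' := (Finset.mem_filter.1 hx).2
      refine Finset.mem_erase.2 ⟨?_, Finset.mem_compl.2 hx'.1⟩
      rintro rfl
      exact hx'.2 hr.symm
    have h3 := Finset.card_le_card h2
    rw [Finset.card_erase_of_mem (Finset.mem_compl.2 ha'), Finset.card_compl, Fintype.card_fin] at h3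
    have h4 : rk D = (NM D).card := rfl
    have h5 : (NM D).card < s := by
      rw [← h4]; have := rk_lt (lt_of_le_of_lt (Nat.zero_le _) a.2) D; omega
    rw [h1]; omega
  let r : (Fin s → Fin n) → (Fr → Fin n) := fun f x => f x.1
  have hfib : ∀ g ∈ A.image r, (A.filter fun f => r f = g).card ≤ B ^ s := by
    intro g hg
    obtain ⟨f0, hf0, rfl⟩ := Finset.mem_image.1 hg
    let anc : Fin s → Fin s := fun j => if (gD D).Reachable a j then a else (exists_minrep D j).choose
    have hanc : ∀ j, (gD D).Reachable (anc j) j := by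
      intro j
      simp only [anc]
      split_ifs with h
      · exact h
      · exact (exists_minrep D j).choose_spec.2
    have hval : ∀ f ∈ A, r f = r f0 → ∀ j, f (anc j) = f0 (anc j) := by
      intro f hf hr j
      by_cases h : (gD D).Reachable a j
      · simp only [anc, if_pos h]
        rw [(hA f hf).1, (hA f0 hf0).1]
      · have hsp := (exists_minrep D j).choose_spec
        have := congrFun hr ⟨(exists_minrep D j).choose, hsp.1, fun h' => h (h'.trans hsp.2)⟩
        simp only [anc, if_neg h]
        exact this
    have hsub : (A.filter fun f => r f = r f0) ⊆
        Fintype.piFinset fun j => (ball H i s (anc j, f0 (anc j))).image Prod.snd := by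
      intro f hf
      have hf' := Finset.mem_filter.1 hf
      rw [Fintype.mem_piFinset]
      intro j
      refine Finset.mem_image.2 ⟨(j, f j), ?_, rfl⟩
      rw [← hval f hf'.1 hf'.2 j]
      exact reach_ball (hA f hf'.1).2 (hanc j)
    refine (Finset.card_le_card hsub).trans ?_
    rw [Fintype.card_piFinset]
    calc _ ≤ ∏ _j : Fin s, B := Finset.prod_le_prod' fun j _ =>
          Finset.card_image_le.trans (card_ball hH i s _)
      _ = B ^ s := by simp
  have h1 := Finset.card_le_mul_card_image A (B ^ s) hfib
  have h2 : (A.image r).card ≤ n ^ Fintype.card Fr := by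
    refine (Finset.card_le_univ _).trans ?_
    rw [Fintype.card_fun, Fintype.card_fin]
  calc A.card * n ^ (rk D + 1) ≤ (B ^ s * n ^ Fintype.card Fr) * n ^ (rk D + 1) :=
        Nat.mul_le_mul_right _ (h1.trans (Nat.mul_le_mul_left _ h2))
    _ = B ^ s * n ^ (Fintype.card Fr + (rk D + 1)) := by rw [pow_add]; ring
    _ ≤ B ^ s * n ^ s := Nat.mul_le_mul_left _ (Nat.pow_le_pow_right hn hFr)
    _ = _ := by ring

end badness

section validity
variable {m s n : ℕ}

noncomputable def patR (R : Finset (Edg m s n)) (f : Hyp m s n) : Finset (Pr2 s) :=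
  univ.filter fun d => eh f d ∈ R

lemma card_sdiff_patR (R : Finset (Edg m s n)) (f : Hyp m s n) :
    (EH f \ R).card + (patR R f).card = Fintype.card (Pr2 s) := by
  have h1 : EH f \ R = (univ.filter fun d => ¬ eh f d ∈ R).image (eh f) := by
    ext x
    simp only [EH, Finset.mem_sdiff, Finset.mem_image, mem_univ, true_and, Finset.mem_filter]
    constructor
    · rintro ⟨⟨d, rfl⟩, hd⟩; exact ⟨d, hd, rfl⟩
    · rintro ⟨d, hd, rfl⟩; exact ⟨⟨d, rfl⟩, hd⟩
  rw [h1, Finset.card_image_of_injective _ (eh_inj f), add_comm]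
  unfold patR
  rw [Finset.card_filter_add_card_filter_not, Finset.card_univ]

lemma eh_mem_EH {f g : Hyp m s n} {d : Pr2 s} (h : eh f d ∈ EH g) :
    g.1 = f.1 ∧ g.2 d.1.1 = f.2 d.1.1 ∧ g.2 d.1.2 = f.2 d.1.2 := by
  have hE := (mem_EH.1 h).1
  exact ⟨(Prod.mk.inj hE).1, (Prod.mk.inj (Prod.mk.inj (Prod.mk.inj hE).2).2).1,
    (Prod.mk.inj (Prod.mk.inj (Prod.mk.inj hE).2).2).2⟩

/-- from pattern membership to a hyperedge, for an unordered pair -/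
lemma pair_mem {H : Finset (Hyp m s n)} {f : Hyp m s n}
    (hall : ∀ d, eh f d ∈ H.biUnion EH) {x w : Fin s} (hxw : x ≠ w) :
    ∃ g ∈ H, g.1 = f.1 ∧ g.2 x = f.2 x ∧ g.2 w = f.2 w := by
  rcases lt_or_gt_of_ne hxw with h | h
  · obtain ⟨g, hg, hgd⟩ := Finset.mem_biUnion.1 (hall ⟨(x, w), h⟩)
    exact ⟨g, hg, eh_mem_EH hgd⟩
  · obtain ⟨g, hg, hgd⟩ := Finset.mem_biUnion.1 (hall ⟨(w, x), h⟩)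
    have := eh_mem_EH hgd
    exact ⟨g, hg, this.1, this.2.2, this.2.1⟩

lemma Q_bound {Dg : ℕ} {p Y : ℝ} (hn : 0 < n) (hs : 0 < s) (hp : 0 < p) (hY : 0 < Y)
    (hp2 : (p⁻¹) ^ s ≤ (n:ℝ) ^ 2) (hYn : Y ^ s ≤ n)
    (hsmall : 2 ^ Fintype.card (Pr2 s) * (Fintype.card (Pr2 s) : ℝ) *
      (p ^ Fintype.card (Pr2 s) * n ^ (s - 1)) * ((1 + s * Dg : ℝ) ^ s) ^ s ≤ Y / 2)
    (Tp Tm H : Finset (Hyp m s n)) (e : Hyp m s n) (hTp : Tp ⊆ H) (he : e ∉ Tm)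
    (hbad : ¬ Bd Dg (insert e H) e) :
    ∑ f ∈ Tm.filter (fun f => ¬ Disjoint (EH f) (EH e \ Tp.biUnion EH)),
      p ^ (EH f \ (Tp.biUnion EH ∪ EH e)).card ≤ 1 / 2 := by
  set b := Fintype.card (Pr2 s) with hb
  set R := Tp.biUnion EH ∪ EH e with hR
  set H' := insert e H with hH'
  have hexc : ¬ exc Dg H' := fun h => hbad (Or.inl h)
  have hnR : (0:ℝ) < n := by exact_mod_cast hn
  have hRH : R ⊆ H'.biUnion EH := by
    rw [hR]
    refine Finset.union_subset ?_ ?_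
    · exact Finset.biUnion_subset_biUnion_of_subset_left _ (hTp.trans (Finset.subset_insert _ _))
    · exact Finset.subset_biUnion_of_mem EH (Finset.mem_insert_self _ _)
  set S := Tm.filter (fun f => ¬ Disjoint (EH f) (EH e \ Tp.biUnion EH)) with hS
  -- the index set
  let J : Finset (Finset (Pr2 s) × Pr2 s) := univ.filter fun x => x.2 ∈ x.1 ∧ x.1 ≠ univ
  let C : Finset (Pr2 s) × Pr2 s → Finset (Hyp m s n) := fun x =>
    univ.filter fun f => f.1 = e.1 ∧ f.2 x.2.1.1 = e.2 x.2.1.1 ∧ Compat H' e.1 x.1 f.2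
  have hS' : ∀ f ∈ S, ∃ x ∈ J, x.1 = patR R f ∧ f ∈ C x := by
    intro f hf
    have hf' := Finset.mem_filter.1 hf
    obtain ⟨z, hz1, hz2⟩ := Finset.not_disjoint_iff.1 hf'.2
    have hfe : f ≠ e := fun h => he (h ▸ hf'.1)
    obtain ⟨d0, -, rfl⟩ := Finset.mem_image.1 hz1
    have hd0 := eh_mem_EH (Finset.mem_sdiff.1 hz2).1
    have hgrp : f.1 = e.1 := hd0.1.symm
    refine ⟨(patR R f, d0), ?_, rfl, ?_⟩
    · refine Finset.mem_filter.2 ⟨mem_univ _, ?_, ?_⟩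
      · exact Finset.mem_filter.2 ⟨mem_univ _, Finset.mem_union_right _ (Finset.mem_sdiff.1 hz2).1⟩
      · intro hu
        have hall : ∀ d, eh f d ∈ H'.biUnion EH := fun d => by
          have : d ∈ patR R f := by
            have h : patR R f = univ := hu
            rw [h]; exact mem_univ _
          exact hRH (Finset.mem_filter.1 this).2
        have hw : ∃ w, f.2 w ≠ e.2 w := by
          by_contra hc
          push Not at hc
          exact hfe (Prod.ext hgrp (funext hc))
        obtain ⟨w, hw⟩ := hw
        have hxw : d0.1.1 ≠ w := by rintro rfl; exact hw hd0.2.1.symm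
        have hyw : d0.1.2 ≠ w := by rintro rfl; exact hw hd0.2.2.symm
        obtain ⟨g1, hg1, a1, a2, a3⟩ := pair_mem hall hxw
        obtain ⟨g2, hg2, b1, b2, b3⟩ := pair_mem hall hyw
        refine hbad (Or.inr ⟨g1, hg1, g2, hg2, a1.trans hgrp, b1.trans hgrp, d0.1.1, d0.1.2, w,
          ne_of_lt d0.2, ?_, ?_, ?_, ?_⟩)
        · rw [a2, hd0.2.1]
        · rw [b2, hd0.2.2]
        · rw [a3, b3]
        · rw [a3]; exact hw
    · refine Finset.mem_filter.2 ⟨mem_univ _, hgrp, hd0.2.1.symm, ?_⟩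
      intro d hd
      obtain ⟨g, hg, hgd⟩ := Finset.mem_biUnion.1 (hRH (Finset.mem_filter.1 hd).2)
      have := eh_mem_EH hgd
      exact ⟨g, hg, this.1.trans hgrp, this.2.1, this.2.2⟩
  have hterm : ∀ f ∈ S, p ^ (EH f \ R).card ≤
      ∑ x ∈ J, if f ∈ C x then p ^ b * (p⁻¹) ^ x.1.card else 0 := by
    intro f hf
    obtain ⟨x, hxJ, hx1, hxC⟩ := hS' f hf
    have h1 : p ^ (EH f \ R).card = p ^ b * (p⁻¹) ^ x.1.card := by
      rw [hx1, hb, ← card_sdiff_patR R f, pow_add, mul_assoc, ← mul_pow, mul_inv_cancel₀ hp.ne',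
        one_pow, mul_one]
    have h2 := Finset.single_le_sum (f := fun x => if f ∈ C x then p ^ b * (p⁻¹) ^ x.1.card else 0)
      (fun x _ => by split_ifs <;> positivity) hxJ
    simp only [if_pos hxC] at h2
    rw [h1]; exact h2
  have hC : ∀ x ∈ J, ((C x).card : ℝ) * (p ^ b * (p⁻¹) ^ x.1.card) ≤
      (p ^ b * n ^ (s - 1)) * ((1 + s * Dg : ℝ) ^ s) ^ s * Y⁻¹ := by
    intro x hx
    have hx' := (Finset.mem_filter.1 hx).2
    have h1 := count_pat hexc hn e.1 x.1 x.2.1.1 (e.2 x.2.1.1) ((C x).image Prod.snd) (by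
      intro f hf
      obtain ⟨g, hg, rfl⟩ := Finset.mem_image.1 hf
      exact (Finset.mem_filter.1 hg).2.2)
    rw [Finset.card_image_of_injOn (by
      intro f hf g hg hfg
      have h1 := (Finset.mem_filter.1 hf).2.1
      have h2 := (Finset.mem_filter.1 hg).2.1
      exact Prod.ext (h1.trans h2.symm) hfg)] at h1
    have h2 : ((C x).card : ℝ) * (n:ℝ) ^ (rk x.1 + 1) ≤ (n:ℝ) ^ s * ((1 + s * Dg : ℝ) ^ s) ^ s := by
      exact_mod_cast h1
    have h3 := pat_gain hn hs hp hY hp2 hYn x.1 ⟨_, hx'.1⟩ hx'.2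
    have h4 : (n:ℝ) ^ s = n ^ (s - 1) * n := by
      rw [← pow_succ]; congr 1; omega
    have h5 : ((C x).card : ℝ) ≤ (n:ℝ) ^ (s - 1) * ((1 + s * Dg : ℝ) ^ s) ^ s * ((n:ℝ) ^ rk x.1)⁻¹ := by
      rw [← div_eq_mul_inv, le_div_iff₀ (by positivity)]
      rw [h4, pow_succ] at h2
      refine le_of_mul_le_mul_right ?_ hnR
      calc _ = ((C x).card : ℝ) * ((n:ℝ) ^ rk x.1 * n) := by ring
        _ ≤ _ := h2
        _ = _ := by ring
    calc ((C x).card : ℝ) * (p ^ b * (p⁻¹) ^ x.1.card)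
        ≤ ((n:ℝ) ^ (s - 1) * ((1 + s * Dg : ℝ) ^ s) ^ s * ((n:ℝ) ^ rk x.1)⁻¹) *
          (p ^ b * (p⁻¹) ^ x.1.card) := mul_le_mul_of_nonneg_right h5 (by positivity)
      _ = (p ^ b * n ^ (s - 1)) * ((1 + s * Dg : ℝ) ^ s) ^ s *
          ((p⁻¹) ^ x.1.card * ((n:ℝ) ^ rk x.1)⁻¹) := by ring
      _ ≤ _ := mul_le_mul_of_nonneg_left h3 (by positivity)
  have hJ : (J.card : ℝ) ≤ 2 ^ b * b := by
    have := Finset.card_le_univ J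
    rw [Fintype.card_prod, Fintype.card_finset] at this
    exact_mod_cast this
  calc _ ≤ ∑ f ∈ S, ∑ x ∈ J, (if f ∈ C x then p ^ b * (p⁻¹) ^ x.1.card else 0) :=
        Finset.sum_le_sum hterm
    _ = ∑ x ∈ J, ∑ f ∈ S, (if f ∈ C x then p ^ b * (p⁻¹) ^ x.1.card else 0) := Finset.sum_comm
    _ ≤ ∑ x ∈ J, ((C x).card : ℝ) * (p ^ b * (p⁻¹) ^ x.1.card) := by
        refine Finset.sum_le_sum fun x _ => ?_
        rw [← Finset.sum_filter, Finset.sum_const, nsmul_eq_mul]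
        refine mul_le_mul_of_nonneg_right ?_ (by positivity)
        have : S.filter (fun f => f ∈ C x) ⊆ C x := fun f hf => (Finset.mem_filter.1 hf).2
        exact_mod_cast Finset.card_le_card this
    _ ≤ ∑ x ∈ J, (p ^ b * n ^ (s - 1)) * ((1 + s * Dg : ℝ) ^ s) ^ s * Y⁻¹ := Finset.sum_le_sum hC
    _ = J.card * ((p ^ b * n ^ (s - 1)) * ((1 + s * Dg : ℝ) ^ s) ^ s * Y⁻¹) := by
        rw [Finset.sum_const, nsmul_eq_mul]
    _ ≤ (2 ^ b * b) * ((p ^ b * n ^ (s - 1)) * ((1 + s * Dg : ℝ) ^ s) ^ s * Y⁻¹) :=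
        mul_le_mul_of_nonneg_right hJ (by positivity)
    _ = (2 ^ b * (b : ℝ) * (p ^ b * n ^ (s - 1)) * ((1 + s * Dg : ℝ) ^ s) ^ s) * Y⁻¹ := by ring
    _ ≤ (Y / 2) * Y⁻¹ := mul_le_mul_of_nonneg_right hsmall (by positivity)
    _ = 1 / 2 := by field_simp

/-- the coupling for our hypergraph -/
lemma coupling_model {Dg : ℕ} {p Y : ℝ} (hn : 0 < n) (hs : 0 < s) (hp : 0 < p) (hp1 : p ≤ 1) (hY : 0 < Y)
    (hp2 : (p⁻¹) ^ s ≤ (n:ℝ) ^ 2) (hYn : Y ^ s ≤ n)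
    (hsmall : 2 ^ Fintype.card (Pr2 s) * (Fintype.card (Pr2 s) : ℝ) *
      (p ^ Fintype.card (Pr2 s) * n ^ (s - 1)) * ((1 + s * Dg : ℝ) ^ s) ^ s ≤ Y / 2)
    (ψ : Finset (Hyp m s n) → Prop) (hψ : ∀ A B, A ⊆ B → ψ A → ψ B) :
    Ex (fun _ => p ^ Fintype.card (Pr2 s) / 2)
      (fun H : Finset (Hyp m s n) => ind (ψ (H.filter fun h => ¬ Bd Dg H h))) ≤
      Ex (fun _ => p) (fun G => ind (ψ (clo EH G))) := by
  have hpb : p ^ Fintype.card (Pr2 s) ≤ 1 := pow_le_one₀ hp.le hp1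
  have hpb0 : 0 < p ^ Fintype.card (Pr2 s) := by positivity
  refine coupling EH (fun _ => p) (fun _ => hp.le) (fun _ => hp1) _ (by linarith) (by linarith) ψ hψ
    (Bd Dg) (Bd_mono Dg) ?_
  intro Tp Tm H e hTp he hbad
  exact valid_crit EH hp hp1 _ (fun h => (card_EH h).le) Tp Tm e
    (Q_bound hn hs hp hY hp2 hYn hsmall Tp Tm H e hTp he hbad)

end validity

section probs
variable {m s n : ℕ}

lemma card_fix (i : Fin m) (D : Finset (Fin s)) (a : Fin s → Fin n) (A : Finset (Hyp m s n))
    (hA : ∀ g ∈ A, g.1 = i ∧ ∀ y ∈ D, g.2 y = a y) : A.card ≤ n ^ (s - D.card) := by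
  let P : Finset (Fin s → Fin n) := Fintype.piFinset fun y => if y ∈ D then {a y} else univ
  have h1 : A ⊆ P.image fun f => (i, f) := by
    intro g hg
    obtain ⟨h1, h2⟩ := hA g hg
    refine Finset.mem_image.2 ⟨g.2, ?_, Prod.ext h1.symm rfl⟩
    rw [Fintype.mem_piFinset]
    intro y
    by_cases hy : y ∈ D
    · rw [if_pos hy]; exact Finset.mem_singleton.2 (h2 y hy)
    · rw [if_neg hy]; exact mem_univ _
  refine (Finset.card_le_card h1).trans (Finset.card_image_le.trans ?_)
  rw [Fintype.card_piFinset]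
  have : ∀ y, (if y ∈ D then ({a y} : Finset (Fin n)) else univ).card = if y ∈ D then 1 else n := by
    intro y; split_ifs <;> simp
  rw [Finset.prod_congr rfl fun y _ => this y, Finset.prod_ite]
  simp only [prod_const_one, one_mul, prod_const]
  have : (univ.filter fun y => y ∉ D) = Dᶜ := by ext; simp
  rw [this, Finset.card_compl, Fintype.card_fin]

lemma ex_ind_subset_card {X : Type*} [Fintype X] [DecidableEq X] (π : ℝ) (F : Finset X) :
    Ex (fun _ : X => π) (fun W => ind (F ⊆ W)) = π ^ F.card := by
  have := Ex_ind_subset (fun _ : X => π) F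
  rw [Finset.prod_const] at this
  rw [← this]
  congr 1
  funext W
  unfold ind
  congr

lemma prob_exc {π : ℝ} (h0 : 0 ≤ π) (h1 : π ≤ 1) (Dg : ℕ) :
    Ex (fun _ : Hyp m s n => π) (fun H => ind (exc Dg H)) ≤
      m * (s * n) * (Real.exp (π * n ^ (s - 1)) / 2 ^ Dg) := by
  have hb : ∀ H : Finset (Hyp m s n), ind (exc Dg H) ≤
      ∑ i : Fin m, ∑ z : Fin s × Fin n, (2 ^ Dg)⁻¹ * (2:ℝ) ^ (H ∩ dgS univ i z).card := by
    intro H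
    have hnn : ∀ i : Fin m, ∀ z : Fin s × Fin n,
        (0:ℝ) ≤ (2 ^ Dg)⁻¹ * (2:ℝ) ^ (H ∩ dgS univ i z).card := fun i z => by positivity
    by_cases he : exc Dg H
    · obtain ⟨i, z, hz⟩ := id he
      have e1 : dgS H i z = H ∩ dgS univ i z := by
        ext g; simp [dgS]
      refine le_trans ?_ (Finset.single_le_sum (f := fun i => ∑ z : Fin s × Fin n,
        (2 ^ Dg)⁻¹ * (2:ℝ) ^ (H ∩ dgS univ i z).card) (fun i _ => Finset.sum_nonneg fun z _ => hnn i z)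
        (mem_univ i))
      refine le_trans ?_ (Finset.single_le_sum (f := fun z =>
        (2 ^ Dg)⁻¹ * (2:ℝ) ^ (H ∩ dgS univ i z).card) (fun z _ => hnn i z) (mem_univ z))
      refine (ind_le_one _).trans ?_
      rw [← e1, inv_mul_eq_div, one_le_div (by positivity)]
      exact pow_le_pow_right₀ one_le_two hz.le
    · have : ind (exc Dg H) = 0 := if_neg he
      rw [this]
      exact Finset.sum_nonneg fun i _ => Finset.sum_nonneg fun z _ => hnn i z
  refine (Ex_mono (fun _ => h0) (fun _ => h1) hb).trans ?_
  rw [Ex_sum]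
  have hz : ∀ (i : Fin m) (z : Fin s × Fin n),
      Ex (fun _ : Hyp m s n => π) (fun H => (2 ^ Dg)⁻¹ * (2:ℝ) ^ (H ∩ dgS univ i z).card) ≤
        Real.exp (π * n ^ (s - 1)) / 2 ^ Dg := by
    intro i z
    rw [Ex_mul, Ex_two_pow, Finset.prod_const, inv_mul_eq_div]
    refine div_le_div_of_nonneg_right ?_ (by positivity)
    have hc : (dgS (univ : Finset (Hyp m s n)) i z).card ≤ n ^ (s - 1) := by
      have := card_fix i {z.1} (fun _ => z.2) (dgS (univ : Finset (Hyp m s n)) i z) (by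
        intro g hg
        have := (Finset.mem_filter.1 hg).2
        refine ⟨this.1, fun y hy => ?_⟩
        rw [Finset.mem_singleton.1 hy]; exact this.2)
      simpa using this
    calc (1 + π) ^ _ ≤ (1 + π) ^ (n ^ (s - 1)) := pow_le_pow_right₀ (by linarith) hc
      _ ≤ (Real.exp π) ^ (n ^ (s - 1)) := by
        refine pow_le_pow_left₀ (by linarith) ?_ _
        rw [add_comm]; exact Real.add_one_le_exp π
      _ = _ := by rw [← Real.exp_nat_mul]; push_cast; rw [mul_comm]
  calc _ ≤ ∑ i : Fin m, ∑ z : Fin s × Fin n, Real.exp (π * n ^ (s - 1)) / 2 ^ Dg := by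
        refine Finset.sum_le_sum fun i _ => ?_
        rw [Ex_sum]
        exact Finset.sum_le_sum fun z _ => hz i z
    _ = _ := by simp; ring

def c2 (t : Fin s × Fin s × Fin s) (h g : Hyp m s n) : Prop :=
    t.1 ≠ t.2.1 ∧ g ≠ h ∧ g.1 = h.1 ∧ g.2 t.1 = h.2 t.1 ∧ g.2 t.2.1 = h.2 t.2.1
def c3 (t : Fin s × Fin s × Fin s) (h g1 g2 : Hyp m s n) : Prop :=
    g1 ≠ h ∧ g2 ≠ h ∧ g1 ≠ g2 ∧ t.2.1 ≠ t.2.2 ∧ g1.1 = h.1 ∧ g2.1 = h.1 ∧ g1.2 t.1 = h.2 t.1 ∧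
      g2.2 t.2.1 = h.2 t.2.1 ∧ g2.2 t.2.2 = g1.2 t.2.2

lemma card_filter_ind {X : Type*} (A : Finset X) (P : X → Prop) :
    ((A.filter P).card : ℝ) = ∑ h ∈ A, ind (P h) := by
  rw [Finset.card_filter]
  push_cast
  refine Finset.sum_congr rfl fun h _ => ?_
  unfold ind
  congr

noncomputable def S2 (H : Finset (Hyp m s n)) (t : Fin s × Fin s × Fin s) (h : Hyp m s n) : ℝ :=
  ∑ g ∈ univ.filter (c2 t h), ind ({h, g} ⊆ H)
noncomputable def S3 (H : Finset (Hyp m s n)) (t : Fin s × Fin s × Fin s) (h : Hyp m s n) : ℝ :=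
  ∑ g1 ∈ univ.filter (fun g : Hyp m s n => g.1 = h.1 ∧ g.2 t.1 = h.2 t.1),
           ∑ g2 ∈ univ.filter (c3 t h g1), ind ({h, g1, g2} ⊆ H)

lemma S2_nonneg (H : Finset (Hyp m s n)) (t : Fin s × Fin s × Fin s) (h : Hyp m s n) :
    0 ≤ S2 H t h := Finset.sum_nonneg fun g _ => ind_nonneg _
lemma S3_nonneg (H : Finset (Hyp m s n)) (t : Fin s × Fin s × Fin s) (h : Hyp m s n) :
    0 ≤ S3 H t h := Finset.sum_nonneg fun g _ => Finset.sum_nonneg fun g _ => ind_nonneg _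

lemma S2_ge {H : Finset (Hyp m s n)} {t : Fin s × Fin s × Fin s} {h g : Hyp m s n} (hh : h ∈ H)
    (hg : g ∈ H) (hc : c2 t h g) : 1 ≤ S2 H t h := by
  unfold S2
  refine le_trans ?_ (Finset.single_le_sum (f := fun g => ind ({h, g} ⊆ H))
        (fun g _ => ind_nonneg _) (Finset.mem_filter.2 ⟨mem_univ g, hc⟩))
  refine (if_pos ?_ : ind _ = 1).ge
  intro z hz
  rcases Finset.mem_insert.1 hz with rfl | hz
  · exact hh
  · rw [Finset.mem_singleton.1 hz]; exact hg

lemma one_le_sum {Z : Type*} (A : Finset Z) (f : Z → ℝ) (hf : ∀ z, 0 ≤ f z) (a : Z) (ha : a ∈ A)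
    (h : 1 ≤ f a) : 1 ≤ ∑ z ∈ A, f z :=
  h.trans (Finset.single_le_sum (fun z _ => hf z) ha)

lemma triple_sub {Z : Type*} [DecidableEq Z] {H : Finset Z} {h g1 g2 : Z} (hh : h ∈ H)
    (hg1 : g1 ∈ H) (hg2 : g2 ∈ H) : ({h, g1, g2} : Finset Z) ⊆ H := by
  intro z hz
  rcases Finset.mem_insert.1 hz with e | hz
  · rw [e]; exact hh
  rcases Finset.mem_insert.1 hz with e | hz
  · rw [e]; exact hg1
  · rw [Finset.mem_singleton.1 hz]; exact hg2

lemma S3_ge {H : Finset (Hyp m s n)} {t : Fin s × Fin s × Fin s} {h g1 g2 : Hyp m s n} (hh : h ∈ H)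
    (hg1 : g1 ∈ H) (hg2 : g2 ∈ H) (hc : c3 t h g1 g2) : 1 ≤ S3 H t h := by
  unfold S3
  have hc' : g1.1 = h.1 ∧ g1.2 t.1 = h.2 t.1 := by
    unfold c3 at hc
    exact ⟨hc.2.2.2.2.1, hc.2.2.2.2.2.2.1⟩
  refine one_le_sum _ _ (fun g => Finset.sum_nonneg fun g _ => ind_nonneg _) g1 ?_ ?_
  · rw [Finset.mem_filter]
    exact ⟨mem_univ _, hc'⟩
  · refine one_le_sum _ _ (fun g => ind_nonneg _) g2 ?_ ?_
    · rw [Finset.mem_filter]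
      exact ⟨mem_univ _, hc⟩
    · rw [show ind _ = 1 from if_pos (triple_sub hh hg1 hg2)]

lemma loc_bound (H : Finset (Hyp m s n)) : ((H.filter fun h => loc H h).card : ℝ) ≤
      ∑ h : Hyp m s n, ∑ t : Fin s × Fin s × Fin s, (S2 H t h + S3 H t h) := by
  rw [card_filter_ind]
  have nn : ∀ t h, 0 ≤ S2 H t h + S3 H t h := fun t h => add_nonneg (S2_nonneg H t h) (S3_nonneg H t h)
  refine le_trans (Finset.sum_le_sum (g := fun h => ∑ t : Fin s × Fin s × Fin s,
        (S2 H t h + S3 H t h)) fun h hh => ?_)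
    (Finset.sum_le_sum_of_subset_of_nonneg (subset_univ H) fun h _ _ => Finset.sum_nonneg fun t _ => nn t h)
  by_cases hl : loc H h
  · obtain ⟨g1, hg1, g2, hg2, e1, e2, x, y, w, hxy, ex, ey, ew, ew'⟩ := id hl
    refine le_trans ?_ (Finset.single_le_sum (f := fun t => S2 H t h + S3 H t h)
      (fun t _ => nn t h) (mem_univ (x, y, w)))
    have hg1h : g1 ≠ h := fun e => ew' (by rw [e])
    have hg2h : g2 ≠ h := fun e => ew' (by rw [ew, e])
    have hyw : y ≠ w := by
      rintro rfl
      exact ew' (by rw [ew, ey])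
    refine (ind_le_one _).trans ?_
    have u2 := S2_nonneg H (x, y, w) h
    have u3 := S3_nonneg H (x, y, w) h
    by_cases hgg : g1 = g2
    · subst hgg
      have := S2_ge (t := (x, y, w)) hh hg1 ⟨hxy, hg1h, e1, ex, ey⟩
      linarith
    · have := S3_ge (t := (x, y, w)) hh hg1 hg2 ⟨hg1h, hg2h, hgg, hyw, e1, e2, ex, ey, ew.symm⟩
      linarith
  · have : ind (loc H h) = 0 := if_neg hl
    rw [this]
    exact Finset.sum_nonneg fun t _ => nn t h

/-- locally bad configurations -/
lemma exp_loc {π : ℝ} (h0 : 0 ≤ π) (h1 : π ≤ 1) :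
    Ex (fun _ : Hyp m s n => π) (fun H => ((H.filter fun h => loc H h).card : ℝ)) ≤
      m * s ^ 3 * (n ^ s * n ^ (s - 2) * π ^ 2 + n ^ s * n ^ (s - 1) * n ^ (s - 2) * π ^ 3) := by
  refine (Ex_mono (fun _ => h0) (fun _ => h1) loc_bound).trans ?_
  rw [Ex_sum]
  have hcount2 : ∀ (t : Fin s × Fin s × Fin s) (h : Hyp m s n), ((univ.filter (c2 t h)).card : ℝ) ≤ (n:ℝ) ^ (s - 2) := by
    intro t h
    by_cases ht : t.1 = t.2.1
    · have : univ.filter (c2 t h) = ∅ := Finset.filter_eq_empty_iff.2 fun g _ hg => hg.1 ht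
      rw [this]; simp
    · have := card_fix h.1 {t.1, t.2.1} h.2 (univ.filter (c2 t h)) (by
        intro g hg
        obtain ⟨_, _, e1, e2, e3⟩ := (Finset.mem_filter.1 hg).2
        refine ⟨e1, fun y hy => ?_⟩
        rcases Finset.mem_insert.1 hy with rfl | hy
        · exact e2
        · rw [Finset.mem_singleton.1 hy]; exact e3)
      rw [Finset.card_pair ht] at this
      exact_mod_cast this
  have hcount1 : ∀ (t : Fin s × Fin s × Fin s) (h : Hyp m s n),
      ((univ.filter (fun g : Hyp m s n => g.1 = h.1 ∧ g.2 t.1 = h.2 t.1)).card : ℝ) ≤ (n:ℝ) ^ (s - 1) := by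
    intro t h
    have := card_fix h.1 {t.1} h.2 (univ.filter (fun g : Hyp m s n => g.1 = h.1 ∧ g.2 t.1 = h.2 t.1)) (by
        intro g hg
        obtain ⟨e1, e2⟩ := (Finset.mem_filter.1 hg).2
        refine ⟨e1, fun y hy => ?_⟩
        rw [Finset.mem_singleton.1 hy]; exact e2)
    rw [Finset.card_singleton] at this
    exact_mod_cast this
  have hcount3 : ∀ (t : Fin s × Fin s × Fin s) (h g1 : Hyp m s n), ((univ.filter (c3 t h g1)).card : ℝ) ≤ (n:ℝ) ^ (s - 2) := by
    intro t h g1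
    by_cases ht : t.2.1 = t.2.2
    · have : univ.filter (c3 t h g1) = ∅ :=
        Finset.filter_eq_empty_iff.2 fun g _ hg => hg.2.2.2.1 ht
      rw [this]; simp
    · have := card_fix h.1 {t.2.1, t.2.2} (fun y => if y = t.2.1 then h.2 y else g1.2 y)
        (univ.filter (c3 t h g1)) (by
        intro g hg
        obtain ⟨_, _, _, _, _, e1, _, e2, e3⟩ := (Finset.mem_filter.1 hg).2
        refine ⟨e1, fun y hy => ?_⟩
        rcases Finset.mem_insert.1 hy with rfl | hy
        · simp only [if_true]; exact e2
        · rw [Finset.mem_singleton.1 hy, if_neg (Ne.symm ht)]; exact e3)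
      rw [Finset.card_pair ht] at this
      exact_mod_cast this
  have hn0 : ∀ k : ℕ, (0:ℝ) ≤ (n:ℝ) ^ k := fun k => by positivity
  have key : ∀ (h : Hyp m s n) (t : Fin s × Fin s × Fin s),
      Ex (fun _ : Hyp m s n => π) (fun H => S2 H t h + S3 H t h) ≤
      (n:ℝ) ^ (s - 2) * π ^ 2 + n ^ (s - 1) * (n ^ (s - 2) * π ^ 3) := by
    intro h t
    unfold S2 S3
    rw [Ex_add, Ex_sum, Ex_sum]
    refine add_le_add ?_ ?_
    · rw [Finset.sum_congr rfl (g := fun _ => π ^ 2)]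
      · rw [Finset.sum_const, nsmul_eq_mul]
        exact mul_le_mul_of_nonneg_right (hcount2 t h) (by positivity)
      · intro g hg
        have hg := (Finset.mem_filter.1 hg).2
        rw [ex_ind_subset_card, Finset.card_pair hg.2.1.symm]
    · calc _ ≤ ∑ g1 ∈ univ.filter (fun g : Hyp m s n => g.1 = h.1 ∧ g.2 t.1 = h.2 t.1),
            (n:ℝ) ^ (s - 2) * π ^ 3 := by
            refine Finset.sum_le_sum fun g1 _ => ?_
            rw [Ex_sum, Finset.sum_congr rfl (g := fun _ => π ^ 3)]
            · rw [Finset.sum_const, nsmul_eq_mul]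
              exact mul_le_mul_of_nonneg_right (hcount3 t h g1) (by positivity)
            · intro g hg
              have hg := (Finset.mem_filter.1 hg).2
              have : ({h, g1, g} : Finset (Hyp m s n)).card = 3 :=
                Finset.card_eq_three.2 ⟨h, g1, g, hg.1.symm, hg.2.1.symm, hg.2.2.1, rfl⟩
              rw [ex_ind_subset_card, this]
        _ ≤ _ := by
          rw [Finset.sum_const, nsmul_eq_mul]
          exact mul_le_mul_of_nonneg_right (hcount1 t h) (by positivity)
  calc _ ≤ ∑ h : Hyp m s n, ∑ t : Fin s × Fin s × Fin s,
        ((n:ℝ) ^ (s - 2) * π ^ 2 + n ^ (s - 1) * (n ^ (s - 2) * π ^ 3)) := by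
        refine Finset.sum_le_sum fun h _ => ?_
        rw [Ex_sum]
        exact Finset.sum_le_sum fun t _ => key h t
    _ = _ := by simp; ring

/-- keep trick -/
lemma keep_trick {X : Type*} [Fintype X] [DecidableEq X] {π : ℝ} (h0 : 0 ≤ π) (h1 : π ≤ 1) (b0 : ℕ)
    (L : Finset X → Finset X) (ψ : Finset X → Prop) (hψ : ∀ A B, A ⊆ B → ψ A → ψ B) :
    Ex (fun _ : X => π) (fun H => ind ((L H).card ≤ b0 ∧ ¬ ψ (H \ L H))) ≤
      2 ^ b0 * Ex (fun _ : X => π / 2) (fun H => ind (¬ ψ H)) := by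
  have e := Ex_inter (fun _ : X => π) (fun _ : X => 1 / 2) (fun H => ind (¬ ψ H))
  have e' : (fun _ : X => π * (1 / 2)) = fun _ : X => π / 2 := by funext; ring
  rw [← e', ← e, ← Ex_mul]
  refine Ex_mono (fun _ => h0) (fun _ => h1) fun H => ?_
  by_cases hH : (L H).card ≤ b0 ∧ ¬ ψ (H \ L H)
  · have h2 : ((1:ℝ) / 2) ^ b0 ≤ Ex (fun _ : X => 1 / 2) (fun W => ind (¬ ψ (H ∩ W))) := by
      have h3 := Ex_disjoint (fun _ : X => (1:ℝ) / 2) (L H)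
      rw [Finset.prod_const] at h3
      have h4 : ((1:ℝ) / 2) ^ b0 ≤ (1 - 1 / 2) ^ (L H).card := by
        norm_num only
        exact pow_le_pow_of_le_one (by norm_num) (by norm_num) hH.1
      refine h4.trans (h3.symm.le.trans ?_)
      refine Ex_mono (fun _ => by norm_num) (fun _ => by norm_num) fun W => ?_
      by_cases hd : Disjoint W (L H)
      · rw [if_pos hd]
        have : ¬ ψ (H ∩ W) := fun hc => hH.2 (hψ _ _ (fun z hz => by
          obtain ⟨z1, z2⟩ := Finset.mem_inter.1 hz
          exact Finset.mem_sdiff.2 ⟨z1, Finset.disjoint_left.1 hd z2⟩) hc)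
        exact (if_pos this : ind _ = 1).ge
      · rw [if_neg hd]; exact ind_nonneg _
    calc ind _ ≤ 1 := ind_le_one _
      _ = 2 ^ b0 * ((1:ℝ) / 2) ^ b0 := by rw [← mul_pow]; norm_num
      _ ≤ _ := mul_le_mul_of_nonneg_left h2 (by positivity)
  · rw [show ind _ = 0 from if_neg hH]
    exact mul_nonneg (by positivity) (Ex_nonneg (fun _ => by norm_num) (fun _ => by norm_num)
      fun _ => ind_nonneg _)

lemma markov {X : Type*} [Fintype X] [DecidableEq X] {P : X → ℝ} (h0 : ∀ x, 0 ≤ P x)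
    (h1 : ∀ x, P x ≤ 1) (f : Finset X → ℝ) (hf : ∀ W, 0 ≤ f W) {t : ℝ} (ht : 0 < t) :
    Ex P (fun W => ind (t ≤ f W)) ≤ Ex P f / t := by
  rw [div_eq_inv_mul, ← Ex_mul]
  refine Ex_mono h0 h1 fun W => ?_
  by_cases h : t ≤ f W
  · refine (ind_le_one _).trans ?_
    rw [inv_mul_eq_div, one_le_div ht]; exact h
  · rw [show ind _ = 0 from if_neg h]
    exact mul_nonneg (inv_nonneg.2 ht.le) (hf W)

/-- lower bound after deleting the bad hyperedges -/
lemma del_bound {π : ℝ} (h0 : 0 ≤ π) (h1 : π ≤ 1) (Dg b0 : ℕ) (ψ : Finset (Hyp m s n) → Prop)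
    (hψ : ∀ A B, A ⊆ B → ψ A → ψ B) :
    1 - m * (s * n) * (Real.exp (π * n ^ (s - 1)) / 2 ^ Dg)
      - m * s ^ 3 * (n ^ s * n ^ (s - 2) * π ^ 2 + n ^ s * n ^ (s - 1) * n ^ (s - 2) * π ^ 3) / (b0 + 1)
      - 2 ^ b0 * Ex (fun _ : Hyp m s n => π / 2) (fun H => ind (¬ ψ H)) ≤
    Ex (fun _ : Hyp m s n => π) (fun H => ind (ψ (H.filter fun h => ¬ Bd Dg H h))) := by
  have a1 := prob_exc (m := m) (s := s) (n := n) h0 h1 Dg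
  have a2 := markov (fun _ => h0) (fun _ => h1)
    (fun H : Finset (Hyp m s n) => ((H.filter fun h => loc H h).card : ℝ)) (fun _ => by positivity)
    (t := b0 + 1) (by positivity)
  have a2' := a2.trans (div_le_div_of_nonneg_right (exp_loc (m := m) (s := s) (n := n) h0 h1)
    (by positivity : (0:ℝ) ≤ (b0:ℝ) + 1))
  have a3 := keep_trick h0 h1 b0 (fun H : Finset (Hyp m s n) => H.filter fun h => loc H h) ψ hψ
  have a4 : 1 - Ex (fun _ : Hyp m s n => π) (fun H => ind (exc Dg H))
      - Ex (fun _ : Hyp m s n => π) (fun H => ind ((b0:ℝ) + 1 ≤ ((H.filter fun h => loc H h).card : ℝ)))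
      - Ex (fun _ : Hyp m s n => π) (fun H => ind ((H.filter fun h => loc H h).card ≤ b0 ∧
          ¬ ψ (H \ H.filter fun h => loc H h))) ≤
      Ex (fun _ : Hyp m s n => π) (fun H => ind (ψ (H.filter fun h => ¬ Bd Dg H h))) := by
    have e0 := Ex_const (fun _ : Hyp m s n => π) 1
    have e1 := Ex_sub (fun _ : Hyp m s n => π) (fun _ => 1) (fun H => ind (exc Dg H))
    rw [e0] at e1
    rw [← e1, ← Ex_sub, ← Ex_sub]
    refine Ex_mono (fun _ => h0) (fun _ => h1) fun H => ?_
    have u1 := ind_nonneg (exc Dg H)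
    have u2 := ind_nonneg ((b0:ℝ) + 1 ≤ ((H.filter fun h => loc H h).card : ℝ))
    have u3 := ind_nonneg ((H.filter fun h => loc H h).card ≤ b0 ∧
          ¬ ψ (H \ H.filter fun h => loc H h))
    have u4 := ind_nonneg (ψ (H.filter fun h => ¬ Bd Dg H h))
    by_cases c1 : exc Dg H
    · have : ind (exc Dg H) = 1 := if_pos c1
      linarith
    by_cases c2 : (b0:ℝ) + 1 ≤ ((H.filter fun h => loc H h).card : ℝ)
    · have : ind ((b0:ℝ) + 1 ≤ ((H.filter fun h => loc H h).card : ℝ)) = 1 := if_pos c2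
      linarith
    have c2' : (H.filter fun h => loc H h).card ≤ b0 := by
      by_contra hc
      exact c2 (by exact_mod_cast (by omega : b0 + 1 ≤ (H.filter fun h => loc H h).card))
    by_cases c3 : ψ (H \ H.filter fun h => loc H h)
    · have : ψ (H.filter fun h => ¬ Bd Dg H h) := by
        refine hψ _ _ ?_ c3
        intro h hh
        obtain ⟨z1, z2⟩ := Finset.mem_sdiff.1 hh
        refine Finset.mem_filter.2 ⟨z1, fun hb => ?_⟩
        rcases hb with hb | hb
        · exact c1 hb
        · exact z2 (Finset.mem_filter.2 ⟨z1, hb⟩)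
      have : ind (ψ (H.filter fun h => ¬ Bd Dg H h)) = 1 := if_pos this
      linarith
    · have : ind ((H.filter fun h => loc H h).card ≤ b0 ∧
          ¬ ψ (H \ H.filter fun h => loc H h)) = 1 := if_pos ⟨c2', c3⟩
      linarith
  linarith
end probs

section rounds
variable {m s n : ℕ} {adj : PtT m s → PtT m s → Fin n → Fin n → Prop}

lemma card_SS_le (σ : Sg m s n) : (SS σ).card ≤ m * n := by
  unfold SS
  refine Finset.card_image_le.trans ?_
  rw [Finset.card_univ]
  simp [Rw]

lemma phase1 {p Y K l : ℝ} {Dg b0 k : ℕ} (hn : 0 < n) (hs : 0 < s) (hp : 0 < p) (hp1 : p ≤ 1) (hY : 0 < Y)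
    (hp2 : (p⁻¹) ^ s ≤ (n:ℝ) ^ 2) (hYn : Y ^ s ≤ n)
    (hsmall : 2 ^ Fintype.card (Pr2 s) * (Fintype.card (Pr2 s) : ℝ) *
      (p ^ Fintype.card (Pr2 s) * (n:ℝ) ^ (s - 1)) * ((1 + (s:ℝ) * Dg) ^ s) ^ s ≤ Y / 2)
    (hK : 1 ≤ K) (hMM : MMb adj K) (hOm : (OmF adj).Nonempty) (hl : 0 ≤ l) (hkl : (m:ℝ) * n ≤ 2 ^ k * l)
    (hkq : k * (2 * Real.exp 2 * ((K / n) ^ s * n)) ≤ p ^ Fintype.card (Pr2 s) / 2 / 2) :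
    1 - m * (s * n) * (Real.exp (p ^ Fintype.card (Pr2 s) / 2 * n ^ (s - 1)) / 2 ^ Dg)
      - m * s ^ 3 * (n ^ s * n ^ (s - 2) * (p ^ Fintype.card (Pr2 s) / 2) ^ 2 +
          n ^ s * n ^ (s - 1) * n ^ (s - 2) * (p ^ Fintype.card (Pr2 s) / 2) ^ 3) / (b0 + 1)
      - 2 ^ b0 * (2 * (k * Real.exp (-l))) ≤
    Ex (fun _ => p) (fun G => ind (badNum (OmF adj) SS (clo EH G) l ≤ ((OmF adj).card : ℝ) / 2)) := by
  set b := Fintype.card (Pr2 s) with hb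
  set ψ : Finset (Hyp m s n) → Prop := fun W => badNum (OmF adj) SS W l ≤ ((OmF adj).card : ℝ) / 2 with hψd
  have hψ : ∀ A B, A ⊆ B → ψ A → ψ B := fun A B hAB hA => (badNum_mono _ _ hAB l).trans hA
  have hc := coupling_model (Dg := Dg) hn hs hp hp1 hY hp2 hYn hsmall ψ hψ
  have hpb1 : p ^ b ≤ 1 := pow_le_one₀ hp.le hp1
  have hpb0 : 0 < p ^ b := by positivity
  have hd := del_bound (π := p ^ b / 2) (by positivity) (by linarith) Dg b0 ψ hψ
  have hnR : (0:ℝ) < n := by exact_mod_cast hn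
  have hOmc : (0:ℝ) < (OmF adj).card := by exact_mod_cast hOm.card_pos
  have hq : 0 < (K / n) ^ s * (n:ℝ) := by positivity
  have hr := hyper_red (X := Hyp m s n) (Sg m s n) hOmc.le hq hl k (by linarith)
  have hr2 := red_mono (π' := p ^ b / 2 / 2) (by positivity) hkq (by linarith) le_rfl hr
  have hr3 := hr2 (OmF adj) SS (hyper_spread (by linarith) hs hn hMM) (fun _ _ => trivial)
    (fun σ _ => le_trans (by exact_mod_cast card_SS_le σ) hkl)
  have hmk := markov (fun _ : Hyp m s n => (by positivity : 0 ≤ p ^ b / 2 / 2))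
    (fun _ => (by linarith : p ^ b / 2 / 2 ≤ 1)) (fun W => badNum (OmF adj) SS W l)
    (fun W => by unfold badNum; positivity) (t := ((OmF adj).card : ℝ) / 2) (by positivity)
  have hE : Ex (fun _ : Hyp m s n => p ^ b / 2 / 2) (fun H => ind (¬ ψ H)) ≤ 2 * (k * Real.exp (-l)) := by
    refine (Ex_mono (fun _ => by positivity) (fun _ => by linarith) fun W =>
      ind_mono fun h => (not_le.1 h).le).trans (hmk.trans ?_)
    rw [div_le_iff₀ (by positivity)]
    refine hr3.trans (le_of_eq ?_)
    ring
  have h2 : (2:ℝ) ^ b0 * Ex (fun _ : Hyp m s n => p ^ b / 2 / 2) (fun H => ind (¬ ψ H)) ≤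
      2 ^ b0 * (2 * (k * Real.exp (-l))) := mul_le_mul_of_nonneg_left hE (by positivity)
  refine le_trans ?_ hc
  linarith

lemma phase2 {p K x l : ℝ} (hK : 1 ≤ K) (hMM : MMb adj K) (hOm : (OmF adj).Nonempty) (hs : 2 ≤ s)
    (hp : 0 < p) (hx : 1 ≤ x) (hw : ∀ D : Finset (Pr2 s), D.Nonempty →
      (p⁻¹) ^ D.card * ((K / n) ^ s * ((constOn n D).card : ℝ)) ≤ K ^ s / x ^ 2)
    (Q : ℝ) (hQ : Q = 2 ^ Fintype.card (Pr2 s) * K ^ s * (Fintype.card (Pr2 s) : ℝ))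
    (hxQ : Q ≤ Real.log x) (k : ℕ) (hk : (k + 1) * p < 1) (hl : l ≤ x ^ k)
    (G1 : Finset (Edg m s n)) (hG : badNum (OmF adj) SS (clo EH G1) l ≤ ((OmF adj).card : ℝ) / 2) :
    1 - 2 * ((k + 1) * Real.exp (-(Real.log x / (2 * (Fintype.card (Pr2 s) : ℝ))) + Q)) ≤
    Ex (fun _ => (k + 1) * p) (fun G2 => ind (∃ σ ∈ OmF adj, ES σ ⊆ G1 ∪ G2)) := by
  set b := Fintype.card (Pr2 s) with hb
  set E2 := (k + 1) * Real.exp (-(Real.log x / (2 * (b : ℝ))) + Q) with hE2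
  have hOmc : (0:ℝ) < (OmF adj).card := by exact_mod_cast hOm.card_pos
  set Om' := (OmF adj).filter fun ω => GoodFrag (OmF adj) SS (clo EH G1) l ω with hOm'
  have hcard : ((OmF adj).card : ℝ) / 2 ≤ Om'.card := by
    unfold badNum at hG
    have := Finset.card_filter_add_card_filter_not (s := OmF adj)
      (fun ω => GoodFrag (OmF adj) SS (clo EH G1) l ω)
    have : (Om'.card : ℝ) + (((OmF adj).filter fun ω => ¬ GoodFrag (OmF adj) SS (clo EH G1) l ω).card : ℝ)
      = (OmF adj).card := by exact_mod_cast this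
    linarith
  have hex : ∀ ω, ∃ ω', ω ∈ Om' → (ω' ∈ OmF adj ∧ SS ω' ⊆ clo EH G1 ∪ SS ω ∧
      ((SS ω' \ clo EH G1).card : ℝ) ≤ l) := by
    intro ω
    by_cases h : ω ∈ Om'
    · obtain ⟨ω', h1, h2, h3⟩ := (Finset.mem_filter.1 h).2
      exact ⟨ω', fun _ => ⟨h1, h2, h3⟩⟩
    · exact ⟨ω, fun h' => absurd h' h⟩
  choose χ hχ using hex
  let T : Sg m s n → Finset (Edg m s n) := fun ω => ES (χ ω) \ G1
  have hT1 : ∀ ω ∈ Om', T ω ⊆ (SS (χ ω) \ clo EH G1).biUnion EH := by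
    intro ω _ e he
    obtain ⟨he1, he2⟩ := Finset.mem_sdiff.1 he
    obtain ⟨h, hh, heh⟩ := Finset.mem_biUnion.1 he1
    refine Finset.mem_biUnion.2 ⟨h, Finset.mem_sdiff.2 ⟨hh, fun hc => he2 ?_⟩, heh⟩
    exact (Finset.mem_filter.1 hc).2 heh
  have hT2 : ∀ ω ∈ Om', T ω ⊆ ES ω := by
    intro ω hω e he
    obtain ⟨h, hh, heh⟩ := Finset.mem_biUnion.1 (hT1 ω hω he)
    obtain ⟨hh1, hh2⟩ := Finset.mem_sdiff.1 hh
    rcases Finset.mem_union.1 ((hχ ω hω).2.1 hh1) with hc | hc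
    · exact absurd hc hh2
    · exact Finset.mem_biUnion.2 ⟨h, hc, heh⟩
  have hT3 : ∀ ω ∈ Om', ((T ω).card : ℝ) ≤ b * x ^ k := by
    intro ω hω
    have h1 := (Finset.card_le_card (hT1 ω hω)).trans
      (Finset.card_biUnion_le_card_mul _ _ b fun h _ => (card_EH h).le)
    have h2 : ((T ω).card : ℝ) ≤ ((SS (χ ω) \ clo EH G1).card : ℝ) * b := by exact_mod_cast h1
    refine h2.trans ?_
    rw [mul_comm]
    exact mul_le_mul_of_nonneg_left ((hχ ω hω).2.2.trans hl) (by positivity)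
  have hr := edge_red (m := m) (Sg m s n) (by linarith) hMM hs hp hx hw Q hQ hxQ k hk Om' T
    (by
      intro U
      unfold NE
      refine Nat.cast_le.2 (Finset.card_le_card ?_)
      intro ω hω
      obtain ⟨h1, h2⟩ := Finset.mem_filter.1 hω
      exact Finset.mem_filter.2 ⟨(Finset.mem_filter.1 h1).1, h2.trans (hT2 ω h1)⟩)
    (fun ω hω => ⟨ω, hT2 ω hω⟩) hT3
  have hkp : 0 ≤ (k + 1) * p := by positivity
  have hmk := markov (fun _ : Edg m s n => hkp)
    (fun _ => hk.le) (fun W => badNum Om' T W (1 / 2))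
    (fun W => by unfold badNum; positivity) (t := ((OmF adj).card : ℝ) / 2) (by positivity)
  have h1 : 1 - Ex (fun _ : Edg m s n => (k + 1) * p)
      (fun W => ind (((OmF adj).card : ℝ) / 2 ≤ badNum Om' T W (1 / 2))) ≤
      Ex (fun _ => (k + 1) * p) (fun G2 => ind (∃ σ ∈ OmF adj, ES σ ⊆ G1 ∪ G2)) := by
    have e1 := Ex_sub (fun _ : Edg m s n => (k + 1) * p) (fun _ => 1)
      (fun W => ind (((OmF adj).card : ℝ) / 2 ≤ badNum Om' T W (1 / 2)))
    rw [Ex_const] at e1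
    rw [← e1]
    refine Ex_mono (fun _ => hkp) (fun _ => hk.le) fun W => ?_
    by_cases hc : ∃ σ ∈ OmF adj, ES σ ⊆ G1 ∪ W
    · have : ind (∃ σ ∈ OmF adj, ES σ ⊆ G1 ∪ W) = 1 := if_pos hc
      have := ind_nonneg (((OmF adj).card : ℝ) / 2 ≤ badNum Om' T W (1 / 2))
      linarith
    · have h2 := ind_nonneg (∃ σ ∈ OmF adj, ES σ ⊆ G1 ∪ W)
      have h3 : ((OmF adj).card : ℝ) / 2 ≤ badNum Om' T W (1 / 2) := by
        refine hcard.trans ?_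
        unfold badNum
        refine Nat.cast_le.2 (Finset.card_le_card ?_)
        intro ω hω
        refine Finset.mem_filter.2 ⟨hω, ?_⟩
        rintro ⟨ω', hω', _, h5⟩
        refine hc ⟨χ ω', (hχ ω' hω').1, ?_⟩
        have h6 : (T ω' \ W).card = 0 := by
          by_contra h0
          have : (1:ℝ) ≤ ((T ω' \ W).card : ℝ) := by exact_mod_cast Nat.one_le_iff_ne_zero.2 h0
          linarith
        intro e he
        by_cases heG : e ∈ G1
        · exact Finset.mem_union_left _ heG
        · refine Finset.mem_union_right _ ?_
          exact (Finset.sdiff_eq_empty_iff_subset.1 (Finset.card_eq_zero.1 h6))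
            (Finset.mem_sdiff.2 ⟨he, heG⟩)
      have : ind (((OmF adj).card : ℝ) / 2 ≤ badNum Om' T W (1 / 2)) = 1 := if_pos h3
      linarith
  refine le_trans ?_ h1
  have h4 : Ex (fun _ : Edg m s n => (k + 1) * p)
      (fun W => ind (((OmF adj).card : ℝ) / 2 ≤ badNum Om' T W (1 / 2))) ≤ 2 * E2 := by
    refine hmk.trans ?_
    rw [div_le_iff₀ (by positivity)]
    refine hr.trans (le_of_eq ?_)
    rw [hE2]; ring
  linarith

lemma phase12 {p e1 e2 : ℝ} {k : ℕ} (hp : 0 < p) (hk : (k + 2) * p < 1)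
    (ψ : Finset (Edg m s n) → Prop)
    (h1 : 1 - e1 ≤ Ex (fun _ : Edg m s n => p) (fun G => ind (ψ G))) (he2 : 0 ≤ e2)
    (h2 : ∀ G1, ψ G1 → 1 - e2 ≤
      Ex (fun _ : Edg m s n => (k + 1) * p) (fun G2 => ind (∃ σ ∈ OmF adj, ES σ ⊆ G1 ∪ G2))) :
    1 - e1 - e2 ≤ Ex (fun _ : Edg m s n => (k + 2) * p) (fun G => ind (∃ σ ∈ OmF adj, ES σ ⊆ G)) := by
  have hkp : 0 ≤ (k + 1) * p := by positivity
  have hk0 : (0:ℝ) ≤ k := by positivity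
  have hkp1 : (k + 1) * p ≤ 1 := by nlinarith
  have hp1 : p ≤ 1 := by nlinarith
  have e := Ex_union (fun _ : Edg m s n => p) (fun _ => (k + 1) * p)
    (fun G => ind (∃ σ ∈ OmF adj, ES σ ⊆ G))
  have hm := Ex_mono_param (X := Edg m s n) (p := 1 - (1 - p) * (1 - (k + 1) * p)) (q := (k + 2) * p)
    (by nlinarith) (by nlinarith) hk
    (f := fun G => ind (∃ σ ∈ OmF adj, ES σ ⊆ G))
    (fun A B hAB => ind_mono fun ⟨σ, h1, h2⟩ => ⟨σ, h1, h2.trans hAB⟩)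
  refine le_trans ?_ hm
  rw [← e]
  have hlow : ∀ G1, ind (ψ G1) - e2 ≤
      Ex (fun _ : Edg m s n => (k + 1) * p) (fun G2 => ind (∃ σ ∈ OmF adj, ES σ ⊆ G1 ∪ G2)) := by
    intro G1
    by_cases h : ψ G1
    · have := h2 G1 h
      have := ind_le_one (ψ G1)
      linarith
    · have h3 : ind (ψ G1) = 0 := if_neg h
      have := Ex_nonneg (fun _ : Edg m s n => hkp) (fun _ => hkp1)
        (f := fun G2 => ind (∃ σ ∈ OmF adj, ES σ ⊆ G1 ∪ G2)) fun _ => ind_nonneg _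
      linarith
  have h5 := Ex_mono (fun _ : Edg m s n => hp.le) (fun _ => hp1) hlow
  rw [Ex_sub, Ex_const] at h5
  linarith
end rounds

section numerics
open Filter Topology

lemma ev_f1 (B A δ : ℝ) (hδ : 0 < δ) :
    ∀ᶠ L : ℝ in atTop, B * Real.exp (L + A * L / 2 - L ^ 2 * Real.log 2) ≤ δ := by
  have h2 : (0:ℝ) < Real.log 2 := Real.log_pos one_lt_two
  have ht : Tendsto (fun L : ℝ => |B| * Real.exp (-L)) atTop (𝓝 0) := by
    have := (Real.tendsto_exp_neg_atTop_nhds_zero).const_mul |B|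
    simpa using this
  filter_upwards [ht.eventually_lt_const hδ, eventually_ge_atTop ((2 + A / 2) / Real.log 2),
    eventually_ge_atTop 0] with L h hL h0
  have h3 : 2 + A / 2 ≤ L * Real.log 2 := (div_le_iff₀ h2).1 hL
  have h4 : L + A * L / 2 - L ^ 2 * Real.log 2 ≤ -L := by nlinarith
  calc B * Real.exp (L + A * L / 2 - L ^ 2 * Real.log 2)
      ≤ |B| * Real.exp (L + A * L / 2 - L ^ 2 * Real.log 2) :=
        mul_le_mul_of_nonneg_right (le_abs_self B) (Real.exp_pos _).le
    _ ≤ |B| * Real.exp (-L) := mul_le_mul_of_nonneg_left (Real.exp_le_exp.2 h4) (abs_nonneg B)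
    _ ≤ δ := h.le

lemma ev_f2 (B A δ : ℝ) (hδ : 0 < δ) (hB : 0 ≤ B) (hA : 0 ≤ A) :
    ∀ᶠ L : ℝ in atTop, B * ((A * L / 2) ^ 2 + (A * L / 2) ^ 3) / (L ^ 4) ≤ δ := by
  filter_upwards [eventually_ge_atTop 1, eventually_ge_atTop (B * (A ^ 2 + A ^ 3) / δ)] with L h1 h2
  have hL : 0 < L := by linarith
  rw [div_le_iff₀ hδ] at h2
  rw [div_le_iff₀ (by positivity)]
  have h3 : (A * L / 2) ^ 2 + (A * L / 2) ^ 3 ≤ (A ^ 2 + A ^ 3) * L ^ 3 := by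
    have : L ^ 2 ≤ L ^ 3 := pow_le_pow_right₀ h1 (by norm_num)
    have e : (A * L / 2) ^ 2 + (A * L / 2) ^ 3 = A ^ 2 * L ^ 2 / 4 + A ^ 3 * L ^ 3 / 8 := by ring
    rw [e]
    have h5 : A ^ 2 * L ^ 2 ≤ A ^ 2 * L ^ 3 := mul_le_mul_of_nonneg_left this (by positivity)
    have h6 : 0 ≤ A ^ 3 * L ^ 3 := by positivity
    have h7 : 0 ≤ A ^ 2 * L ^ 2 := by positivity
    nlinarith
  calc B * ((A * L / 2) ^ 2 + (A * L / 2) ^ 3) ≤ B * ((A ^ 2 + A ^ 3) * L ^ 3) :=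
        mul_le_mul_of_nonneg_left h3 hB
    _ = (B * (A ^ 2 + A ^ 3)) * L ^ 3 := by ring
    _ ≤ (L * δ) * L ^ 3 := mul_le_mul_of_nonneg_right h2 (by positivity)
    _ = δ * L ^ 4 := by ring

lemma ev_f3 (δ : ℝ) (hδ : 0 < δ) :
    ∀ᶠ L : ℝ in atTop, Real.exp (L ^ 4 + 1) * (2 * (3 * L * Real.exp (-L ^ 5))) ≤ δ := by
  have ht : Tendsto (fun L : ℝ => 6 * (L ^ 1 * Real.exp (-L))) atTop (𝓝 0) := by
    have := (Real.tendsto_pow_mul_exp_neg_atTop_nhds_zero 1).const_mul 6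
    simpa using this
  filter_upwards [ht.eventually_lt_const hδ, eventually_ge_atTop 3] with L h hL
  have h1 : Real.exp (L ^ 4 + 1) * Real.exp (-L ^ 5) ≤ Real.exp (-L) := by
    rw [← Real.exp_add]
    refine Real.exp_le_exp.2 ?_
    have e5 : L ^ 5 = L * L ^ 4 := by ring
    have e4 : L ≤ L ^ 4 := by
      calc L = L ^ 1 := (pow_one L).symm
        _ ≤ L ^ 4 := pow_le_pow_right₀ (by linarith) (by norm_num)
    have : 3 * L ^ 4 ≤ L * L ^ 4 := mul_le_mul_of_nonneg_right hL (by positivity)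
    linarith
  calc _ = 6 * L * (Real.exp (L ^ 4 + 1) * Real.exp (-L ^ 5)) := by ring
    _ ≤ 6 * L * Real.exp (-L) := mul_le_mul_of_nonneg_left h1 (by linarith)
    _ = 6 * (L ^ 1 * Real.exp (-L)) := by ring
    _ ≤ δ := h.le

lemma tendsto_log_sqrt : Tendsto (fun L : ℝ => Real.log (Real.sqrt L)) atTop atTop :=
  Real.tendsto_log_atTop.comp Real.tendsto_sqrt_atTop

lemma ev_f4 (B Q b δ : ℝ) (hb : 0 < b) (hδ : 0 < δ) :
    ∀ᶠ L : ℝ in atTop, B * Real.exp (-(Real.log (Real.sqrt L) / (2 * b)) + Q) ≤ δ := by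
  have ht : Tendsto (fun L : ℝ => B * Real.exp (-(Real.log (Real.sqrt L) / (2 * b)) + Q)) atTop (𝓝 0) := by
    have h1 : Tendsto (fun L : ℝ => -(Real.log (Real.sqrt L) / (2 * b))) atTop atBot :=
      tendsto_neg_atTop_atBot.comp (tendsto_log_sqrt.atTop_div_const (by positivity))
    have h2 := Real.tendsto_exp_atBot.comp (tendsto_atBot_add_const_right _ Q h1)
    have := h2.const_mul B
    simpa using this
  filter_upwards [ht.eventually_lt_const hδ] with L h
  exact h.le

lemma ev_pow_exp (B c : ℝ) (hc : 0 < c) (N : ℕ) :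
    ∀ᶠ L : ℝ in atTop, B * L ^ N ≤ Real.exp (c * L) := by
  have h := (isLittleO_pow_exp_pos_mul_atTop N hc).const_mul_left B
  filter_upwards [h.bound (c := 1) one_pos] with L hL
  rw [one_mul, Real.norm_eq_abs, Real.norm_eq_abs, abs_of_pos (Real.exp_pos _)] at hL
  exact (le_abs_self _).trans hL

lemma ev_f5 (B A : ℝ) (s : ℕ) (hs : 0 < s) (hB : 0 ≤ B) (hA : 0 ≤ A) :
    ∀ᶠ L : ℝ in atTop, B * (A * L) * ((1 + (s:ℝ) * (L ^ 2 + 1)) ^ s) ^ s ≤ Real.exp (L / s) / 2 := by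
  have hsR : (0:ℝ) < s := by exact_mod_cast hs
  filter_upwards [eventually_ge_atTop 1,
    ev_pow_exp (2 * (B * A * ((1 + 2 * (s:ℝ)) ^ s) ^ s)) (1 / s) (by positivity) (2 * s * s + 1)]
    with L h1 h2
  have h3 : 1 + (s:ℝ) * (L ^ 2 + 1) ≤ (1 + 2 * s) * L ^ 2 := by
    have : 1 ≤ L ^ 2 := one_le_pow₀ h1
    nlinarith
  have h4 : ((1 + (s:ℝ) * (L ^ 2 + 1)) ^ s) ^ s ≤ (((1 + 2 * s) * L ^ 2) ^ s) ^ s := by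
    refine pow_le_pow_left₀ (by positivity) ?_ _
    exact pow_le_pow_left₀ (by positivity) h3 _
  have h5 : B * (A * L) * ((1 + (s:ℝ) * (L ^ 2 + 1)) ^ s) ^ s ≤
      B * (A * L) * (((1 + 2 * s) * L ^ 2) ^ s) ^ s :=
    mul_le_mul_of_nonneg_left h4 (by positivity)
  have e : 2 * (B * (A * L) * (((1 + 2 * (s:ℝ)) * L ^ 2) ^ s) ^ s) =
      2 * (B * A * ((1 + 2 * (s:ℝ)) ^ s) ^ s) * L ^ (2 * s * s + 1) := by
    rw [mul_pow, mul_pow, pow_succ L (2 * s * s), ← pow_mul L, ← pow_mul L]; ring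
  rw [div_eq_mul_inv L, mul_comm L, ← one_div]
  linarith

lemma ev_f9 (C e c δ : ℝ) (hc : 0 < c) (hδ : 0 < δ) :
    ∀ᶠ L : ℝ in atTop, C * Real.exp (-c * L) * L ^ e < δ := by
  have h := (tendsto_rpow_mul_exp_neg_mul_atTop_nhds_zero e c hc).const_mul C
  rw [mul_zero] at h
  filter_upwards [h.eventually_lt_const hδ] with L hL
  calc C * Real.exp (-c * L) * L ^ e = C * (L ^ e * Real.exp (-c * L)) := by ring
    _ < δ := hL
end numerics

section mainex
open Filter Topology

lemma pbase {s : ℕ} (hs : 2 ≤ s) {n L C : ℝ} (hn : 0 < n) (hL : 0 < L) :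
    (C * n ^ (-(2:ℝ) / s) * L ^ ((2:ℝ) / (s * (s - 1)))) ^ Fintype.card (Pr2 s) * n ^ (s - 1) =
      C ^ Fintype.card (Pr2 s) * L := by
  have hb : 2 * (Fintype.card (Pr2 s) : ℝ) = s * (s - 1) := by
    have := card_Pr2 s
    have h2 : ((2 * Fintype.card (Pr2 s) : ℕ) : ℝ) = ((s * (s - 1) : ℕ) : ℝ) := by rw [this]
    push_cast [Nat.cast_sub (by omega : 1 ≤ s)] at h2
    exact h2
  have hsR : (2:ℝ) ≤ s := by exact_mod_cast hs
  set b := Fintype.card (Pr2 s)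
  have e1 : (n ^ (-(2:ℝ) / s)) ^ b = n ^ (-((s:ℝ) - 1)) := by
    rw [← Real.rpow_natCast, ← Real.rpow_mul hn.le]
    congr 1
    have hs0 : (s:ℝ) ≠ 0 := by positivity
    field_simp
    linarith
  have e2 : (L ^ ((2:ℝ) / (s * (s - 1)))) ^ b = L := by
    rw [← Real.rpow_natCast, ← Real.rpow_mul hL.le]
    have : (2:ℝ) / (s * (s - 1)) * b = 1 := by
      rw [← hb]
      have : (2 * (b:ℝ)) ≠ 0 := by rw [hb]; exact mul_ne_zero (by positivity) (by linarith)
      field_simp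
      have hb0 : (b:ℝ) ≠ 0 := by intro h; rw [h] at this; simp at this
      try exact div_self hb0
    rw [this, Real.rpow_one]
  have e3 : n ^ (s - 1) = n ^ ((s:ℝ) - 1) := by
    rw [← Real.rpow_natCast, Nat.cast_sub (by omega : 1 ≤ s)]; simp
  rw [mul_pow, mul_pow, e1, e2, e3, Real.rpow_neg hn.le]
  have : n ^ ((s:ℝ) - 1) ≠ 0 := (Real.rpow_pos_of_pos hn _).ne'
  field_simp

lemma pinv_pow {s : ℕ} (hs : 2 ≤ s) {n L C : ℝ} (hn : 0 < n) (hL : 1 ≤ L) (hC : 1 ≤ C) :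
    ((C * n ^ (-(2:ℝ) / s) * L ^ ((2:ℝ) / (s * (s - 1))))⁻¹) ^ s ≤ n ^ 2 := by
  have hsR : (2:ℝ) ≤ s := by exact_mod_cast hs
  have h1 : 1 ≤ L ^ ((2:ℝ) / (s * (s - 1))) :=
    Real.one_le_rpow hL (div_nonneg (by norm_num) (mul_nonneg (by linarith) (by linarith)))
  have hp := Real.rpow_pos_of_pos hn (-(2:ℝ) / s)
  have h2 : n ^ (-(2:ℝ) / s) ≤ C * n ^ (-(2:ℝ) / s) * L ^ ((2:ℝ) / (s * (s - 1))) := by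
    calc n ^ (-(2:ℝ) / s) = 1 * n ^ (-(2:ℝ) / s) * 1 := by ring
      _ ≤ _ := by gcongr
  have h3 : (C * n ^ (-(2:ℝ) / s) * L ^ ((2:ℝ) / (s * (s - 1))))⁻¹ ≤ n ^ ((2:ℝ) / s) := by
    have := inv_anti₀ hp h2
    refine this.trans (le_of_eq ?_)
    rw [← Real.rpow_neg hn.le]; congr 1; ring
  calc _ ≤ (n ^ ((2:ℝ) / s)) ^ s := pow_le_pow_left₀ (by positivity) h3 s
    _ = n ^ 2 := by
      rw [← Real.rpow_natCast, ← Real.rpow_mul hn.le, div_mul_cancel₀ _ (by linarith)]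
      norm_num

set_option maxHeartbeats 2000000 in
theorem main_ex (m s : ℕ) (hs : 2 ≤ s) (K : ℝ) (hK : 1 ≤ K) : ∃ C : ℝ, 0 < C ∧ ∀ δ : ℝ, 0 < δ →
    ∃ n₀ : ℕ, ∀ n : ℕ, n₀ ≤ n → 
      0 ≤ C * (n : ℝ) ^ (-(2 : ℝ) / (s : ℝ)) * (Real.log n) ^ ((2 : ℝ) / ((s : ℝ) * ((s : ℝ) - 1))) ∧
      C * (n : ℝ) ^ (-(2 : ℝ) / (s : ℝ)) * (Real.log n) ^ ((2 : ℝ) / ((s : ℝ) * ((s : ℝ) - 1))) < 1 ∧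
      ∀ adj : PtT m s → PtT m s → Fin n → Fin n → Prop, MMb adj K → (OmF adj).Nonempty →
      1 - δ ≤ Ex (fun _ : Edg m s n => C * (n : ℝ) ^ (-(2 : ℝ) / (s : ℝ)) *
        (Real.log n) ^ ((2 : ℝ) / ((s : ℝ) * ((s : ℝ) - 1)))) (fun G => ind (∃ σ ∈ OmF adj, ES σ ⊆ G)) := by
  have he2 : 1 ≤ Real.exp 2 := Real.one_le_exp (by norm_num)
  have hKs : 1 ≤ K ^ s := one_le_pow₀ hK
  set C₁ : ℝ := 24 * Real.exp 2 * K ^ s with hC₁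
  have hC1 : 1 ≤ C₁ := by
    have : 1 ≤ Real.exp 2 * K ^ s := one_le_mul_of_one_le_of_one_le he2 hKs
    rw [hC₁]; nlinarith
  set b := Fintype.card (Pr2 s) with hb
  have hb1 : 1 ≤ b := by
    have h := card_Pr2 s
    rw [← hb] at h
    have : 1 * 1 ≤ s * (s - 1) := Nat.mul_le_mul (by omega) (by omega)
    omega
  have hbR : (1:ℝ) ≤ b := by exact_mod_cast hb1
  set A : ℝ := C₁ ^ b with hA
  have hAC : C₁ ≤ A := by
    calc C₁ = C₁ ^ 1 := (pow_one _).symm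
      _ ≤ A := pow_le_pow_right₀ hC1 hb1
  have hA1 : 1 ≤ A := hC1.trans hAC
  have hsR : (2:ℝ) ≤ s := by exact_mod_cast hs
  set Q : ℝ := 2 ^ b * K ^ s * (b : ℝ) with hQ
  refine ⟨(10 + 2) * C₁, by positivity, fun δ hδ => ?_⟩
  have hlog : Tendsto (fun n : ℕ => Real.log (n:ℝ)) atTop atTop :=
    Real.tendsto_log_atTop.comp tendsto_natCast_atTop_atTop
  have hev : ∀ᶠ n : ℕ in atTop, 0 < n ∧ _ := (eventually_gt_atTop 0).and
    (hlog.eventually (((ev_f1 (m * s) A (δ / 4) (by positivity)).and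
      ((ev_f2 (m * s ^ 3) A (δ / 4) (by positivity) (by positivity) (by positivity)).and
      ((ev_f3 (δ / 4) (by positivity)).and
      ((ev_f4 (2 * (10 + 1)) Q b (δ / 4) (by positivity) (by positivity)).and
      ((ev_f5 (2 ^ b * b) A s (by omega) (by positivity) (by positivity)).and
      ((ev_pow_exp 1 1 one_pos s).and
      ((tendsto_log_sqrt.eventually_ge_atTop Q).and
      ((eventually_ge_atTop (m:ℝ)).and
      ((eventually_ge_atTop (1:ℝ)).and
      (ev_f9 ((10 + 2) * C₁) ((2 : ℝ) / ((s : ℝ) * ((s : ℝ) - 1))) (2 / s) 1 (by positivity) one_pos))))))))))))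
  obtain ⟨n₀, hn₀⟩ := eventually_atTop.1 hev
  refine ⟨n₀, fun n hn => ?_⟩
  obtain ⟨hn0, F1, F2, F3, F4, F5, F6, F7, F8, F8', F9⟩ := hn₀ n hn
  clear hev hn₀ hn
  set L := Real.log (n:ℝ) with hL
  have hnR : (0:ℝ) < n := by exact_mod_cast hn0
  have hexpL : Real.exp L = n := Real.exp_log hnR
  have hL0 : 0 < L := by linarith
  set p : ℝ := C₁ * (n : ℝ) ^ (-(2 : ℝ) / (s : ℝ)) * L ^ ((2 : ℝ) / ((s : ℝ) * ((s : ℝ) - 1))) with hp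
  have hp12 : (10 + 2) * C₁ * (n : ℝ) ^ (-(2 : ℝ) / (s : ℝ)) * L ^ ((2 : ℝ) / ((s : ℝ) * ((s : ℝ) - 1)))
      = (((10:ℕ):ℝ) + 2) * p := by rw [hp]; push_cast; ring
  rw [hp12]
  have hp0 : 0 < p := mul_pos (mul_pos (by linarith) (Real.rpow_pos_of_pos hnR _)) (Real.rpow_pos_of_pos hL0 _)
  have hp1' : (((10:ℕ):ℝ) + 2) * p < 1 := by
    rw [← hp12]
    refine lt_of_eq_of_lt ?_ F9
    congr 2
    rw [Real.rpow_def_of_pos hnR]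
    congr 1; rw [← hL]; ring
  refine ⟨by positivity, hp1', fun adj hMM hOm => ?_⟩
  have hp1 : p ≤ 1 := by push_cast at hp1'; linarith
  have hpb : p ^ b * (n:ℝ) ^ (s - 1) = A * L := pbase hs hnR hL0
  have hps : (p⁻¹) ^ s ≤ (n:ℝ) ^ 2 := pinv_pow hs hnR F8' hC1
  have hns : (0:ℝ) < (n:ℝ) ^ (s - 1) := by positivity
  have hpb' : p ^ b = A * L / (n:ℝ) ^ (s - 1) := by rw [← hpb]; field_simp
  have hbm : (((m:ℝ)) * n) ≤ 2 ^ (⌈2 * L⌉₊) * L ^ 5 := by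
    have h1 : (n:ℝ) ≤ 2 ^ (⌈2 * L⌉₊) := by
      rw [← hexpL, ← Real.rpow_natCast, Real.rpow_def_of_pos two_pos]
      refine Real.exp_le_exp.2 ?_
      have h2 := Nat.le_ceil (2 * L)
      have h3 : (0.6931471803:ℝ) < Real.log 2 := Real.log_two_gt_d9
      nlinarith
    have h2 : (m:ℝ) ≤ L ^ 5 := F8.trans (by
      calc L = L ^ 1 := (pow_one L).symm
        _ ≤ L ^ 5 := pow_le_pow_right₀ F8' (by norm_num))
    rw [mul_comm]
    exact mul_le_mul h1 h2 (by positivity) (by positivity)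
  have hk3 : ((⌈2 * L⌉₊ : ℕ) : ℝ) ≤ 3 * L := by
    have := (Nat.ceil_lt_add_one (by positivity : 0 ≤ 2 * L)).le
    linarith
  have hDg : ((⌈L ^ 2⌉₊ : ℕ) : ℝ) ≤ L ^ 2 + 1 := (Nat.ceil_lt_add_one (by positivity)).le
  have hb0 : ((⌈L ^ 4⌉₊ : ℕ) : ℝ) ≤ L ^ 4 + 1 := (Nat.ceil_lt_add_one (by positivity)).le
  have hYs : (Real.exp (L / s)) ^ s = n := by
    rw [← Real.exp_nat_mul, mul_div_cancel₀ _ (by positivity), hexpL]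
  have ph1 := phase1 (adj := adj) (p := p) (Y := Real.exp (L / s)) (K := K) (l := L ^ 5) (Dg := ⌈L ^ 2⌉₊)
    (b0 := ⌈L ^ 4⌉₊) (k := ⌈2 * L⌉₊) hn0 (by omega) hp0 hp1 (Real.exp_pos _) hps hYs.le
    (by
      rw [← hb, hpb]
      refine le_trans ?_ F5
      refine mul_le_mul_of_nonneg_left ?_ (by positivity)
      refine pow_le_pow_left₀ (by positivity) ?_ _
      refine pow_le_pow_left₀ (by positivity) ?_ _
      have := mul_le_mul_of_nonneg_left hDg (by positivity : (0:ℝ) ≤ s)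
      linarith)
    hK hMM hOm (by positivity) hbm
    (by
      rw [← hb, hpb']
      have e1 : (K / n) ^ s * (n:ℝ) = K ^ s / (n:ℝ) ^ (s - 1) := by
        have : (n:ℝ) ^ s = (n:ℝ) ^ (s - 1) * n := by rw [← pow_succ]; congr 1; omega
        rw [div_pow, this]
        field_simp
      rw [e1]
      have e2 : (⌈2 * L⌉₊ : ℝ) * (2 * Real.exp 2 * (K ^ s / (n:ℝ) ^ (s - 1))) =
        ((⌈2 * L⌉₊ : ℝ) * (2 * Real.exp 2 * K ^ s)) / (n:ℝ) ^ (s - 1) := by ring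
      have e3 : A * L / (n:ℝ) ^ (s - 1) / 2 / 2 = (A * L / 4) / (n:ℝ) ^ (s - 1) := by ring
      rw [e2, e3]
      refine div_le_div_of_nonneg_right ?_ hns.le
      calc (⌈2 * L⌉₊ : ℝ) * (2 * Real.exp 2 * K ^ s) ≤ 3 * L * (2 * Real.exp 2 * K ^ s) :=
            mul_le_mul_of_nonneg_right hk3 (by positivity)
        _ = C₁ * L / 4 := by rw [hC₁]; ring
        _ ≤ A * L / 4 := by
          have := mul_le_mul_of_nonneg_right hAC hL0.le
          linarith)
  have T1 : (m:ℝ) * (s * n) * (Real.exp (p ^ b / 2 * n ^ (s - 1)) / 2 ^ ⌈L ^ 2⌉₊) ≤ δ / 4 := by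
    refine le_trans ?_ F1
    have e1 : p ^ b / 2 * (n:ℝ) ^ (s - 1) = A * L / 2 := by rw [← hpb]; ring
    rw [e1]
    have h2 : Real.exp (L ^ 2 * Real.log 2) ≤ 2 ^ ⌈L ^ 2⌉₊ := by
      rw [← Real.rpow_natCast 2 ⌈L ^ 2⌉₊, Real.rpow_def_of_pos two_pos]
      refine Real.exp_le_exp.2 ?_
      rw [mul_comm]
      exact mul_le_mul_of_nonneg_left (Nat.le_ceil _) (Real.log_pos one_lt_two).le
    have h3 : Real.exp (A * L / 2) / 2 ^ ⌈L ^ 2⌉₊ ≤ Real.exp (A * L / 2) / Real.exp (L ^ 2 * Real.log 2) :=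
      div_le_div_of_nonneg_left (Real.exp_pos _).le (Real.exp_pos _) h2
    rw [Real.exp_sub, Real.exp_add, hexpL]
    calc _ ≤ (m:ℝ) * (s * n) * (Real.exp (A * L / 2) / Real.exp (L ^ 2 * Real.log 2)) :=
          mul_le_mul_of_nonneg_left h3 (by positivity)
      _ = _ := by ring
  have T2 : (m:ℝ) * s ^ 3 * (n ^ s * n ^ (s - 2) * (p ^ b / 2) ^ 2 +
          n ^ s * n ^ (s - 1) * n ^ (s - 2) * (p ^ b / 2) ^ 3) / ((⌈L ^ 4⌉₊ : ℝ) + 1) ≤ δ / 4 := by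
    refine le_trans ?_ F2
    have e0 : (n:ℝ) ^ s * (n:ℝ) ^ (s - 2) = ((n:ℝ) ^ (s - 1)) ^ 2 := by
      rw [← pow_add, ← pow_mul]; congr 1; omega
    have e1 : (n:ℝ) ^ s * n ^ (s - 2) * (p ^ b / 2) ^ 2 +
          n ^ s * n ^ (s - 1) * n ^ (s - 2) * (p ^ b / 2) ^ 3 = (A * L / 2) ^ 2 + (A * L / 2) ^ 3 := by
      rw [← hpb]
      calc _ = ((n:ℝ) ^ s * n ^ (s - 2)) * (p ^ b / 2) ^ 2 +
          ((n:ℝ) ^ s * n ^ (s - 2)) * n ^ (s - 1) * (p ^ b / 2) ^ 3 := by ring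
        _ = _ := by rw [e0]; ring
    rw [e1]
    refine div_le_div_of_nonneg_left (by positivity) (by positivity) ?_
    have := Nat.le_ceil (L ^ 4)
    linarith
  have T3 : (2:ℝ) ^ ⌈L ^ 4⌉₊ * (2 * ((⌈2 * L⌉₊ : ℝ) * Real.exp (-L ^ 5))) ≤ δ / 4 := by
    refine le_trans ?_ F3
    have h1 : (2:ℝ) ^ ⌈L ^ 4⌉₊ ≤ Real.exp (L ^ 4 + 1) := by
      rw [← Real.rpow_natCast, Real.rpow_def_of_pos two_pos]
      refine Real.exp_le_exp.2 ?_
      have h3 : Real.log 2 ≤ 1 := by have := Real.log_two_lt_d9; linarith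
      calc _ ≤ 1 * ((⌈L ^ 4⌉₊ : ℕ) : ℝ) := mul_le_mul_of_nonneg_right h3 (by positivity)
        _ ≤ _ := by linarith
    have h2 : (2 * ((⌈2 * L⌉₊ : ℝ) * Real.exp (-L ^ 5))) ≤ 2 * (3 * L * Real.exp (-L ^ 5)) := by
      have := mul_le_mul_of_nonneg_right hk3 (Real.exp_pos (-L ^ 5)).le
      linarith
    exact mul_le_mul h1 h2 (by positivity) (Real.exp_pos _).le
  rw [← hb] at ph1
  have hx1 : 1 ≤ Real.sqrt L := Real.one_le_sqrt.2 F8'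
  have hsq : Real.sqrt L ^ 2 = L := Real.sq_sqrt hL0.le
  have hw := edge_w (s := s) (n := n) (K := K) (p := p) (L := L) (by linarith) hn0 (by omega) hp0 F8' hps
    (by rw [one_mul, one_mul, hexpL] at F6; exact F6)
    (by
      rw [← hb, inv_pow, hpb', inv_div]
      refine div_le_div_of_nonneg_left hns.le hL0 ?_
      nlinarith)
  have ph2 := fun G1 hG1 => phase2 (adj := adj) (l := L ^ 5) (x := Real.sqrt L) hK hMM hOm hs hp0 hx1
    (by rw [hsq]; exact hw) Q hQ F7 10
    (by push_cast at hp1' ⊢; linarith)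
    (by
      have : Real.sqrt L ^ 10 = (Real.sqrt L ^ 2) ^ 5 := by ring
      rw [this, hsq]) G1 hG1
  have := phase12 (adj := adj) (k := 10) (e1 := 3 * δ / 4) (e2 := δ / 4) hp0 hp1'
    (fun G => badNum (OmF adj) SS (clo EH G) (L ^ 5) ≤ ((OmF adj).card : ℝ) / 2)
    (by linarith) (by positivity) (fun G1 hG1 => by
      refine le_trans ?_ (ph2 G1 hG1)
      rw [← hb]
      push_cast
      linarith)
  refine le_trans ?_ this
  linarith
end mainex

section transfer

/-- Non-loop pairs. -/
abbrev NEd (N : ℕ) := {e : Sym2 (Fin N) // ¬ e.IsDiag}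

noncomputable def toG {N : ℕ} (W : Finset (NEd N)) : SimpleGraph (Fin N) :=
  SimpleGraph.fromEdgeSet {e | ∃ h : ¬ e.IsDiag, (⟨e, h⟩ : NEd N) ∈ W}

lemma toG_edgeSet {N : ℕ} (W : Finset (NEd N)) :
    (toG W).edgeSet = {e | ∃ h : ¬ e.IsDiag, (⟨e, h⟩ : NEd N) ∈ W} := by
  unfold toG
  rw [SimpleGraph.edgeSet_fromEdgeSet]
  ext e
  constructor
  · intro h; exact h.1
  · rintro ⟨h, hW⟩; exact ⟨⟨h, hW⟩, h⟩

lemma edgeCount_toG {N : ℕ} (W : Finset (NEd N)) : edgeCount (toG W) = W.card := by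
  unfold edgeCount
  rw [toG_edgeSet]
  have e : {e | ∃ h : ¬ e.IsDiag, (⟨e, h⟩ : NEd N) ∈ W} =
      ((W.map (Function.Embedding.subtype _) : Finset (Sym2 (Fin N))) : Set (Sym2 (Fin N))) := by
    ext x; simp
  rw [e, Nat.card_coe_set_eq, Set.ncard_coe_finset, Finset.card_map]

noncomputable def graphEquiv (N : ℕ) : Finset (NEd N) ≃ SimpleGraph (Fin N) where
  toFun := toG
  invFun H := univ.filter fun e => e.1 ∈ H.edgeSet
  left_inv W := by
    ext e
    rw [Finset.mem_filter, toG_edgeSet]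
    constructor
    · rintro ⟨-, h, h2⟩; exact h2
    · intro h; exact ⟨mem_univ _, e.2, h⟩
  right_inv H := by
    rw [← SimpleGraph.edgeSet_inj, toG_edgeSet]
    ext e
    constructor
    · rintro ⟨h, h2⟩; exact (Finset.mem_filter.1 h2).2
    · intro h
      exact ⟨H.not_isDiag_of_mem_edgeSet h, Finset.mem_filter.2 ⟨mem_univ _, h⟩⟩

lemma wt_const {X : Type*} [Fintype X] [DecidableEq X] (p : ℝ) (W : Finset X) :
    wt (fun _ => p) W = p ^ W.card * (1 - p) ^ (Fintype.card X - W.card) := by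
  unfold wt
  rw [Finset.prod_ite, Finset.prod_const, Finset.prod_const]
  congr 2
  · congr 1; ext x; simp
  · rw [← Finset.card_compl]; congr 1; ext x; simp

lemma Pr_eq (N : ℕ) (p : ℝ) (P : SimpleGraph (Fin N) → Prop) :
    Pr N p P = Ex (fun _ : NEd N => p) (fun W => ind (P (toG W))) := by
  unfold Pr Ex
  refine (Fintype.sum_equiv (graphEquiv N) _ _ fun W => ?_).symm
  have h : graphEquiv N W = toG W := rfl
  rw [h, edgeCount_toG, wt_const, Sym2.card_subtype_not_diag, Fintype.card_fin]
  unfold ind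
  beta_reduce
  by_cases hP : P (toG W)
  · rw [if_pos hP, if_pos hP, mul_one]
  · rw [if_neg hP, if_neg hP, mul_zero]

lemma cliqueFactor_of_fun {N n r : ℕ} {H : SimpleGraph (Fin N)} (f : Fin N → Fin n)
    (hf : ∀ a, H.IsNClique r (univ.filter fun b => f b = f a)) : HasCliqueFactor H r := by
  refine ⟨Finpartition.ofSetoid (Setoid.ker f), fun c hc => ?_⟩
  obtain ⟨a, ha⟩ := (Finpartition.ofSetoid (Setoid.ker f)).nonempty_of_mem_parts hc
  have : c = univ.filter fun b => f b = f a := by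
    rw [← Finpartition.part_eq_of_mem _ hc ha]
    ext b
    rw [Finpartition.mem_part_ofSetoid_iff_rel, Finset.mem_filter, Setoid.ker_def]
    constructor
    · intro h; exact ⟨mem_univ _, h.symm⟩
    · intro h; exact h.2.symm
  rw [this]
  exact hf a

/-- Placement of the real parts into the vertex set. -/
structure Place {m s n N : ℕ} (real : PtT m s → Prop) (vx : PtT m s → Fin n → Fin N) (r : ℕ) : Prop where
  inj : ∀ p q u v, real p → real q → vx p u = vx q v → p = q ∧ u = v
  cov : ∀ x, ∃ p u, real p ∧ vx p u = x
  card : (univ.filter real).card = r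

lemma factor_of_rows {m s n N r : ℕ} {real : PtT m s → Prop} {vx : PtT m s → Fin n → Fin N}
    (pl : Place real vx r) {H : SimpleGraph (Fin N)} (σ : Sg m s n)
    (hσ : ∀ y p q, real p → real q → p ≠ q → H.Adj (vx p (σ p y)) (vx q (σ q y))) :
    HasCliqueFactor H r := by
  choose P U hr hv using pl.cov
  have key : ∀ p y, real p → (σ (P (vx p (σ p y)))).symm (U (vx p (σ p y))) = y := by
    intro p y hp
    obtain ⟨h1, h2⟩ := pl.inj _ _ _ _ (hr (vx p (σ p y))) hp (hv (vx p (σ p y)))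
    rw [h2, h1, Equiv.symm_apply_apply]
  refine cliqueFactor_of_fun (fun x => (σ (P x)).symm (U x)) fun a => ?_
  set y := (σ (P a)).symm (U a) with hy
  have e : (univ.filter fun b => (σ (P b)).symm (U b) = y) =
      (univ.filter real).image (fun p => vx p (σ p y)) := by
    ext b
    rw [Finset.mem_filter, Finset.mem_image]
    constructor
    · rintro ⟨-, h⟩
      refine ⟨P b, Finset.mem_filter.2 ⟨mem_univ _, hr b⟩, ?_⟩
      show vx (P b) (σ (P b) y) = b
      rw [← h, Equiv.apply_symm_apply, hv]
    · rintro ⟨p, hp, rfl⟩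
      exact ⟨mem_univ _, key p y (Finset.mem_filter.1 hp).2⟩
  rw [e]
  rw [SimpleGraph.isNClique_iff]
  constructor
  · intro x hx z hz hxz
    obtain ⟨p, hp, rfl⟩ := Finset.mem_image.1 (Finset.mem_coe.1 hx)
    obtain ⟨q, hq, rfl⟩ := Finset.mem_image.1 (Finset.mem_coe.1 hz)
    refine hσ y p q (Finset.mem_filter.1 hp).2 (Finset.mem_filter.1 hq).2 ?_
    rintro rfl
    exact hxz rfl
  · rw [Finset.card_image_of_injOn, pl.card]
    intro p hp q hq h
    exact (pl.inj _ _ _ _ (Finset.mem_filter.1 hp).2 (Finset.mem_filter.1 hq).2 h).1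

/-- Edges both of whose endpoints are real. -/
abbrev Rl {m s : ℕ} (n : ℕ) (real : PtT m s → Prop) :=
  {e : Edg m s n // real (e.1, e.2.1.1.1) ∧ real (e.1, e.2.1.1.2)}

lemma place_ne {m s n N r : ℕ} {real : PtT m s → Prop} {vx : PtT m s → Fin n → Fin N}
    (pl : Place real vx r) (e : Rl n real) :
    ¬ (s(vx (e.1.1, e.1.2.1.1.1) e.1.2.2.1, vx (e.1.1, e.1.2.1.1.2) e.1.2.2.2)).IsDiag := by
  rw [Sym2.mk_isDiag_iff]
  intro h
  have h1 := (pl.inj _ _ _ _ e.2.1 e.2.2 h).1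
  have h2 := congrArg Prod.snd h1
  exact absurd h2 (ne_of_lt e.1.2.1.2)

def rlEmb {m s n N r : ℕ} {real : PtT m s → Prop} {vx : PtT m s → Fin n → Fin N}
    (pl : Place real vx r) : Rl n real ↪ NEd N where
  toFun e := ⟨s(vx (e.1.1, e.1.2.1.1.1) e.1.2.2.1, vx (e.1.1, e.1.2.1.1.2) e.1.2.2.2), place_ne pl e⟩
  inj' := by
    rintro ⟨⟨i, ⟨⟨a, b⟩, hab⟩, u, v⟩, hr1, hr2⟩ ⟨⟨i', ⟨⟨a', b'⟩, hab'⟩, u', v'⟩, hr1', hr2'⟩ h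
    have h' := congrArg Subtype.val h
    dsimp only at h' hr1 hr2 hr1' hr2' hab hab'
    rcases Sym2.eq_iff.1 h' with ⟨h1, h2⟩ | ⟨h1, h2⟩
    · obtain ⟨e1, e2⟩ := pl.inj _ _ _ _ hr1 hr1' h1
      obtain ⟨e3, e4⟩ := pl.inj _ _ _ _ hr2 hr2' h2
      simp only [Prod.mk.injEq] at e1 e3
      obtain ⟨rfl, rfl⟩ := e1
      obtain ⟨-, rfl⟩ := e3
      subst e2 e4
      rfl
    · obtain ⟨e1, e2⟩ := pl.inj _ _ _ _ hr1 hr2' h1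
      obtain ⟨e3, e4⟩ := pl.inj _ _ _ _ hr2 hr1' h2
      simp only [Prod.mk.injEq] at e1 e3
      obtain ⟨rfl, rfl⟩ := e1
      obtain ⟨-, rfl⟩ := e3
      exact absurd hab (not_lt.2 hab'.le)

/-- Host relation. -/
def hadj {m s n N : ℕ} (real : PtT m s → Prop) (vx : PtT m s → Fin n → Fin N) (G : SimpleGraph (Fin N)) :
    PtT m s → PtT m s → Fin n → Fin n → Prop :=
  fun p q u v => p.1 ≠ q.1 → real p → real q → G.Adj (vx p u) (vx q v)

lemma transfer {m s n N r : ℕ} {real : PtT m s → Prop} {vx : PtT m s → Fin n → Fin N}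
    (pl : Place real vx r) (G : SimpleGraph (Fin N)) {p : ℝ} (hp0 : 0 ≤ p) (hp1 : p ≤ 1) :
    Ex (fun _ : Edg m s n => p) (fun E => ind (∃ σ ∈ OmF (hadj real vx G), ES σ ⊆ E)) ≤
      Pr N p (fun H => HasCliqueFactor (G ⊔ H) r) := by
  set f : Finset (Rl n real) → ℝ := fun W =>
    ind (∃ σ ∈ OmF (hadj real vx G), ∀ e : Rl n real, e.1 ∈ ES σ → e ∈ W) with hf
  rw [Pr_eq]
  calc _ ≤ Ex (fun _ : Edg m s n => p)
        (fun E => f (univ.filter fun y => (Function.Embedding.subtype _) y ∈ E)) := by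
        refine Ex_mono (fun _ => hp0) (fun _ => hp1) fun E => ind_mono ?_
        rintro ⟨σ, h1, h2⟩
        exact ⟨σ, h1, fun e he => Finset.mem_filter.2 ⟨mem_univ _, h2 he⟩⟩
    _ = Ex (fun _ : Rl n real => p) f := Ex_marginal _ p f
    _ = Ex (fun _ : NEd N => p) (fun E => f (univ.filter fun y => (rlEmb pl) y ∈ E)) :=
        (Ex_marginal (rlEmb pl) p f).symm
    _ ≤ _ := by
        refine Ex_mono (fun _ => hp0) (fun _ => hp1) fun E => ind_mono ?_
        rintro ⟨σ, h1, h2⟩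
        have hom := (Finset.mem_filter.1 h1).2
        have hlt : ∀ (y : Fin n) (i : Fin m) (a b : Fin s), real (i, a) → real (i, b) → a < b →
            (toG E).Adj (vx (i, a) (σ (i, a) y)) (vx (i, b) (σ (i, b) y)) := by
          intro y i a b ha hb hab
          have := h2 ⟨eh (row σ (i, y)) ⟨(a, b), hab⟩, ha, hb⟩
            (mem_ES.2 ⟨((i, y), ⟨(a, b), hab⟩), rfl⟩)
          have h3 := (Finset.mem_filter.1 this).2
          rw [← SimpleGraph.mem_edgeSet, toG_edgeSet]
          exact ⟨_, h3⟩
        refine factor_of_rows pl σ fun y p q hp hq hpq => ?_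
        by_cases hi : p.1 = q.1
        · right
          obtain ⟨i, a⟩ := p
          obtain ⟨i', b⟩ := q
          dsimp only at hi
          subst hi
          have hab : a ≠ b := fun h => hpq (by rw [h])
          rcases lt_or_gt_of_ne hab with h | h
          · exact hlt y i a b hp hq h
          · exact (hlt y i b a hq hp h).symm
        · left
          exact hom y p q hpq hi hp hq

end transfer

section final

lemma relGood_of_super {n N : ℕ} {G : SimpleGraph (Fin N)} {S T : Set (Fin N)} {x y : Fin n → Fin N}
    (hx : Function.Injective x) (hy : Function.Injective y) (hS : Set.range x = S) (hT : Set.range y = T)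
    {ε d θ ϑ : ℝ} (hθ : θ ≤ ϑ) (hd : ϑ ≤ d) (hε : ε ≤ θ / 2)
    (h : IsSuperRegularPair G S T ε d ϑ) : RelGood n ε θ (fun u v => G.Adj (x u) (y v)) := by
  have cS : S.ncard = n := by rw [← hS, ← Set.image_univ, Set.ncard_image_of_injective _ hx]; simp
  have cT : T.ncard = n := by rw [← hT, ← Set.image_univ, Set.ncard_image_of_injective _ hy]; simp
  obtain ⟨hreg, hdeg, -⟩ := h
  constructor
  · intro u
    have h1 := hdeg (x u) (by rw [← hS]; exact Set.mem_range_self u)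
    have e : T ∩ G.neighborSet (x u) =
        y '' ((univ.filter fun v => G.Adj (x u) (y v) : Finset (Fin n)) : Set (Fin n)) := by
      ext z
      rw [← hT]
      constructor
      · rintro ⟨⟨v, rfl⟩, h⟩
        exact ⟨v, Finset.mem_coe.2 (Finset.mem_filter.2 ⟨mem_univ _, h⟩), rfl⟩
      · rintro ⟨v, hv, rfl⟩
        exact ⟨⟨v, rfl⟩, (Finset.mem_filter.1 (Finset.mem_coe.1 hv)).2⟩
    rw [e, Set.ncard_image_of_injective _ hy, Set.ncard_coe_finset, cT] at h1
    exact le_trans (mul_le_mul_of_nonneg_right hθ (Nat.cast_nonneg _)) h1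
  · intro A B hA hB
    have cX : (x '' (A : Set (Fin n))).ncard = A.card := by
      rw [Set.ncard_image_of_injective _ hx, Set.ncard_coe_finset]
    have cY : (y '' (B : Set (Fin n))).ncard = B.card := by
      rw [Set.ncard_image_of_injective _ hy, Set.ncard_coe_finset]
    have h1 := hreg (x '' (A : Set (Fin n))) (by rw [← hS]; exact Set.image_subset_range _ _)
      (y '' (B : Set (Fin n))) (by rw [← hT]; exact Set.image_subset_range _ _)
      (by rw [cX, cS]; exact hA) (by rw [cY, cT]; exact hB)
    have e : edgesBtw G (x '' (A : Set (Fin n))) (y '' (B : Set (Fin n))) =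
        ∑ u ∈ A, (B.filter fun v => G.Adj (x u) (y v)).card := by
      unfold edgesBtw
      have e1 : {p : Fin N × Fin N | p.1 ∈ x '' (A : Set (Fin n)) ∧ p.2 ∈ y '' (B : Set (Fin n)) ∧
          G.Adj p.1 p.2} = (Prod.map x y) '' (((A ×ˢ B).filter fun q => G.Adj (x q.1) (y q.2) :
            Finset (Fin n × Fin n)) : Set (Fin n × Fin n)) := by
        ext ⟨a, b⟩
        constructor
        · rintro ⟨⟨u, hu, h1⟩, ⟨v, hv, h2⟩, h3⟩
          dsimp only at h1 h2 h3
          subst h1 h2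
          exact ⟨(u, v), Finset.mem_coe.2 (Finset.mem_filter.2 ⟨Finset.mem_product.2 ⟨hu, hv⟩, h3⟩), rfl⟩
        · rintro ⟨⟨u, v⟩, hq, h⟩
          obtain ⟨h1, h2⟩ := Prod.mk.inj h
          subst h1 h2
          have h3 := Finset.mem_filter.1 (Finset.mem_coe.1 hq)
          have h4 := Finset.mem_product.1 h3.1
          exact ⟨⟨u, h4.1, rfl⟩, ⟨v, h4.2, rfl⟩, h3.2⟩
      have e2 : Nat.card {p : Fin N × Fin N // p.1 ∈ x '' (A : Set (Fin n)) ∧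
          p.2 ∈ y '' (B : Set (Fin n)) ∧ G.Adj p.1 p.2} =
          ({p : Fin N × Fin N | p.1 ∈ x '' (A : Set (Fin n)) ∧ p.2 ∈ y '' (B : Set (Fin n)) ∧
          G.Adj p.1 p.2}).ncard := rfl
      rw [e2, e1, Set.ncard_image_of_injective _ (Function.Injective.prodMap hx hy), Set.ncard_coe_finset,
        Finset.card_filter, Finset.sum_product]
      refine Finset.sum_congr rfl fun u _ => ?_
      rw [Finset.card_filter]
    have h2 : θ / 2 ≤ density G (x '' (A : Set (Fin n))) (y '' (B : Set (Fin n))) := by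
      have := (abs_lt.1 h1).1
      linarith
    unfold density at h2
    rw [e, cX, cY] at h2
    rw [← Nat.cast_sum]
    rcases Nat.eq_zero_or_pos A.card with hA0 | hA0
    · rw [hA0, Nat.cast_zero, mul_zero, zero_mul]; exact Nat.cast_nonneg _
    rcases Nat.eq_zero_or_pos B.card with hB0 | hB0
    · rw [hB0, Nat.cast_zero, mul_zero]; exact Nat.cast_nonneg _
    rw [le_div_iff₀ (by positivity)] at h2
    rw [mul_assoc]
    exact h2

lemma card_real {m s : ℕ} (sstar : Fin m → ℕ) (hs : ∀ i, sstar i ≤ s) :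
    (univ.filter fun p : PtT m s => p.2.val < sstar p.1).card = ∑ i, sstar i := by
  rw [Finset.card_filter, Fintype.sum_prod_type]
  refine Finset.sum_congr rfl fun i _ => ?_
  dsimp only
  rw [← Finset.card_filter]
  rw [Fin.card_filter_val_lt]
  exact min_eq_right (hs i)

lemma exists_place {m s n r : ℕ} (sstar : Fin m → ℕ) (hs : ∀ i, sstar i ≤ s) (hr : r = ∑ i, sstar i)
    (hN : 0 < n * r) (W : (i : Fin m) → Fin (sstar i) → Set (Fin (n * r)))
    (hW : ∀ i j, (W i j).ncard = n)
    (hdis : Pairwise fun (a b : Σ i, Fin (sstar i)) => Disjoint (W a.1 a.2) (W b.1 b.2)) :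
    ∃ vx : PtT m s → Fin n → Fin (n * r), Place (fun p : PtT m s => p.2.val < sstar p.1) vx r ∧
      ∀ p : PtT m s, ∀ h : p.2.val < sstar p.1, Function.Injective (vx p) ∧
        Set.range (vx p) = W p.1 ⟨p.2.val, h⟩ := by
  have hex : ∀ p : PtT m s, ∃ f : Fin n → Fin (n * r), ∀ h : p.2.val < sstar p.1, Function.Injective f ∧
        Set.range f = W p.1 ⟨p.2.val, h⟩ := by
    intro p
    by_cases h : p.2.val < sstar p.1
    · have h1 : Nat.card (W p.1 ⟨p.2.val, h⟩) = n := by rw [Nat.card_coe_set_eq, hW]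
      let e : Fin n ≃ W p.1 ⟨p.2.val, h⟩ := (Finite.equivFinOfCardEq h1).symm
      refine ⟨fun u => (e u).1, fun _ => ⟨fun a b hab => e.injective (Subtype.ext hab), ?_⟩⟩
      ext z
      constructor
      · rintro ⟨u, rfl⟩; exact (e u).2
      · intro hz; exact ⟨e.symm ⟨z, hz⟩, by simp⟩
    · exact ⟨fun _ => ⟨0, hN⟩, fun h' => absurd h' h⟩
  choose vx hvx using hex
  have inj : ∀ p q u v, p.2.val < sstar p.1 → q.2.val < sstar q.1 → vx p u = vx q v → p = q ∧ u = v := by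
    intro p q u v hp hq h
    have hpq : p = q := by
      by_contra hne
      have h1 : (⟨p.1, ⟨p.2.val, hp⟩⟩ : Σ i, Fin (sstar i)) ≠ ⟨q.1, ⟨q.2.val, hq⟩⟩ := by
        obtain ⟨i, a⟩ := p
        obtain ⟨i', b⟩ := q
        intro h2
        apply hne
        have h3 : i = i' := congrArg Sigma.fst h2
        subst h3
        have h4 := eq_of_heq (Sigma.mk.inj h2).2
        have h5 : a.val = b.val := by simpa using h4
        rw [Fin.ext h5]
      have h2 := hdis h1
      refine absurd ?_ (Set.disjoint_left.1 h2 (?_ : vx p u ∈ _))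
      rotate_left
      · have := (hvx p hp).2
        dsimp only
        rw [← this]; exact Set.mem_range_self u
      · have := (hvx q hq).2
        dsimp only
        rw [← this, h]; exact Set.mem_range_self v
    subst hpq
    exact ⟨rfl, (hvx p hp).1 h⟩
  refine ⟨vx, ⟨inj, ?_, ?_⟩, hvx⟩
  · let g : {p : PtT m s // p.2.val < sstar p.1} × Fin n → Fin (n * r) := fun z => vx z.1.1 z.2
    have hg : Function.Injective g := by
      intro z w h
      obtain ⟨h1, h2⟩ := inj _ _ _ _ z.1.2 w.1.2 h
      exact Prod.ext (Subtype.ext h1) h2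
    have hc : Fintype.card ({p : PtT m s // p.2.val < sstar p.1} × Fin n) = Fintype.card (Fin (n * r)) := by
      rw [Fintype.card_prod, Fintype.card_fin, Fintype.card_fin, mul_comm, Fintype.card_subtype,
        card_real sstar hs, hr]
    intro x
    obtain ⟨z, hz⟩ := ((Fintype.bijective_iff_injective_and_card g).2 ⟨hg, hc⟩).2 x
    exact ⟨z.1.1, z.2, z.1.2, hz⟩
  · refine Eq.trans ?_ ((card_real sstar hs).trans hr.symm)
    congr!

lemma main_ex' (m s : ℕ) (hs : 1 ≤ s) (K : ℝ) (hK : 1 ≤ K) : ∃ C : ℝ, 0 < C ∧ ∀ δ : ℝ, 0 < δ →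
    ∃ n₀ : ℕ, ∀ n : ℕ, n₀ ≤ n →
    0 ≤ C * (n : ℝ) ^ (-(2 : ℝ) / (s : ℝ)) * (Real.log n) ^ ((2 : ℝ) / ((s : ℝ) * ((s : ℝ) - 1))) ∧
    C * (n : ℝ) ^ (-(2 : ℝ) / (s : ℝ)) * (Real.log n) ^ ((2 : ℝ) / ((s : ℝ) * ((s : ℝ) - 1))) ≤ 1 ∧
    ∀ adj : PtT m s → PtT m s → Fin n → Fin n → Prop, MMb adj K → (OmF adj).Nonempty →
    1 - δ ≤ Ex (fun _ : Edg m s n => C * (n : ℝ) ^ (-(2 : ℝ) / (s : ℝ)) *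
      (Real.log n) ^ ((2 : ℝ) / ((s : ℝ) * ((s : ℝ) - 1))))
      (fun G => ind (∃ σ ∈ OmF adj, ES σ ⊆ G)) := by
  rcases Nat.lt_or_ge 1 s with h2 | h2
  · obtain ⟨C, hC, h⟩ := main_ex m s h2 K hK
    refine ⟨C, hC, fun δ hδ => ?_⟩
    obtain ⟨n₀, hn₀⟩ := h δ hδ
    exact ⟨n₀, fun n hn => ⟨(hn₀ n hn).1, (hn₀ n hn).2.1.le, (hn₀ n hn).2.2⟩⟩
  · have hs1 : s = 1 := le_antisymm h2 hs
    subst hs1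
    refine ⟨1, one_pos, fun δ hδ => ⟨1, fun n hn => ⟨?_, ?_, ?_⟩⟩⟩
    · have : 0 ≤ Real.log (n : ℝ) := Real.log_natCast_nonneg n
      positivity
    · have e : (2 : ℝ) / (((1 : ℕ) : ℝ) * (((1 : ℕ) : ℝ) - 1)) = 0 := by simp
      rw [e, Real.rpow_zero, one_mul, mul_one]
      exact Real.rpow_le_one_of_one_le_of_nonpos (by exact_mod_cast hn) (by norm_num)
    · rintro adj - ⟨σ, hσ⟩
      have e : (fun G : Finset (Edg m 1 n) => ind (∃ σ ∈ OmF adj, ES σ ⊆ G)) = fun _ => 1 := by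
        funext G
        have : ∃ σ ∈ OmF adj, ES σ ⊆ G := by
          refine ⟨σ, hσ, fun e _ => ?_⟩
          have := e.2.1.2
          rw [Subsingleton.elim e.2.1.1.1 e.2.1.1.2] at this
          exact absurd this (lt_irrefl _)
        unfold ind
        exact if_pos this
      rw [e, Ex_const]
      linarith

end final

/-- Lemma 6.3: `K_r`-factors in randomly perturbed collections of
super-regular pairs, where `r = s*(1) + … + s*(m)` with each `s*(i) ≤ s`. -/
theorem statement9 (m s : ℕ) (hm : 1 ≤ m) (hs : 1 ≤ s) (ϑ : ℝ) (hϑ : 0 < ϑ) :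
    ∃ ε₀ : ℝ, 0 < ε₀ ∧ ∀ ε : ℝ, 0 < ε → ε ≤ ε₀ →
      ∃ C : ℝ, 0 < C ∧
        ∀ δ : ℝ, 0 < δ → ∃ n₀ : ℕ, ∀ n : ℕ, n₀ ≤ n →
          ∀ (sstar : Fin m → ℕ) (r : ℕ), (∀ i, sstar i ≤ s) → r = ∑ i, sstar i →
            ∀ G : SimpleGraph (Fin (n * r)),
              ∀ W : (i : Fin m) → Fin (sstar i) → Set (Fin (n * r)),
                (∀ i j, (W i j).ncard = n) →
                (Pairwise fun (a b : Σ i, Fin (sstar i)) =>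
                  Disjoint (W a.1 a.2) (W b.1 b.2)) →
                (∀ i i', i ≠ i' → ∀ j j', ∃ d : ℝ, ϑ ≤ d ∧
                  IsSuperRegularPair G (W i j) (W i' j') ε d ϑ) →
                1 - δ ≤ Pr (n * r) (C * (n : ℝ) ^ (-(2 : ℝ) / (s : ℝ)) *
                    (Real.log n) ^ ((2 : ℝ) / ((s : ℝ) * ((s : ℝ) - 1))))
                  (fun H => HasCliqueFactor (G ⊔ H) r) := by
  obtain ⟨M, hM⟩ : ∃ M, Fintype.card (Gam (PtT m s)) = M + 1 :=
    ⟨Fintype.card (Gam (PtT m s)) - 1, (Nat.succ_pred_eq_of_pos Fintype.card_pos).symm⟩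
  obtain ⟨θ, hθ0, hθϑ, hθ1⟩ : ∃ θ : ℝ, 0 < θ ∧ θ ≤ ϑ ∧ θ ≤ 1 :=
    ⟨min ϑ 1, lt_min hϑ one_pos, min_le_left _ _, min_le_right _ _⟩
  set η : ℝ := θ / 2 * (θ / 4) ^ M with hη
  have hη0 : 0 < η := by positivity
  refine ⟨min (θ / 2) (η / (2 * (M + 1))), lt_min (by positivity) (by positivity), fun ε hε0 hε => ?_⟩
  have hε1 : ε ≤ θ / 2 := hε.trans (min_le_left _ _)
  have hε2 : ε * (2 * ((M : ℝ) + 1)) ≤ η := by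
    have := hε.trans (min_le_right _ _)
    rwa [le_div_iff₀ (by positivity)] at this
  have hc : 0 < cc θ M (θ / 2) := cc_pos hθ0 M (by positivity)
  obtain ⟨K, hK, hspread⟩ := MM_spread (PtT m s) hc (by positivity : 0 < θ / 4)
  obtain ⟨C, hC, hmain⟩ := main_ex' m s hs K hK
  refine ⟨C, hC, fun δ hδ => ?_⟩
  obtain ⟨n₀, hn₀⟩ := hmain δ hδ
  refine ⟨max n₀ (max 1 (max ⌈1 / η⌉₊ ⌈1 / (θ / 4)⌉₊)), fun n hn sstar r hss hr G W hW hdis hsup => ?_⟩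
  have h1 : n₀ ≤ n := (le_max_left _ _).trans hn
  have hn' := (le_max_right _ _).trans hn
  have hn1 : 0 < n := (le_max_left _ _).trans hn'
  have hn'' := (le_max_right _ _).trans hn'
  have hn2 : 1 ≤ (n : ℝ) * η := by
    have := Nat.ceil_le.1 ((le_max_left _ _).trans hn'')
    rwa [div_le_iff₀ hη0] at this
  have hn3 : 1 ≤ (n : ℝ) * (θ / 4) := by
    have := Nat.ceil_le.1 ((le_max_right _ _).trans hn'')
    rwa [div_le_iff₀ (by positivity)] at this
  obtain ⟨hp0, hp1, hEx⟩ := hn₀ n h1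
  rcases Nat.eq_zero_or_pos r with hr0 | hr0
  · rw [Pr_eq]
    have e : (fun E : Finset (NEd (n * r)) => ind (HasCliqueFactor (G ⊔ toG E) r)) = fun _ => 1 := by
      funext E
      refine if_pos ?_
      refine cliqueFactor_of_fun (n := n) (fun _ => ⟨0, hn1⟩) fun a => ?_
      exfalso
      have h5 := a.2
      have h6 : n * r = 0 := by rw [hr0, mul_zero]
      omega
    rw [e, Ex_const]
    linarith
  obtain ⟨vx, pl, hvx⟩ := exists_place (s := s) sstar hss hr (Nat.mul_pos hn1 hr0) W hW hdis
  refine le_trans ?_ (transfer pl G hp0 hp1)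
  have hH : HostGood n ε θ (hadj (fun p : PtT m s => p.2.val < sstar p.1) vx G) := by
    constructor
    · intro p q u v h h1 h2 h3
      exact (h h1.symm h3 h2).symm
    · intro p q _
      by_cases hb : p.1 ≠ q.1 ∧ p.2.val < sstar p.1 ∧ q.2.val < sstar q.1
      · obtain ⟨b1, b2, b3⟩ := hb
        obtain ⟨d, hd, hsr⟩ := hsup p.1 q.1 b1 ⟨p.2.val, b2⟩ ⟨q.2.val, b3⟩
        have := relGood_of_super (hvx p b2).1 (hvx q b3).1 (hvx p b2).2 (hvx q b3).2 hθϑ hd hε1 hsr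
        have e : hadj (fun p : PtT m s => p.2.val < sstar p.1) vx G p q =
            fun u v => G.Adj (vx p u) (vx q v) := by
          funext u v
          exact propext ⟨fun h => h b1 b2 b3, fun h _ _ _ => h⟩
        rw [e]
        exact this
      · refine relGood_true hθ0 hθ1 fun u v h1 h2 h3 => ?_
        exact absurd ⟨h1, h2, h3⟩ hb
  have hsw : SwProp (hadj (fun p : PtT m s => p.2.val < sstar p.1) vx G) M (cc θ M (θ / 2)) (θ / 4) :=
    ⟨hM, hc, by positivity, hn1,
      switch_count hε0 hθ0 hθ1 hn1 _ hH M hM hε2 hn2 hn3⟩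
  refine hEx _ (hspread hsw) ?_
  have h3 := omF_lower hsw
  have h4 : (0 : ℝ) < ((OmF (hadj (fun p : PtT m s => p.2.val < sstar p.1) vx G)).card : ℝ) :=
    lt_of_lt_of_le (by positivity) h3
  exact Finset.card_pos.1 (by exact_mod_cast h4)
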